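/- For every K ≥ 1 there exists C(K) ≥ 1 such that for every group G and every finite nonempty subset A ⊆ G with |A·A| ≤ K|A|, there exist a virtually nilpotent subgroup Γ₀ ≤ G and an element g ∈ G with |A ∩ gΓ₀| ≥ |A|/C(K). -/

import Mathlib

open Pointwise

/-- A group is virtually nilpotent if it has a nilpotent subgroup of finite index. -/
def IsVirtuallyNilpotent (G : Type*) [Group G] : Prop :=
  ∃ H : Subgroup G, H.FiniteIndex ∧ Group.IsNilpotent H

section HilbertTrapping

variable {E : Type*} [NormedAddCommGroup E] [InnerProductSpace ℝ E]

/-- Vectors whose iterates under `T` grow at most like `ε ^ m`. -/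
def slowSpace (T : E →L[ℝ] E) (ε : ℝ) : Submodule ℝ E where
  carrier := {v | ∃ C : ℝ, ∀ m : ℕ, ‖(T ^ m) v‖ ≤ C * ε ^ m}
  add_mem' := by
    rintro a b ⟨C, hC⟩ ⟨D, hD⟩
    refine ⟨C + D, fun m => ?_⟩
    rw [map_add, add_mul]
    exact (norm_add_le _ _).trans (add_le_add (hC m) (hD m))
  zero_mem' := ⟨0, fun m => by simp⟩
  smul_mem' := by
    rintro c v ⟨C, hC⟩
    refine ⟨‖c‖ * C, fun m => ?_⟩
    rw [map_smul, norm_smul, mul_assoc]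
    exact mul_le_mul_of_nonneg_left (hC m) (norm_nonneg _)

lemma slowSpace_norm_le {T : E →L[ℝ] E} (hT : ∀ u v, inner ℝ (T u) v = inner ℝ u (T v))
    {ε : ℝ} (hε : 0 < ε) {v : E} (hv : v ∈ slowSpace T ε) : ‖T v‖ ≤ ε * ‖v‖ := by
  obtain ⟨C, hC⟩ := hv
  by_contra! h
  set a : ℕ → ℝ := fun m => ‖(T ^ m) v‖ with ha
  have hconv : ∀ m, a (m + 1) ^ 2 ≤ a m * a (m + 2) := by
    intro m
    have h1 : inner ℝ ((T ^ (m + 1)) v) ((T ^ (m + 1)) v)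
        = inner ℝ ((T ^ m) v) ((T ^ (m + 2)) v) := by
      rw [pow_succ' T m, pow_succ' T (m + 1), pow_succ' T m]
      exact hT _ _
    calc a (m + 1) ^ 2 = inner ℝ ((T ^ (m + 1)) v) ((T ^ (m + 1)) v) :=
          (real_inner_self_eq_norm_sq _).symm
      _ ≤ a m * a (m + 2) := h1 ▸ real_inner_le_norm _ _
  have ha0 : 0 < a 0 := by
    rcases (norm_nonneg v).lt_or_eq with h0 | h0
    · simpa [ha] using h0
    · rw [eq_comm, norm_eq_zero] at h0
      simp [h0] at h
  have hanon : ∀ m, 0 ≤ a m := fun m => norm_nonneg _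
  have hr : ε < a 1 / a 0 := by
    rw [lt_div_iff₀ ha0]; simpa [ha] using h
  set r := a 1 / a 0 with hrdef
  have hr0 : 0 < r := hε.trans hr
  have hstep : ∀ m, 0 < a m ∧ r * a m ≤ a (m + 1) := by
    intro m
    induction m with
    | zero => exact ⟨ha0, by rw [hrdef, div_mul_cancel₀ _ ha0.ne']⟩
    | succ m ih =>
      obtain ⟨h1, h2⟩ := ih
      have h3 : 0 < a (m + 1) := (mul_pos hr0 h1).trans_le h2
      refine ⟨h3, ?_⟩
      have h4 := hconv m
      have h5 : r * a m * a (m + 1) ≤ a m * a (m + 2) := by nlinarith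
      have h6 : a m * (r * a (m + 1)) ≤ a m * a (m + 2) := by linarith
      exact le_of_mul_le_mul_left h6 h1
  have hpow : ∀ m, r ^ m * a 0 ≤ a m := by
    intro m
    induction m with
    | zero => simp
    | succ m ih =>
      calc r ^ (m + 1) * a 0 = r * (r ^ m * a 0) := by ring
        _ ≤ r * a m := mul_le_mul_of_nonneg_left ih hr0.le
        _ ≤ _ := (hstep m).2
  have hq : 1 < r / ε := by rwa [one_lt_div hε]
  obtain ⟨m, hm⟩ := pow_unbounded_of_one_lt (C / a 0) hq
  have h7 : r ^ m * a 0 ≤ C * ε ^ m := (hpow m).trans (hC m)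
  rw [div_pow, div_lt_div_iff₀ ha0 (pow_pos hε m)] at hm
  linarith

variable [CompleteSpace E]

/-- A vector which is orthogonal to the fixed vectors of a group of isometries and is moved by at
most `δ` has norm at most `δ`. -/
lemma norm_le_of_orbit_near {F : Type*} [Group F] (ρ : F → E →L[ℝ] E)
    (hmul : ∀ g h v, ρ (g * h) v = ρ g (ρ h v)) (hone : ∀ v, ρ 1 v = v)
    (hnorm : ∀ g v, ‖ρ g v‖ = ‖v‖) {u : E} {δ : ℝ}
    (horth : ∀ z, (∀ f, ρ f z = z) → inner ℝ z u = 0)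
    (hu : ∀ f, ‖ρ f u - u‖ ≤ δ) : ‖u‖ ≤ δ := by
  set S := closure (convexHull ℝ (Set.range fun f => ρ f u)) with hS
  have hinner : ∀ g x y, inner ℝ (ρ g x) (ρ g y) = inner ℝ x y := by
    intro g x y
    rw [real_inner_eq_norm_add_mul_self_sub_norm_mul_self_sub_norm_mul_self_div_two,
      real_inner_eq_norm_add_mul_self_sub_norm_mul_self_sub_norm_mul_self_div_two, ← map_add,
      hnorm, hnorm, hnorm]
  have hconv : Convex ℝ S := (convex_convexHull ℝ _).closure
  have hne : S.Nonempty := ⟨u, subset_closure (subset_convexHull ℝ _ ⟨1, hone u⟩)⟩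
  have hmaps : ∀ g, Set.MapsTo (ρ g) S S := by
    intro g
    apply Set.MapsTo.closure _ (ρ g).continuous
    rw [Set.mapsTo_iff_image_subset]
    have := (ρ g).toLinearMap.image_convexHull (Set.range fun f => ρ f u)
    rw [ContinuousLinearMap.coe_coe] at this
    rw [this]
    apply convexHull_mono
    rintro _ ⟨_, ⟨f, rfl⟩, rfl⟩
    exact ⟨g * f, hmul g f u⟩
  obtain ⟨p, hpS, hp⟩ := exists_norm_eq_iInf_of_complete_convex hne
    (isClosed_closure.isComplete) hconv 0
  have hp' := (norm_eq_iInf_iff_real_inner_le_zero hconv hpS).1 hp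
  have hfix : ∀ f, ρ f p = p := by
    intro f
    have h1 := hp' _ (hmaps f hpS)
    have h2 : ‖ρ f p - p‖ ^ 2 ≤ 0 := by
      rw [norm_sub_sq_real, hnorm, real_inner_comm]
      rw [zero_sub, inner_neg_left, inner_sub_right, real_inner_self_eq_norm_sq] at h1
      linarith
    have h3 : ‖ρ f p - p‖ = 0 := by
      have := sq_nonneg ‖ρ f p - p‖
      exact pow_eq_zero_iff two_ne_zero |>.1 (le_antisymm h2 this)
    exact sub_eq_zero.1 (norm_eq_zero.1 h3)
  have hp0 : inner ℝ p p = 0 := by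
    have h1 : S ⊆ {x | inner ℝ p x = 0} := by
      have hcl : IsClosed {x | inner ℝ p x = 0} :=
        isClosed_eq (continuous_const.inner continuous_id) continuous_const
      have hcx : Convex ℝ {x | inner ℝ p x = 0} := by
        intro x hx y hy a b _ _ _
        simp only [Set.mem_ofPred_eq] at hx hy ⊢
        rw [inner_add_right, inner_smul_right, inner_smul_right, hx, hy]; simp
      refine closure_minimal (convexHull_min ?_ hcx) hcl
      rintro _ ⟨f, rfl⟩
      have h2 : inner ℝ (ρ f p) (ρ f u) = 0 := by rw [hinner]; exact horth p hfix
      rwa [hfix] at h2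
    exact h1 hpS
  have h2 : S ⊆ Metric.closedBall u δ := by
    refine closure_minimal (convexHull_min ?_ (convex_closedBall u δ)) Metric.isClosed_closedBall
    rintro _ ⟨f, rfl⟩
    simpa [dist_eq_norm] using hu f
  have h3 := h2 hpS
  rw [inner_self_eq_zero] at hp0
  simpa [hp0, dist_eq_norm] using h3

/-- A spectral gap argument: a group of isometries commuting with a self-adjoint operator has a
normal subgroup trapping all nearby subgroups. -/
lemma exists_normal_trapping {H : Type*} [Group H] (ρ : H → E →L[ℝ] E)
    (hmul : ∀ g h v, ρ (g * h) v = ρ g (ρ h v)) (hone : ∀ v, ρ 1 v = v)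
    (hnorm : ∀ g v, ‖ρ g v‖ = ‖v‖) (T : E →L[ℝ] E)
    (hT : ∀ u v, inner ℝ (T u) v = inner ℝ u (T v)) (hcomm : ∀ g v, T (ρ g v) = ρ g (T v))
    {ε : ℝ} (hε : 0 < ε) :
    ∃ N : Subgroup H, N.Normal ∧ (∀ h ∈ N, ∀ v, ‖T (ρ h v - v)‖ ≤ 2 * ε * ‖v‖) ∧
      ∀ W : Set H, (∀ w ∈ W, ∀ v, ‖ρ w (T v) - T v‖ ≤ ε * ‖v‖) →
        ∀ F : Subgroup H, (F : Set H) ⊆ N * W → F ≤ N := by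
  have hinner : ∀ g x y, inner ℝ (ρ g x) (ρ g y) = inner ℝ x y := by
    intro g x y
    rw [real_inner_eq_norm_add_mul_self_sub_norm_mul_self_sub_norm_mul_self_div_two,
      real_inner_eq_norm_add_mul_self_sub_norm_mul_self_sub_norm_mul_self_div_two, ← map_add,
      hnorm, hnorm, hnorm]
  have hadj : ∀ g x y, inner ℝ x (ρ g y) = inner ℝ (ρ g⁻¹ x) y := by
    intro g x y
    rw [← hinner g (ρ g⁻¹ x) y, ← hmul, mul_inv_cancel, hone]
  set E₀ := slowSpace T ε with hE₀
  have hpowcomm : ∀ g v m, (T ^ m) (ρ g v) = ρ g ((T ^ m) v) := by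
    intro g v m
    induction m with
    | zero => simp
    | succ m ih =>
      rw [pow_succ', mul_apply_eq_comp, ih, hcomm, mul_apply_eq_comp]
  have hE₀ρ : ∀ g, ∀ v ∈ E₀, ρ g v ∈ E₀ := by
    rintro g v ⟨C, hC⟩
    exact ⟨C, fun m => by rw [hpowcomm, hnorm]; exact hC m⟩
  have hE₀T : ∀ v ∈ E₀, T v ∈ E₀ := by
    rintro v ⟨C, hC⟩
    refine ⟨C * ε, fun m => ?_⟩
    have := hC (m + 1)
    rw [pow_succ T, mul_apply_eq_comp] at this
    calc _ ≤ _ := this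
      _ = _ := by ring
  have hPρ : ∀ g, ∀ v ∈ E₀ᗮ, ρ g v ∈ E₀ᗮ := by
    intro g v hv
    rw [Submodule.mem_orthogonal] at hv ⊢
    intro u hu
    rw [hadj]
    exact hv _ (hE₀ρ _ _ hu)
  have hPT : ∀ v ∈ E₀ᗮ, T v ∈ E₀ᗮ := by
    intro v hv
    rw [Submodule.mem_orthogonal] at hv ⊢
    intro u hu
    rw [← hT]
    exact hv _ (hE₀T _ hu)
  let N : Subgroup H :=
    { carrier := {h | ∀ v ∈ E₀ᗮ, ρ h v = v}
      mul_mem' := by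
        intro a b ha hb v hv
        rw [hmul, hb v hv, ha v hv]
      one_mem' := fun v _ => hone v
      inv_mem' := by
        intro a ha v hv
        have := ha v hv
        conv_lhs => rw [← this]
        rw [← hmul, inv_mul_cancel, hone] }
  have hN : ∀ h, h ∈ N ↔ ∀ v ∈ E₀ᗮ, ρ h v = v := fun h => Iff.rfl
  refine ⟨N, ⟨?_⟩, ?_, ?_⟩
  · intro n hn g
    rw [hN] at hn ⊢
    intro v hv
    rw [hmul, hmul, hn _ (hPρ _ _ hv), ← hmul, mul_inv_cancel, hone]
  · intro h hh v
    have hclosure : ∀ x ∈ E₀.topologicalClosure, ‖T x‖ ≤ ε * ‖x‖ := by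
      intro x hx
      have hcl : IsClosed {x : E | ‖T x‖ ≤ ε * ‖x‖} :=
        isClosed_le T.continuous.norm (continuous_const.mul continuous_norm)
      exact closure_minimal (fun y hy => slowSpace_norm_le hT hε hy) hcl hx
    have hρclosure : ∀ x ∈ E₀.topologicalClosure, ρ h x ∈ E₀.topologicalClosure := by
      intro x hx
      exact Set.MapsTo.closure (fun y hy => hE₀ρ h y hy) (ρ h).continuous hx
    set K := E₀.topologicalClosure with hK
    have hKo : Kᗮ = E₀ᗮ := Submodule.orthogonal_closure E₀
    have : CompleteSpace K := (Submodule.isClosed_topologicalClosure E₀).completeSpace_coe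
    obtain ⟨e, he, e', he', rfl⟩ := K.exists_add_mem_mem_orthogonal v
    rw [hKo] at he'
    have h1 : ρ h (e + e') - (e + e') = ρ h e - e := by
      rw [map_add, hh e' he']; abel
    rw [h1]
    have h2 : ‖e‖ ≤ ‖e + e'‖ := by
      have := norm_add_sq_eq_norm_sq_add_norm_sq_of_inner_eq_zero e e'
        (by rw [← hKo] at he'; exact he' e he)
      nlinarith [norm_nonneg e, norm_nonneg e', norm_nonneg (e + e')]
    calc ‖T (ρ h e - e)‖ ≤ ε * ‖ρ h e - e‖ := hclosure _ (K.sub_mem (hρclosure e he) he)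
      _ ≤ ε * (‖e‖ + ‖e‖) := by
          gcongr
          exact (norm_sub_le _ _).trans (by rw [hnorm])
      _ ≤ 2 * ε * ‖e + e'‖ := by nlinarith
  · intro W hW F hF h hh v hv
    set P : E → Prop := fun y => y ∈ E₀ᗮ ∧ ∀ z, (∀ f : F, ρ f z = z) → inner ℝ z y = 0 with hP
    have hPT' : ∀ y, P y → P (T y) := by
      rintro y ⟨h1, h2⟩
      refine ⟨hPT y h1, fun z hz => ?_⟩
      rw [← hT]
      exact h2 _ fun f => by rw [← hcomm, hz]
    have hbound : ∀ y, P y → ‖T y‖ ≤ ε * ‖y‖ := by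
      intro y hy
      refine norm_le_of_orbit_near (F := F) (fun f => ρ f) (fun g h v => hmul _ _ _)
        (fun v => hone v) (fun g v => hnorm _ _) (hPT' y hy).2 ?_
      intro f
      obtain ⟨n, hn, w, hw, hnw⟩ := hF f.2
      have : ρ f (T y) = ρ w (T y) := by
        rw [← hnw]
        show ρ (n * w) (T y) = _
        rw [hmul]
        exact hn _ (hPρ _ _ (hPT' y hy).1)
      rw [this]
      exact hW w hw y
    have hy : P (ρ h v - v) := by
      refine ⟨Submodule.sub_mem _ (hPρ h v hv) hv, fun z hz => ?_⟩
      rw [inner_sub_right, hadj]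
      have := hz ⟨h⁻¹, F.inv_mem hh⟩
      simp only at this
      rw [this, sub_self]
    have hiter : ∀ m, P ((T ^ m) (ρ h v - v)) ∧
        ‖(T ^ m) (ρ h v - v)‖ ≤ ‖ρ h v - v‖ * ε ^ m := by
      intro m
      induction m with
      | zero => simpa using hy
      | succ m ih =>
        rw [pow_succ', mul_apply_eq_comp]
        refine ⟨hPT' _ ih.1, (hbound _ ih.1).trans ?_⟩
        calc _ ≤ ε * (‖ρ h v - v‖ * ε ^ m) := by gcongr; exact ih.2
          _ = _ := by ring
    have hmem : ρ h v - v ∈ E₀ := ⟨_, fun m => (hiter m).2⟩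
    have h0 : inner ℝ (ρ h v - v) (ρ h v - v) = 0 := hy.1 _ hmem
    rw [inner_self_eq_zero] at h0
    exact sub_eq_zero.1 h0

lemma exists_normal_trapping_of_commute {H : Type*} [Group H] (ρ : H → E →L[ℝ] E)
    (hmul : ∀ g h v, ρ (g * h) v = ρ g (ρ h v)) (hone : ∀ v, ρ 1 v = v)
    (hnorm : ∀ g v, ‖ρ g v‖ = ‖v‖) (T : E →L[ℝ] E) (hcomm : ∀ g v, T (ρ g v) = ρ g (T v))
    {ε : ℝ} (hε : 0 < ε) :
    ∃ N : Subgroup H, N.Normal ∧ (∀ h ∈ N, ∀ v, ‖T (ρ h v - v)‖ ^ 2 ≤ 4 * ε * ‖v‖ ^ 2) ∧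
      ∀ W : Set H, (∀ w ∈ W, ∀ v, ‖T‖ * ‖ρ w (T v) - T v‖ ≤ ε * ‖v‖) →
        ∀ F : Subgroup H, (F : Set H) ⊆ N * W → F ≤ N := by
  have hinner : ∀ g x y, inner ℝ (ρ g x) (ρ g y) = inner ℝ x y := by
    intro g x y
    rw [real_inner_eq_norm_add_mul_self_sub_norm_mul_self_sub_norm_mul_self_div_two,
      real_inner_eq_norm_add_mul_self_sub_norm_mul_self_sub_norm_mul_self_div_two, ← map_add,
      hnorm, hnorm, hnorm]
  have hadj : ∀ g x y, inner ℝ x (ρ g y) = inner ℝ (ρ g⁻¹ x) y := by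
    intro g x y
    rw [← hinner g (ρ g⁻¹ x) y, ← hmul, mul_inv_cancel, hone]
  have hcomm' : ∀ h φ, T.adjoint (ρ h φ) = ρ h (T.adjoint φ) := by
    intro h φ
    refine ext_inner_left ℝ fun v => ?_
    rw [ContinuousLinearMap.adjoint_inner_right, hadj, hadj,
      ContinuousLinearMap.adjoint_inner_right, hcomm]
  have hinner' : ∀ u v, inner ℝ ((T.adjoint.comp T) u) v = inner ℝ (T u) (T v) := fun u v => by
    rw [ContinuousLinearMap.comp_apply, ContinuousLinearMap.adjoint_inner_left]
  obtain ⟨N, hN, hN1, hN2⟩ := exists_normal_trapping ρ hmul hone hnorm (T.adjoint.comp T)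
    (fun u v => by rw [hinner', real_inner_comm, ← hinner', real_inner_comm])
    (fun g v => by
      rw [ContinuousLinearMap.comp_apply, hcomm, hcomm', ContinuousLinearMap.comp_apply]) hε
  refine ⟨N, hN, fun h hh v => ?_, fun W hW F hF => hN2 W (fun w hw v => ?_) F hF⟩
  · have h4 : ‖ρ h v - v‖ ≤ 2 * ‖v‖ := by
      refine (norm_sub_le _ _).trans ?_
      rw [hnorm]; linarith
    calc _ = inner ℝ ((T.adjoint.comp T) (ρ h v - v)) (ρ h v - v) := by
          rw [hinner', real_inner_self_eq_norm_sq]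
      _ ≤ ‖(T.adjoint.comp T) (ρ h v - v)‖ * ‖ρ h v - v‖ := real_inner_le_norm _ _
      _ ≤ (2 * ε * ‖v‖) * (2 * ‖v‖) := by gcongr; exact hN1 h hh v
      _ = _ := by ring
  · have h2 : ρ w ((T.adjoint.comp T) v) - (T.adjoint.comp T) v
        = T.adjoint (ρ w (T v) - T v) := by
      rw [ContinuousLinearMap.comp_apply, ← hcomm', ← map_sub]
    rw [h2]
    have h1 := T.adjoint.le_opNorm (ρ w (T v) - T v)
    rw [LinearIsometryEquiv.norm_map ContinuousLinearMap.adjoint T] at h1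
    exact h1.trans (hW w hw v)

end HilbertTrapping

section KernelOperator

open MeasureTheory

variable {H : Type*} [TopologicalSpace H] [CompactSpace H] [MeasurableSpace H] [BorelSpace H]
  (μ : Measure H) [IsFiniteMeasure μ]

/-- The map `φ ↦ (x ↦ ⟨Φ x, φ⟩)` from `L²` to continuous functions given by a continuous
kernel. -/
noncomputable def kernelMap (Φ : C(H, Lp ℝ 2 μ)) : Lp ℝ 2 μ →L[ℝ] C(H, ℝ) :=
  LinearMap.mkContinuous
    { toFun := fun φ => (⟨fun x => inner ℝ (Φ x) φ, by fun_prop⟩ : C(H, ℝ))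
      map_add' := fun a b => by ext x; simp [inner_add_right]
      map_smul' := fun c a => by ext x; simp [inner_smul_right] } ‖Φ‖ (fun φ => by
      rw [ContinuousMap.norm_le _ (by positivity)]
      intro x
      exact (norm_inner_le_norm _ _).trans
        (mul_le_mul_of_nonneg_right (Φ.norm_coe_le_norm x) (norm_nonneg _)))

/-- The operator on `L²` given by a continuous kernel. -/
noncomputable def kernelOp (Φ : C(H, Lp ℝ 2 μ)) : Lp ℝ 2 μ →L[ℝ] Lp ℝ 2 μ :=
  (ContinuousMap.toLp 2 μ ℝ).comp (kernelMap μ Φ)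

lemma kernelOp_apply (Φ : C(H, Lp ℝ 2 μ)) (φ : Lp ℝ 2 μ) : kernelOp μ Φ φ =
    ContinuousMap.toLp 2 μ ℝ (⟨fun x => inner ℝ (Φ x) φ, by fun_prop⟩ : C(H, ℝ)) := rfl

lemma norm_kernelOp_sub_le (Φ Ψ : C(H, Lp ℝ 2 μ)) (φ : Lp ℝ 2 μ) :
    ‖kernelOp μ Φ φ - kernelOp μ Ψ φ‖ ≤ ‖ContinuousMap.toLp (E := ℝ) 2 μ ℝ‖ * ‖Φ - Ψ‖ * ‖φ‖ := by
  rw [kernelOp_apply, kernelOp_apply, ← map_sub, mul_assoc]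
  refine (ContinuousLinearMap.le_opNorm _ _).trans ?_
  gcongr
  rw [ContinuousMap.norm_le _ (by positivity)]
  intro x
  rw [ContinuousMap.sub_apply]
  simp only [ContinuousMap.coe_mk]
  rw [← inner_sub_left]
  refine (norm_inner_le_norm _ _).trans ?_
  gcongr
  exact (Φ - Ψ).norm_coe_le_norm x

end KernelOperator

section CompactTrapping

open MeasureTheory Topology

variable {H : Type*} [Group H] [TopologicalSpace H] [IsTopologicalGroup H]
  [MeasurableSpace H] [BorelSpace H]

/-- The left regular representation on `L²` of a compact group. -/
noncomputable def leftReg (μ : Measure H) [μ.IsMulLeftInvariant] (h : H) :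
    Lp ℝ 2 μ →L[ℝ] Lp ℝ 2 μ :=
  (Lp.compMeasurePreservingₗᵢ ℝ (fun y => h⁻¹ * y)
    (measurePreserving_mul_left μ h⁻¹)).toContinuousLinearMap

variable (μ : Measure H) [μ.IsMulLeftInvariant]

lemma norm_leftReg (h : H) (φ : Lp ℝ 2 μ) : ‖leftReg μ h φ‖ = ‖φ‖ :=
  LinearIsometry.norm_map _ φ

lemma coeFn_leftReg (h : H) (φ : Lp ℝ 2 μ) : leftReg μ h φ =ᵐ[μ] fun y => φ (h⁻¹ * y) :=
  Lp.coeFn_compMeasurePreserving φ (measurePreserving_mul_left μ h⁻¹)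

lemma leftReg_one (φ : Lp ℝ 2 μ) : leftReg μ 1 φ = φ := by
  apply Lp.ext
  filter_upwards [coeFn_leftReg μ 1 φ] with x hx
  rw [hx]; simp

lemma leftReg_mul (g h : H) (φ : Lp ℝ 2 μ) :
    leftReg μ (g * h) φ = leftReg μ g (leftReg μ h φ) := by
  apply Lp.ext
  have h1 := (measurePreserving_mul_left μ g⁻¹).quasiMeasurePreserving.ae (coeFn_leftReg μ h φ)
  filter_upwards [coeFn_leftReg μ (g * h) φ, coeFn_leftReg μ g (leftReg μ h φ), h1]
    with x hx1 hx2 hx3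
  rw [hx1, hx2, hx3, mul_inv_rev, mul_assoc]

lemma inner_leftReg (h : H) (x y : Lp ℝ 2 μ) :
    inner ℝ (leftReg μ h x) (leftReg μ h y) = inner ℝ x y :=
  LinearIsometry.inner_map_map _ x y

lemma inner_leftReg_right (h : H) (x y : Lp ℝ 2 μ) :
    inner ℝ x (leftReg μ h y) = inner ℝ (leftReg μ h⁻¹ x) y := by
  rw [← inner_leftReg μ h (leftReg μ h⁻¹ x) y, ← leftReg_mul, mul_inv_cancel, leftReg_one]

variable [CompactSpace H] [IsFiniteMeasure μ]

lemma leftReg_toLp (h : H) (f f' : C(H, ℝ)) (hf : ∀ x, f' x = f (h⁻¹ * x)) :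
    leftReg μ h (ContinuousMap.toLp 2 μ ℝ f) = ContinuousMap.toLp 2 μ ℝ f' := by
  apply Lp.ext
  have h1 := (measurePreserving_mul_left μ h⁻¹).quasiMeasurePreserving.ae
    (ContinuousMap.coeFn_toLp (p := 2) (𝕜 := ℝ) μ f)
  filter_upwards [coeFn_leftReg μ h (ContinuousMap.toLp 2 μ ℝ f),
    ContinuousMap.coeFn_toLp (p := 2) (𝕜 := ℝ) μ f', h1] with x hx1 hx2 hx3
  rw [hx1, hx2, hx3, hf]

omit [MeasurableSpace H] [BorelSpace H] in
/-- Arbitrarily small normal subgroups of a compact group trap all nearby subgroups. -/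
lemma exists_small_normal_trapping {O : Set H} (hO : O ∈ 𝓝 (1 : H)) :
    ∃ N : Subgroup H, N.Normal ∧ (N : Set H) ⊆ O ∧
      ∃ W ∈ 𝓝 (1 : H), ∀ F : Subgroup H, (F : Set H) ⊆ N * W → F ≤ N := by
  borelize H
  let μ : Measure H := Measure.haar
  obtain ⟨V, hV, hVinv, hVO⟩ : ∃ V ∈ 𝓝 (1 : H), V⁻¹ = V ∧ (V * V) * (V * V) ⊆ O := by
    obtain ⟨V₁, h1, h2⟩ := exists_nhds_one_split4 hO
    refine ⟨V₁ ∩ V₁⁻¹, Filter.inter_mem h1 (inv_mem_nhds_one H h1), ?_, ?_⟩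
    · ext x; simp [and_comm]
    · rintro _ ⟨_, ⟨a, ha, b, hb, rfl⟩, _, ⟨c, hc, d, hd, rfl⟩, rfl⟩
      have := h2 ha.1 hb.1 hc.1 hd.1
      simpa [mul_assoc] using this
  obtain ⟨f, hf0, hf1, hfI⟩ : ∃ f : C(H, ℝ), (∀ x, x ∉ V → f x = 0) ∧ f 1 = 1 ∧ ∀ x, 0 ≤ f x := by
    have hcl : closure ({1} : Set H) ⊆ interior V :=
      isCompact_singleton.closure_subset_of_isOpen isOpen_interior
        (by simpa using mem_interior_iff_mem_nhds.2 hV)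
    obtain ⟨f, h0, h1, h2⟩ := exists_continuous_zero_one_of_isClosed
      (isOpen_interior (s := V)).isClosed_compl (isClosed_closure (s := ({1} : Set H)))
      (Set.disjoint_compl_left_iff_subset.2 hcl)
    refine ⟨f, fun x hx => h0 fun h => hx (interior_subset h), ?_, fun x => (h2 x).1⟩
    exact h1 (subset_closure rfl)
  let Φ₀ : C(H, C(H, ℝ)) := ContinuousMap.curry ⟨fun p : H × H => f (p.2⁻¹ * p.1), by fun_prop⟩
  have hΦ₀ : ∀ x y, Φ₀ x y = f (y⁻¹ * x) := fun x y => rfl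
  let Φ : C(H, Lp ℝ 2 μ) :=
    ⟨fun x => ContinuousMap.toLp 2 μ ℝ (Φ₀ x), by fun_prop⟩
  have hΦ : ∀ x, Φ x = ContinuousMap.toLp 2 μ ℝ (Φ₀ x) := fun x => rfl
  have hΦρ : ∀ h x, leftReg μ h (Φ x) = Φ (h * x) := by
    intro h x
    refine leftReg_toLp μ h _ _ fun y => ?_
    rw [hΦ₀, hΦ₀]; congr 1; group
  set T₀ := kernelOp μ Φ with hT₀
  let Ψ : C(H, C(H, Lp ℝ 2 μ)) :=
    ContinuousMap.curry ⟨fun p : H × H => Φ (p.1⁻¹ * p.2), by fun_prop⟩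
  have hΨ : ∀ h φ, leftReg μ h (T₀ φ) = kernelOp μ (Ψ h) φ := by
    intro h φ
    rw [hT₀, kernelOp_apply, kernelOp_apply]
    refine leftReg_toLp μ h _ _ fun x => ?_
    rfl
  have hcomm₀ : ∀ h φ, T₀ (leftReg μ h φ) = leftReg μ h (T₀ φ) := by
    intro h φ
    rw [hΨ, hT₀, kernelOp_apply, kernelOp_apply]
    congr 1
    ext x
    show inner ℝ (Φ x) (leftReg μ h φ) = inner ℝ (Φ (h⁻¹ * x)) φ
    rw [inner_leftReg_right, hΦρ]
  let v := Φ 1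
  let a : C(H, ℝ) := ⟨fun x => inner ℝ (Φ x) v, by fun_prop⟩
  have hv : T₀ v = ContinuousMap.toLp 2 μ ℝ a := rfl
  have ha1 : a 1 ≠ 0 := by
    show inner ℝ (Φ 1) (Φ 1) ≠ (0 : ℝ)
    rw [Ne, inner_self_eq_zero, hΦ]
    intro h0
    have := ContinuousMap.toLp_injective (p := 2) (𝕜 := ℝ) μ (h0.trans (map_zero _).symm)
    have h1 := hΦ₀ 1 1
    rw [this] at h1
    simp [hf1] at h1
  have hasupp : ∀ x, x ∉ V * V → a x = 0 := by
    intro x hx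
    show inner ℝ (Φ x) (Φ 1) = (0 : ℝ)
    rw [L2.inner_def]
    refine integral_eq_zero_of_ae ?_
    filter_upwards [ContinuousMap.coeFn_toLp (p := 2) (𝕜 := ℝ) μ (Φ₀ x),
      ContinuousMap.coeFn_toLp (p := 2) (𝕜 := ℝ) μ (Φ₀ 1)] with y h1 h2
    rw [hΦ, hΦ, h1, h2, hΦ₀, hΦ₀]
    by_cases hy : y⁻¹ * x ∈ V
    · have : y⁻¹ * 1 ∉ V := by
        intro hy'
        apply hx
        rw [mul_one, ← Set.mem_inv, hVinv] at hy'
        exact ⟨y, hy', _, hy, by group⟩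
      rw [hf0 _ this]; simp
    · simp [hf0 _ hy]
  have haLp : ContinuousMap.toLp (E := ℝ) 2 μ ℝ a ≠ 0 := by
    intro h0
    have := ContinuousMap.toLp_injective (p := 2) (𝕜 := ℝ) μ (h0.trans (map_zero _).symm)
    exact ha1 (by rw [this]; rfl)
  set α := ‖ContinuousMap.toLp (E := ℝ) 2 μ ℝ a‖ with hα
  have hα0 : 0 < α := norm_pos_iff.2 haLp
  have hε : 0 < α ^ 2 / (4 * (‖v‖ + 1) ^ 2) := by positivity
  obtain ⟨N, hNn, hN1, hN2⟩ := exists_normal_trapping_of_commute (leftReg μ) (leftReg_mul μ)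
    (leftReg_one μ) (norm_leftReg μ) T₀ hcomm₀ hε
  refine ⟨N, hNn, ?_, ?_⟩
  · intro h hh
    by_contra hhO
    have hdisj : ∀ x, a x ≠ 0 → a (h⁻¹ * x) = 0 := by
      intro x hx
      by_contra hx'
      have h1 : x ∈ V * V := by by_contra h; exact hx (hasupp x h)
      have h2 : h⁻¹ * x ∈ V * V := by by_contra h; exact hx' (hasupp _ h)
      apply hhO
      apply hVO
      refine ⟨x, h1, (h⁻¹ * x)⁻¹, ?_, by simp⟩
      rw [← Set.mem_inv, mul_inv_rev, hVinv]
      exact h2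
    have h1 : ‖T₀ (leftReg μ h v - v)‖ ^ 2 < α ^ 2 := by
      calc _ ≤ 4 * (α ^ 2 / (4 * (‖v‖ + 1) ^ 2)) * ‖v‖ ^ 2 := hN1 h hh v
        _ = α ^ 2 * (‖v‖ ^ 2 / (‖v‖ + 1) ^ 2) := by field_simp
        _ < α ^ 2 * 1 := by
          gcongr
          rw [div_lt_one (by positivity)]
          have := norm_nonneg v
          gcongr
          linarith
        _ = _ := mul_one _
    have h5 : α ≤ ‖T₀ (leftReg μ h v - v)‖ := by
      let a' : C(H, ℝ) := ⟨fun x => a (h⁻¹ * x), by fun_prop⟩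
      have h6 : T₀ (leftReg μ h v - v) = ContinuousMap.toLp 2 μ ℝ (a' - a) := by
        rw [map_sub, hcomm₀, hv, leftReg_toLp μ h a a' fun x => rfl, map_sub]
      rw [h6, hα]
      refine Lp.norm_le_norm_of_ae_le ?_
      filter_upwards [ContinuousMap.coeFn_toLp (p := 2) (𝕜 := ℝ) μ a,
        ContinuousMap.coeFn_toLp (p := 2) (𝕜 := ℝ) μ (a' - a)] with x h1 h2
      rw [h1, h2]
      by_cases hx : a x = 0
      · simp [hx]
      · have : a' x = 0 := hdisj x hx
        simp [this]
    nlinarith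
  · set ε := α ^ 2 / (4 * (‖v‖ + 1) ^ 2) with hεdef
    set c := ‖T₀‖ * ‖ContinuousMap.toLp (E := ℝ) 2 μ ℝ‖ + 1 with hc
    have hc0 : 0 < c := by positivity
    have hΨ1 : Ψ 1 = Φ := by
      ext1 x
      show Φ (1⁻¹ * x) = Φ x
      simp
    have hW : {w | ‖Ψ w - Φ‖ < ε / c} ∈ 𝓝 (1 : H) := by
      apply IsOpen.mem_nhds
      · exact isOpen_lt (by fun_prop) continuous_const
      · simp only [Set.mem_ofPred_eq, hΨ1, sub_self, norm_zero]; positivity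
    refine ⟨_, hW, fun F hF => hN2 _ (fun w hw φ => ?_) F hF⟩
    rw [hΨ]
    have hw' : ‖Ψ w - Φ‖ ≤ ε / c := le_of_lt hw
    calc _ ≤ ‖T₀‖ * (‖ContinuousMap.toLp (E := ℝ) 2 μ ℝ‖ * ‖Ψ w - Φ‖ * ‖φ‖) :=
          by
          gcongr; exact norm_kernelOp_sub_le μ _ _ _
      _ = (‖T₀‖ * ‖ContinuousMap.toLp (E := ℝ) 2 μ ℝ‖) * ‖Ψ w - Φ‖ * ‖φ‖ := by ring
      _ ≤ c * (ε / c) * ‖φ‖ := by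
          gcongr
          linarith
      _ = ε * ‖φ‖ := by rw [mul_div_cancel₀ _ hc0.ne']

end CompactTrapping

section Ultraproduct

open Filter

/-- A fixed nonprincipal ultrafilter on the natural numbers. -/
noncomputable abbrev ultra : Ultrafilter ℕ := hyperfilter ℕ

lemma ultra_eventually_ge (N : ℕ) : ∀ᶠ n in ultra, N ≤ n :=
  Nat.hyperfilter_le_atTop (eventually_ge_atTop N)

/-- The subset of the product given by a sequence of subsets of the factors. -/
def internalSet {G : ℕ → Type*} (A : ∀ n, Set (G n)) : Set (∀ n, G n) :=
  {x | ∀ᶠ n in ultra, x n ∈ A n}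

/-- Countable saturation. -/
lemma exists_of_finitely_satisfiable {α : ℕ → Type*} [∀ n, Nonempty (α n)]
    (P : ℕ → ∀ n, α n → Prop)
    (h : ∀ k, ∀ᶠ n in ultra, ∃ x, ∀ i ≤ k, P i n x) :
    ∃ x : ∀ n, α n, ∀ i, ∀ᶠ n in ultra, P i n (x n) := by
  classical
  have key : ∀ n, ∃ x : α n, ∀ k ≤ n, (∃ y, ∀ i ≤ k, P i n y) → ∀ i ≤ k, P i n x := by
    intro n
    by_cases h0 : ∃ y, ∀ i ≤ 0, P i n y
    · set k := Nat.findGreatest (fun k => ∃ y, ∀ i ≤ k, P i n y) n with hk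
      have : ∃ y, ∀ i ≤ k, P i n y :=
        Nat.findGreatest_spec (P := fun k => ∃ y, ∀ i ≤ k, P i n y) (Nat.zero_le n) h0
      obtain ⟨y, hy⟩ := this
      refine ⟨y, fun l hl hex i hi => hy i (hi.trans ?_)⟩
      exact Nat.le_findGreatest (P := fun k => ∃ y, ∀ i ≤ k, P i n y) hl hex
    · refine ⟨Classical.arbitrary _, fun k _ hex => ?_⟩
      obtain ⟨y, hy⟩ := hex
      exact absurd ⟨y, fun i hi => hy i (by omega)⟩ h0
  choose x hx using key
  refine ⟨x, fun i => ?_⟩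
  filter_upwards [h i, ultra_eventually_ge i] with n h1 h2
  exact hx n i h2 h1 i le_rfl

variable {G : ℕ → Type*}

lemma mem_internalSet {A : ∀ n, Set (G n)} {x : ∀ n, G n} :
    x ∈ internalSet A ↔ ∀ᶠ n in ultra, x n ∈ A n := Iff.rfl

lemma internalSet_mono {A B : ∀ n, Set (G n)} (h : ∀ᶠ n in ultra, A n ⊆ B n) :
    internalSet A ⊆ internalSet B := by
  intro x hx
  filter_upwards [h, hx] with n h1 h2 using h1 h2

lemma eventually_of_forall_internal [∀ n, Nonempty (G n)] {P : ∀ n, G n → Prop}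
    (h : ∀ x : ∀ n, G n, ∀ᶠ n in ultra, P n (x n)) : ∀ᶠ n in ultra, ∀ y, P n y := by
  classical
  have : ∀ n, ∃ y, P n y → ∀ z, P n z := fun n => by
    by_cases hc : ∀ z, P n z
    · exact ⟨Classical.arbitrary _, fun _ => hc⟩
    · push Not at hc
      obtain ⟨z, hz⟩ := hc
      exact ⟨z, fun h => absurd h hz⟩
  choose x hx using this
  filter_upwards [h x] with n hn using hx n hn

lemma eventually_subset_of_internalSet [∀ n, Nonempty (G n)] {A B : ∀ n, Set (G n)}
    (h : internalSet A ⊆ internalSet B) : ∀ᶠ n in ultra, A n ⊆ B n := by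
  refine eventually_of_forall_internal (P := fun n y => y ∈ A n → y ∈ B n) fun x => ?_
  rw [Ultrafilter.eventually_imp]
  exact fun hx => h hx

lemma internalSet_inter (A B : ∀ n, Set (G n)) :
    internalSet (fun n => A n ∩ B n) = internalSet A ∩ internalSet B := by
  ext x
  exact eventually_and

variable [∀ n, Group (G n)]

lemma internalSet_mul (A B : ∀ n, Set (G n)) :
    internalSet (fun n => A n * B n) = internalSet A * internalSet B := by
  classical
  apply Set.Subset.antisymm
  · intro x hx
    have : ∀ n, ∃ a b, x n ∈ A n * B n → a ∈ A n ∧ b ∈ B n ∧ a * b = x n := by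
      intro n
      by_cases h : x n ∈ A n * B n
      · obtain ⟨a, ha, b, hb, hab⟩ := h
        exact ⟨a, b, fun _ => ⟨ha, hb, hab⟩⟩
      · exact ⟨1, 1, fun h' => absurd h' h⟩
    choose a b hab using this
    refine ⟨a, ?_, fun n => (a n)⁻¹ * x n, ?_, by ext n; simp⟩
    · filter_upwards [hx] with n hn using (hab n hn).1
    · filter_upwards [hx] with n hn
      rw [← (hab n hn).2.2]
      simpa using (hab n hn).2.1
  · rintro _ ⟨a, ha, b, hb, rfl⟩
    filter_upwards [ha, hb] with n h1 h2 using ⟨_, h1, _, h2, rfl⟩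

lemma internalSet_inv (A : ∀ n, Set (G n)) :
    internalSet (fun n => (A n)⁻¹) = (internalSet A)⁻¹ := by
  ext x
  simp only [Set.mem_inv, mem_internalSet, Pi.inv_apply]

lemma exists_internal_cover {G : ℕ → Type*} [∀ n, Group (G n)] {A B : ∀ n, Set (G n)} {m : ℕ}
    (hm : ∀ᶠ n in ultra, ∃ X : Finset (G n), X.card ≤ m ∧ A n ⊆ X * B n) :
    ∃ X : Finset (∀ n, G n), X.card ≤ m ∧ internalSet A ⊆ X * internalSet B := by
  classical
  have : ∀ n, ∃ f : Fin m → G n, (∃ X : Finset (G n), X.card ≤ m ∧ A n ⊆ X * B n) →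
      ∀ x ∈ A n, ∃ j, (f j)⁻¹ * x ∈ B n := by
    intro n
    by_cases h : ∃ X : Finset (G n), X.card ≤ m ∧ A n ⊆ X * B n
    · obtain ⟨X, hX, hsub⟩ := h
      refine ⟨fun j => if hj : (j : ℕ) < X.card then X.equivFin.symm ⟨j, hj⟩ else 1,
        fun _ x hx => ?_⟩
      obtain ⟨a, ha, b, hb, rfl⟩ := hsub hx
      refine ⟨⟨X.equivFin ⟨a, ha⟩, (X.equivFin ⟨a, ha⟩).2.trans_le hX⟩, ?_⟩
      simpa using hb
    · exact ⟨fun _ => 1, fun h' => absurd h' h⟩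
  choose f hf using this
  refine ⟨Finset.univ.image fun j n => f n j, Finset.card_image_le.trans (by simp), fun x hx => ?_⟩
  have h1 : ∀ᶠ n in ultra, ∃ j, (f n j)⁻¹ * x n ∈ B n := by
    filter_upwards [hm, hx] with n h1 h2 using hf n h1 _ h2
  obtain ⟨j, hj⟩ := Ultrafilter.eventually_exists_iff.1 h1
  exact ⟨fun n => f n j, by simp, (fun n => f n j)⁻¹ * x, hj, by simp⟩

/-- A shrinking sequence of finite symmetric sets in an ultraproduct that behaves like a
neighbourhood basis of the identity in a locally compact group. -/
structure GoodChain (S : ℕ → ∀ n, Set (G n)) : Prop where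
  one : ∀ k, ∀ᶠ n in ultra, 1 ∈ S k n
  inv : ∀ k, ∀ᶠ n in ultra, (S k n)⁻¹ = S k n
  mul : ∀ k, ∀ᶠ n in ultra, S (k + 1) n * S (k + 1) n ⊆ S k n
  conj : ∀ k, ∀ᶠ n in ultra, ∀ a ∈ S 0 n, ∀ s ∈ S (k + 1) n, a * s * a⁻¹ ∈ S k n
  fin : ∀ᶠ n in ultra, (S 0 n).Finite
  cover : ∀ k, ∃ m : ℕ, ∀ᶠ n in ultra, ∃ X : Finset (G n), X.card ≤ m ∧ S 0 n ⊆ X * S k n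

namespace GoodChain

variable {S : ℕ → ∀ n, Set (G n)} (hS : GoodChain S)
include hS

lemma one_mem (k : ℕ) : (1 : ∀ n, G n) ∈ internalSet (S k) := hS.one k

lemma inv_mem {k : ℕ} {x : ∀ n, G n} (hx : x ∈ internalSet (S k)) : x⁻¹ ∈ internalSet (S k) := by
  filter_upwards [hS.inv k, hx] with n h1 h2
  rw [← h1]
  simpa using h2

lemma mul_mem {k : ℕ} {x y : ∀ n, G n} (hx : x ∈ internalSet (S (k + 1)))
    (hy : y ∈ internalSet (S (k + 1))) : x * y ∈ internalSet (S k) := by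
  filter_upwards [hS.mul k, hx, hy] with n h1 h2 h3 using h1 ⟨_, h2, _, h3, rfl⟩

lemma conj_mem {k : ℕ} {a x : ∀ n, G n} (ha : a ∈ internalSet (S 0))
    (hx : x ∈ internalSet (S (k + 1))) : a * x * a⁻¹ ∈ internalSet (S k) := by
  filter_upwards [hS.conj k, ha, hx] with n h1 h2 h3 using h1 _ h2 _ h3

lemma eventually_anti {k l : ℕ} (h : k ≤ l) : ∀ᶠ n in ultra, S l n ⊆ S k n := by
  induction l, h using Nat.le_induction with
  | base => exact Eventually.of_forall fun n => subset_rfl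
  | succ l _ ih =>
    filter_upwards [ih, hS.mul l, hS.one (l + 1)] with n h1 h2 h3
    exact fun x hx => h1 (h2 ⟨x, hx, 1, h3, mul_one x⟩)

lemma anti {k l : ℕ} (h : k ≤ l) : internalSet (S l) ⊆ internalSet (S k) :=
  internalSet_mono (hS.eventually_anti h)

lemma mul_mem_of_lt {k l : ℕ} (h : k < l) {x y : ∀ n, G n} (hx : x ∈ internalSet (S l))
    (hy : y ∈ internalSet (S l)) : x * y ∈ internalSet (S k) :=
  hS.mul_mem (hS.anti h hx) (hS.anti h hy)

lemma eventually_pow (k r : ℕ) : ∀ᶠ n in ultra, S (k + r) n ^ (2 ^ r) ⊆ S k n := by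
  induction r with
  | zero => simp
  | succ r ih =>
    filter_upwards [ih, hS.mul (k + r)] with n h1 h2
    rw [pow_succ', pow_mul, pow_two]
    exact (Set.pow_subset_pow_left h2).trans h1

lemma exists_cover (k : ℕ) :
    ∃ X : Finset (∀ n, G n), internalSet (S 0) ⊆ X * internalSet (S k) := by
  obtain ⟨m, hm⟩ := hS.cover k
  obtain ⟨X, -, hX⟩ := exists_internal_cover hm
  exact ⟨X, hX⟩

/-- Every external subset is approximated from outside by an internal one. -/
lemma exists_hull {A : Set (∀ n, G n)} (hA : A ⊆ internalSet (S 0)) (b : ℕ) :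
    ∃ D : ∀ n, Set (G n), A ⊆ internalSet D ∧ internalSet D ⊆ A * internalSet (S b) := by
  classical
  obtain ⟨X, hX⟩ := hS.exists_cover (b + 1)
  let Y := X.filter fun x => ∃ a ∈ A, x⁻¹ * a ∈ internalSet (S (b + 1))
  refine ⟨fun n => ⋃ x ∈ Y, {y | (x n)⁻¹ * y ∈ S (b + 1) n}, fun a ha => ?_, fun d hd => ?_⟩
  · obtain ⟨x, hx, s, hs, hxs⟩ := hX (hA ha)
    have h1 : x⁻¹ * a ∈ internalSet (S (b + 1)) := by rw [← hxs]; simpa using hs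
    have hxY : x ∈ Y := Finset.mem_filter.2 ⟨hx, a, ha, h1⟩
    filter_upwards [h1] with n hn
    simp only [Set.mem_iUnion]
    exact ⟨x, hxY, hn⟩
  · have h1 : ∀ᶠ n in ultra, ∃ x : Y, (x.1 n)⁻¹ * d n ∈ S (b + 1) n := by
      filter_upwards [hd] with n hn
      simp only [Set.mem_iUnion] at hn
      obtain ⟨x, hx, hn⟩ := hn
      exact ⟨⟨x, hx⟩, hn⟩
    obtain ⟨⟨x, hx⟩, hxd⟩ := Ultrafilter.eventually_exists_iff.1 h1
    obtain ⟨_, a, ha, hxa⟩ := Finset.mem_filter.1 hx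
    refine ⟨a, ha, a⁻¹ * d, ?_, by simp⟩
    have : a⁻¹ * d = (x⁻¹ * a)⁻¹ * (x⁻¹ * d) := by group
    rw [this]
    exact hS.mul_mem (hS.inv_mem hxa) hxd

end GoodChain

end Ultraproduct

section Trap

open Filter Topology

variable {G : ℕ → Type*} [∀ n, Group (G n)]

namespace GoodChain

variable {S : ℕ → ∀ n, Set (G n)} (hS : GoodChain S)

/-- The closure of a subgroup in the topology given by a chain. -/
def closure (H : Subgroup (∀ n, G n)) (hH : (H : Set (∀ n, G n)) ⊆ internalSet (S 0)) :
    Subgroup (∀ n, G n) where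
  carrier := {x | ∀ k, ∃ h ∈ H, h⁻¹ * x ∈ internalSet (S k)}
  one_mem' := fun k => ⟨1, H.one_mem, by simpa using hS.one_mem k⟩
  mul_mem' := by
    intro x y hx hy k
    obtain ⟨h, hh, h1⟩ := hx (k + 2)
    obtain ⟨h', hh', h2⟩ := hy (k + 1)
    refine ⟨h * h', H.mul_mem hh hh', ?_⟩
    have h3 := hS.mul_mem (hS.conj_mem (hH (H.inv_mem hh')) h1) h2
    convert h3 using 1
    group
  inv_mem' := by
    intro x hx k
    obtain ⟨h, hh, h1⟩ := hx (k + 1)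
    refine ⟨h⁻¹, H.inv_mem hh, ?_⟩
    have h3 := hS.conj_mem (hH hh) (hS.inv_mem h1)
    convert h3 using 1
    group

lemma le_closure (H : Subgroup (∀ n, G n)) (hH : (H : Set (∀ n, G n)) ⊆ internalSet (S 0)) :
    H ≤ hS.closure H hH :=
  fun h hh k => ⟨h, hh, by simpa using hS.one_mem k⟩

lemma closure_subset (H : Subgroup (∀ n, G n)) {j : ℕ}
    (hH : (H : Set (∀ n, G n)) ⊆ internalSet (S (j + 1))) :
    (hS.closure H (hH.trans (hS.anti (Nat.zero_le _))) : Set (∀ n, G n)) ⊆ internalSet (S j) := by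
  intro x hx
  obtain ⟨h, hh, h1⟩ := hx (j + 1)
  have := hS.mul_mem (hH hh) h1
  simpa using this

/-- A subgroup contained in the chain is a topological group. -/
@[reducible] def filterBasis (K : Subgroup (∀ n, G n))
    (hK : (K : Set (∀ n, G n)) ⊆ internalSet (S 0)) : GroupFilterBasis K where
  sets := Set.range fun k => {x : K | (x : ∀ n, G n) ∈ internalSet (S k)}
  nonempty := Set.range_nonempty _
  inter_sets := by
    rintro _ _ ⟨k, rfl⟩ ⟨l, rfl⟩
    refine ⟨_, ⟨max k l, rfl⟩, fun x hx => ⟨?_, ?_⟩⟩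
    · exact hS.anti (le_max_left k l) hx
    · exact hS.anti (le_max_right k l) hx
  one' := by
    rintro _ ⟨k, rfl⟩
    exact hS.one_mem k
  mul' := by
    rintro _ ⟨k, rfl⟩
    refine ⟨_, ⟨k + 1, rfl⟩, ?_⟩
    rintro _ ⟨x, hx, y, hy, rfl⟩
    exact hS.mul_mem hx hy
  inv' := by
    rintro _ ⟨k, rfl⟩
    exact ⟨_, ⟨k, rfl⟩, fun x hx => hS.inv_mem hx⟩
  conj' := by
    rintro x₀ _ ⟨k, rfl⟩
    exact ⟨_, ⟨k + 1, rfl⟩, fun x hx => hS.conj_mem (hK x₀.2) hx⟩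

lemma compactSpace_closure (H : Subgroup (∀ n, G n))
    (hH : (H : Set (∀ n, G n)) ⊆ internalSet (S 0))
    (hK : (hS.closure H hH : Set (∀ n, G n)) ⊆ internalSet (S 0)) :
    @CompactSpace (hS.closure H hH) (hS.filterBasis _ hK).topology := by
  classical
  let B := hS.filterBasis _ hK
  let _ := B.topology
  constructor
  rw [isCompact_iff_ultrafilter_le_nhds]
  intro 𝓕 _
  have hc : ∀ k, ∃ c : ∀ n, G n,
      {x : hS.closure H hH | c⁻¹ * (x : ∀ n, G n) ∈ internalSet (S k)} ∈ 𝓕 := by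
    intro k
    obtain ⟨X, hX⟩ := hS.exists_cover k
    have h1 : ∀ᶠ x : hS.closure H hH in 𝓕, ∃ c : X, c.1⁻¹ * (x : ∀ n, G n) ∈ internalSet (S k) := by
      refine Eventually.of_forall fun x => ?_
      obtain ⟨c, hc, s, hs, hcs⟩ := hX (hK x.2)
      refine ⟨⟨c, hc⟩, ?_⟩
      rw [← hcs]; simpa using hs
    obtain ⟨c, hc⟩ := Ultrafilter.eventually_exists_iff.1 h1
    exact ⟨c, hc⟩
  choose c hc using hc
  obtain ⟨x, hx⟩ := exists_of_finitely_satisfiable (α := G)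
    (fun k n y => (c k n)⁻¹ * y ∈ S k n) (by
      intro k
      have h1 : ∀ᶠ x : hS.closure H hH in 𝓕, ∀ i ∈ Finset.range (k + 1),
          (c i)⁻¹ * (x : ∀ n, G n) ∈ internalSet (S i) :=
        (eventually_all_finset _).2 fun i _ => hc i
      obtain ⟨x, hx⟩ := h1.exists
      have h2 : ∀ᶠ n in ultra, ∀ i ∈ Finset.range (k + 1), (c i n)⁻¹ * (x : ∀ n, G n) n ∈ S i n :=
        (eventually_all_finset _).2 fun i hi => hx i hi
      filter_upwards [h2] with n hn
      exact ⟨_, fun i hi => hn i (Finset.mem_range.2 (by omega))⟩)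
  have hx' : ∀ k, (c k)⁻¹ * x ∈ internalSet (S k) := hx
  have hlim : ∀ k, ∀ y : hS.closure H hH, (c (k + 1))⁻¹ * (y : ∀ n, G n) ∈ internalSet (S (k + 1)) →
      x⁻¹ * (y : ∀ n, G n) ∈ internalSet (S k) := by
    intro k y hy
    have := hS.mul_mem (hS.inv_mem (hx' (k + 1))) hy
    convert this using 1
    group
  have hxK : x ∈ hS.closure H hH := by
    intro k
    obtain ⟨y, hy⟩ := Ultrafilter.nonempty_of_mem (hc (k + 2))
    obtain ⟨h, hh, h1⟩ := y.2 (k + 1)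
    refine ⟨h, hh, ?_⟩
    have := hS.mul_mem h1 (hS.inv_mem (hlim (k + 1) y hy))
    convert this using 1
    group
  refine ⟨⟨x, hxK⟩, trivial, ?_⟩
  rw [(B.nhds_hasBasis _).ge_iff]
  rintro _ ⟨k, rfl⟩
  filter_upwards [hc (k + 1)] with y hy
  exact ⟨⟨x, hxK⟩⁻¹ * y, hlim k y hy, by simp⟩

include hS in
/-- Subgroups inside a good chain have small subgroups trapping all their nearby subgroups. -/
lemma exists_trapping_subgroup (H : Subgroup (∀ n, G n))
    (hH : (H : Set (∀ n, G n)) ⊆ internalSet (S 1)) (k : ℕ) :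
    ∃ N : Subgroup (∀ n, G n), (N : Set (∀ n, G n)) ⊆ internalSet (S k) ∧ ∃ w,
      ∀ F : Subgroup (∀ n, G n), F ≤ H → (F : Set (∀ n, G n)) ⊆ N * internalSet (S w) → F ≤ N := by
  have hH0 := hH.trans (hS.anti (Nat.zero_le _))
  have hK := hS.closure_subset H hH
  set K := hS.closure H hH0 with hKdef
  let B := hS.filterBasis K hK
  let _ := B.topology
  have : CompactSpace K := hS.compactSpace_closure H hH0 hK
  have hO : {x : K | (x : ∀ n, G n) ∈ internalSet (S k)} ∈ 𝓝 (1 : K) :=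
    B.nhds_one_hasBasis.mem_of_mem (i := {x : K | (x : ∀ n, G n) ∈ internalSet (S k)}) ⟨k, rfl⟩
  obtain ⟨N, -, hN1, W, hW, hN2⟩ := exists_small_normal_trapping hO
  obtain ⟨_, ⟨w, rfl⟩, hwW⟩ := B.nhds_one_hasBasis.mem_iff.1 hW
  refine ⟨N.map K.subtype, ?_, w, fun F hF hFN => ?_⟩
  · rintro _ ⟨x, hx, rfl⟩
    exact hN1 hx
  · have hFK : F ≤ K := hF.trans (hS.le_closure H hH0)
    have h1 := hN2 (F.subgroupOf K) (by
      intro f hf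
      obtain ⟨_, ⟨n, hn, rfl⟩, s, hs, hns⟩ := hFN hf
      refine ⟨n, hn, n⁻¹ * f, hwW ?_, by simp⟩
      have : ((n⁻¹ * f : K) : ∀ n, G n) = s := by
        rw [Subgroup.coe_mul, Subgroup.coe_inv, eq_comm, eq_inv_mul_iff_mul_eq]
        exact hns
      show ((n⁻¹ * f : K) : ∀ n, G n) ∈ internalSet (S w)
      rw [this]; exact hs)
    intro f hf
    exact ⟨⟨f, hFK hf⟩, h1 (by exact hf), rfl⟩

end GoodChain

end Trap

section Words

variable {G : Type*} [Group G]

/-- Elements whose first `n` powers lie in `V`. -/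
def Qset (V : Set G) (n : ℕ) : Set G := {g | ∀ k ≤ n, g ^ k ∈ V}

/-- `Word V L i x` means that `x` is a product of elements `g` with total cost at most `i / L`,
where an element whose first `n` powers lie in `V` costs `1 / n`. -/
inductive Word (V : Set G) (L : ℕ) : ℕ → G → Prop
  | one (i : ℕ) : Word V L i 1
  | cons {g x : G} {n c i : ℕ} (hg : g ∈ Qset V n) (hc : L ≤ c * n) (hx : Word V L i x) :
      Word V L (i + c) (g * x)

namespace Word

variable {V : Set G} {L : ℕ}

lemma mono {i j : ℕ} {x : G} (h : Word V L i x) (hij : i ≤ j) : Word V L j x := by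
  induction h generalizing j with
  | one => exact one j
  | @cons g x n c i hg hc hx ih =>
    obtain ⟨d, rfl⟩ := Nat.exists_eq_add_of_le hij
    rw [show i + c + d = i + d + c by ring]
    exact cons hg hc (ih (Nat.le_add_right _ _))

lemma mul {i j : ℕ} {x y : G} (hx : Word V L i x) (hy : Word V L j y) :
    Word V L (i + j) (x * y) := by
  induction hx with
  | one i => simpa using hy.mono (Nat.le_add_left _ _)
  | @cons g x n c i hg hc hx ih =>
    rw [mul_assoc, show i + c + j = i + j + c by ring]
    exact cons hg hc ih

lemma of_mem {g : G} {n c : ℕ} (hg : g ∈ Qset V n) (hc : L ≤ c * n) : Word V L c g := by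
  simpa using cons hg hc (one 0)

lemma inv (hV : V⁻¹ = V) {i : ℕ} {x : G} (hx : Word V L i x) : Word V L i x⁻¹ := by
  induction hx with
  | one i => simpa using one i
  | @cons g x n c i hg hc hx ih =>
    rw [mul_inv_rev]
    refine mul ih (of_mem (n := n) (fun k hk => ?_) hc)
    rw [inv_pow, ← Set.mem_inv, hV]
    exact hg k hk

lemma subset {V' : Set G} (hV : V ⊆ V') {i : ℕ} {x : G} (hx : Word V L i x) : Word V' L i x := by
  induction hx with
  | one i => exact one i
  | cons hg hc _ ih => exact cons (fun k hk => hV (hg k hk)) hc ih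

lemma mem_of_le_one (hV : 1 ∈ V) (hL : 1 ≤ L) {i : ℕ} {x : G} (hx : Word V L i x) :
    (i = 0 → x = 1) ∧ (i = 1 → x ∈ V) := by
  induction hx with
  | one i => exact ⟨fun _ => rfl, fun _ => hV⟩
  | @cons g x n c i hg hc hx ih =>
    have hc0 : c ≠ 0 := by rintro rfl; omega
    have hn0 : n ≠ 0 := by rintro rfl; omega
    refine ⟨by omega, fun h => ?_⟩
    rw [ih.1 (by omega), mul_one]
    simpa using hg 1 (by omega)

end Word

end Words

section Bump

open Classical in
/-- The average of the indicator functions of the first `R` sets of a sequence. -/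
noncomputable def bump {G : Type*} (E : ℕ → Set G) (R : ℕ) (x : G) : ℝ :=
  ((Finset.range R).filter fun i => x ∈ E i).card / (R : ℝ)

variable {G : Type*}

lemma bump_nonneg (E : ℕ → Set G) (R : ℕ) (x : G) : 0 ≤ bump E R x := by
  unfold bump; positivity

open Classical in
lemma bump_le_one (E : ℕ → Set G) (R : ℕ) (x : G) : bump E R x ≤ 1 := by
  unfold bump
  refine div_le_one_of_le₀ ?_ (by positivity)
  exact_mod_cast (Finset.card_filter_le _ _).trans (by simp)

open Classical in
lemma bump_eq_one {E : ℕ → Set G} {R : ℕ} (hR : 1 ≤ R) {x : G} (h : ∀ i < R, x ∈ E i) :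
    bump E R x = 1 := by
  unfold bump
  rw [Finset.filter_true_of_mem (by simpa using h), Finset.card_range]
  exact div_self (by positivity)

open Classical in
lemma exists_mem_of_bump_ne_zero {E : ℕ → Set G} {R : ℕ} {x : G} (h : bump E R x ≠ 0) :
    ∃ i < R, x ∈ E i := by
  by_contra! hc
  apply h
  unfold bump
  rw [Finset.filter_false_of_mem (by simpa using hc)]
  simp

open Classical in
lemma bump_le_add {E : ℕ → Set G} {R c : ℕ} {x y : G} (h : ∀ i, x ∈ E i → y ∈ E (i + c)) :
    bump E R x ≤ bump E R y + c / R := by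
  unfold bump
  rw [← add_div]
  refine div_le_div_of_nonneg_right ?_ (by positivity)
  have h1 : (((Finset.range R).filter fun i => x ∈ E i).map (addRightEmbedding c)) ⊆
      ((Finset.range R).filter fun i => y ∈ E i) ∪ Finset.Ico R (R + c) := by
    intro j hj
    simp only [Finset.mem_map, Finset.mem_filter, Finset.mem_range, addRightEmbedding_apply] at hj
    obtain ⟨i, ⟨hi, hxi⟩, rfl⟩ := hj
    simp only [Finset.mem_union, Finset.mem_filter, Finset.mem_range, Finset.mem_Ico]
    by_cases hic : i + c < R
    · exact Or.inl ⟨hic, h i hxi⟩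
    · exact Or.inr ⟨by omega, by omega⟩
  have h2 := (Finset.card_le_card h1).trans (Finset.card_union_le _ _)
  rw [Finset.card_map, Nat.card_Ico, Nat.add_sub_cancel_left] at h2
  exact_mod_cast h2

lemma abs_bump_sub_le {E : ℕ → Set G} {R c : ℕ} {x y : G} (h : ∀ i, x ∈ E i → y ∈ E (i + c))
    (h' : ∀ i, y ∈ E i → x ∈ E (i + c)) : |bump E R x - bump E R y| ≤ c / R := by
  rw [abs_le]
  constructor <;> linarith [bump_le_add (R := R) h, bump_le_add (R := R) h']

end Bump

section Convolution

variable {G : Type*} [Group G]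

/-- The convolution of `ψ`, supported in `D`, with `η`. -/
def convOn (D : Finset G) (ψ η : G → ℝ) (x : G) : ℝ := ∑ y ∈ D, ψ y * η (y⁻¹ * x)

variable {D : Finset G} {ψ η : G → ℝ}

lemma abs_convOn_sub_le (hψ : ∀ y, |ψ y| ≤ 1) {h : G} {b : ℝ}
    (hη : ∀ y ∈ D, ∀ z, |η z - η ((y⁻¹ * h * y)⁻¹ * z)| ≤ b) (x : G) :
    |convOn D ψ η x - convOn D ψ η (h⁻¹ * x)| ≤ D.card * b := by
  unfold convOn
  rw [← Finset.sum_sub_distrib, ← nsmul_eq_mul]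
  refine (Finset.abs_sum_le_sum_abs _ _).trans (Finset.sum_le_card_nsmul _ _ _ fun y hy => ?_)
  rw [← mul_sub, abs_mul]
  have h1 := hη y hy (y⁻¹ * x)
  rw [show (y⁻¹ * h * y)⁻¹ * (y⁻¹ * x) = y⁻¹ * (h⁻¹ * x) by group] at h1
  exact (mul_le_of_le_one_left (abs_nonneg _) (hψ y)).trans h1

lemma card_le_convOn_one {Y' : Finset G} (hψ : ∀ y, 0 ≤ ψ y) (hη : ∀ y, 0 ≤ η y) (hY : Y' ⊆ D)
    (hψ1 : ∀ y ∈ Y', ψ y = 1) (hη1 : ∀ y ∈ Y', η y⁻¹ = 1) : (Y'.card : ℝ) ≤ convOn D ψ η 1 := by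
  calc (Y'.card : ℝ) = ∑ y ∈ Y', ψ y * η (y⁻¹ * 1) := by
        rw [Finset.card_eq_sum_ones, Nat.cast_sum]
        exact Finset.sum_congr rfl fun y hy => by simp [hψ1 y hy, hη1 y hy]
    _ ≤ _ := Finset.sum_le_sum_of_subset_of_nonneg hY fun y _ _ => mul_nonneg (hψ _) (hη _)

variable [DecidableEq G]

lemma convOn_sub (hD : ∀ y, y ∉ D → ψ y = 0) (g x : G) :
    convOn D ψ η x - convOn D ψ η (g⁻¹ * x) =
      ∑ y ∈ D ∪ D.image (g * ·), (ψ y - ψ (g⁻¹ * y)) * η (y⁻¹ * x) := by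
  unfold convOn
  simp_rw [sub_mul]
  rw [Finset.sum_sub_distrib]
  congr 1
  · refine Finset.sum_subset Finset.subset_union_left fun y _ hy => ?_
    rw [hD y hy, zero_mul]
  · rw [← Finset.sum_subset (Finset.subset_union_right (s₁ := D)), Finset.sum_image]
    · refine Finset.sum_congr rfl fun y _ => ?_
      rw [inv_mul_cancel_left, mul_inv_rev, mul_assoc]
    · exact fun a _ b _ h => mul_left_cancel h
    · intro y _ hy
      rw [hD, zero_mul]
      intro hy'
      exact hy (Finset.mem_image.2 ⟨_, hy', by simp⟩)

lemma abs_second_difference_le (hD : ∀ y, y ∉ D → ψ y = 0) {g h : G} {a b : ℝ} (ha : 0 ≤ a)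
    (hψ : ∀ y, |ψ y - ψ (g⁻¹ * y)| ≤ a)
    (hη : ∀ y ∈ D ∪ D.image (g * ·), ∀ z, |η z - η ((y⁻¹ * h * y)⁻¹ * z)| ≤ b) (x : G) :
    |(convOn D ψ η x - convOn D ψ η (g⁻¹ * x)) -
      (convOn D ψ η (h⁻¹ * x) - convOn D ψ η (g⁻¹ * (h⁻¹ * x)))| ≤ 2 * D.card * (a * b) := by
  rw [convOn_sub hD, convOn_sub hD, ← Finset.sum_sub_distrib]
  have hcard : (D ∪ D.image (g * ·)).card ≤ 2 * D.card := by
    refine (Finset.card_union_le _ _).trans ?_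
    rw [two_mul]
    exact Nat.add_le_add_left Finset.card_image_le _
  by_cases hne : (D ∪ D.image (g * ·)).Nonempty
  · obtain ⟨y₀, hy₀⟩ := hne
    have hb : 0 ≤ b := (abs_nonneg _).trans (hη y₀ hy₀ 1)
    calc _ ≤ (D ∪ D.image (g * ·)).card • (a * b) := by
          refine (Finset.abs_sum_le_sum_abs _ _).trans
            (Finset.sum_le_card_nsmul _ _ _ fun y hy => ?_)
          rw [← mul_sub, abs_mul]
          have h1 := hη y hy (y⁻¹ * x)
          rw [show (y⁻¹ * h * y)⁻¹ * (y⁻¹ * x) = y⁻¹ * (h⁻¹ * x) by group] at h1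
          exact mul_le_mul (hψ y) h1 (abs_nonneg _) ha
      _ ≤ _ := by
          rw [nsmul_eq_mul]
          have : ((D ∪ D.image (g * ·)).card : ℝ) ≤ 2 * D.card := by exact_mod_cast hcard
          exact mul_le_mul_of_nonneg_right this (by positivity)
  · rw [Finset.not_nonempty_iff_eq_empty] at hne
    have hD0 : D = ∅ := Finset.subset_empty.1 (hne ▸ Finset.subset_union_left)
    rw [hne]; simp [hD0]

end Convolution

section Gleason

variable {G : Type*} [Group G]

lemma inv_mem_Qset {V : Set G} (hV : V⁻¹ = V) {n : ℕ} {g : G} (hg : g ∈ Qset V n) :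
    g⁻¹ ∈ Qset V n := fun k hk => by
  rw [inv_pow, ← Set.mem_inv, hV]
  exact hg k hk

/-- The products of a word of cost at most `i` with an element of `Y`. -/
def wordMul (V : Set G) (L : ℕ) (Y : Set G) (i : ℕ) : Set G := {x | Word V L i x} * Y

lemma mul_mem_wordMul {V Y : Set G} {L n c i : ℕ} {g y : G} (hg : g ∈ Qset V n)
    (hc : L ≤ c * n) (hy : y ∈ wordMul V L Y i) : g * y ∈ wordMul V L Y (i + c) := by
  obtain ⟨x, hx, y, hy, rfl⟩ := hy
  exact ⟨g * x, Word.cons hg hc hx, y, hy, mul_assoc _ _ _⟩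

lemma abs_bump_wordMul_sub_le {V Y : Set G} (hV : V⁻¹ = V) {L n c R : ℕ} {g : G}
    (hg : g ∈ Qset V n) (hc : L ≤ c * n) (y : G) :
    |bump (wordMul V L Y) R y - bump (wordMul V L Y) R (g⁻¹ * y)| ≤ c / R := by
  refine abs_bump_sub_le (fun i hi => mul_mem_wordMul (inv_mem_Qset hV hg) hc hi) fun i hi => ?_
  simpa using mul_mem_wordMul hg hc hi

lemma exists_of_convOn_ne_zero {D : Finset G} {ψ η : G → ℝ} {x : G} (h : convOn D ψ η x ≠ 0) :
    ∃ y ∈ D, ψ y ≠ 0 ∧ η (y⁻¹ * x) ≠ 0 := by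
  obtain ⟨y, hy, hy0⟩ := Finset.exists_ne_zero_of_sum_ne_zero h
  exact ⟨y, hy, left_ne_zero_of_mul hy0, right_ne_zero_of_mul hy0⟩

lemma natCast_mul_sub_eq (φ : G → ℝ) (g x : G) (n : ℕ) :
    n * (φ x - φ (g⁻¹ * x)) = (φ x - φ ((g ^ n)⁻¹ * x)) +
      ∑ i ∈ Finset.range n, ((φ x - φ (g⁻¹ * x)) -
        (φ ((g ^ i)⁻¹ * x) - φ (g⁻¹ * ((g ^ i)⁻¹ * x)))) := by
  have h : ∀ i, φ (g⁻¹ * ((g ^ i)⁻¹ * x)) = φ ((g ^ (i + 1))⁻¹ * x) := fun i => by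
    rw [pow_succ, mul_inv_rev, mul_assoc]
  simp_rw [h]
  rw [Finset.sum_sub_distrib, Finset.sum_range_sub' (fun i => φ ((g ^ i)⁻¹ * x))]
  simp [mul_sub]

/-- If the words of cost at most `m` are well controlled, then doubling the cost only enlarges
the set of words by a small neighbourhood. -/
lemma word_two_mul_subset {V : Set G} (hV : V⁻¹ = V) {L m R : ℕ} (hm : 1 ≤ m) (hmL : m ≤ L)
    (hR : 1 ≤ R) {Y Z : Set G} (hZ : Z⁻¹ = Z) (hZ1 : 1 ∈ Z) {Y' D : Finset G}
    (hY' : ∀ y ∈ Y', y⁻¹ ∈ Y') (hYY : (Y' : Set G) ⊆ Y)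
    (hZY : ∀ i < R, Z ^ i * (Y' : Set G) ⊆ Y)
    (hD : wordMul V L Y m ⊆ D) (hVZ : ∀ v ∈ V, ∀ y ∈ D, y⁻¹ * v * y ∈ Z)
    (hcard : 6 * D.card < R * Y'.card) {x : G} (hx : Word V L (2 * m) x) :
    x ∈ wordMul V L (Y * Y) m := by
  classical
  set ψ := bump (wordMul V L Y) m with hψ
  set η := bump (fun i => Z ^ i * (Y' : Set G)) R with hη
  set φ := convOn D ψ η with hφ
  have hm0 : (0 : ℝ) < m := by exact_mod_cast hm
  have hR0 : (0 : ℝ) < R := by exact_mod_cast hR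
  have hmono : ∀ i < m, wordMul V L Y i ⊆ wordMul V L Y m := fun i hi =>
    Set.mul_subset_mul_right fun z hz => Word.mono hz hi.le
  have hψD : ∀ y, y ∉ D → ψ y = 0 := by
    intro y hy
    by_contra h
    obtain ⟨i, hi, hyi⟩ := exists_mem_of_bump_ne_zero h
    exact hy (hD (hmono i hi hyi))
  have hψ1 : ∀ y, |ψ y| ≤ 1 := fun y => by
    rw [abs_of_nonneg (bump_nonneg _ _ _)]; exact bump_le_one _ _ _
  have hη1 : ∀ z ∈ Z, ∀ y, |η y - η (z⁻¹ * y)| ≤ 1 / R := by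
    have key : ∀ z ∈ Z, ∀ i, ∀ y ∈ Z ^ i * (Y' : Set G), z * y ∈ Z ^ (i + 1) * (Y' : Set G) := by
      intro z hz i y hy
      rw [pow_succ', mul_assoc]
      exact Set.mul_mem_mul hz hy
    intro z hz y
    have := abs_bump_sub_le (E := fun i => Z ^ i * (Y' : Set G)) (R := R) (c := 1) (x := y)
      (y := z⁻¹ * y) (fun i hi => key _ (by rwa [← Set.mem_inv, hZ]) i _ hi)
      (fun i hi => by simpa using key _ hz i _ hi)
    simpa using this
  have hone : ∀ (g : G) (n c : ℕ), g ∈ Qset V n → L ≤ c * n → ∀ z,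
      |φ z - φ (g⁻¹ * z)| ≤ c * (3 * D.card / (m * R)) := by
    intro g n c hg hc z
    have hn : 1 ≤ n := by
      rcases Nat.eq_zero_or_pos n with rfl | h
      · omega
      · exact h
    have hn0 : (0 : ℝ) < n := by exact_mod_cast hn
    have h1 : |φ z - φ ((g ^ n)⁻¹ * z)| ≤ D.card * (1 / R) :=
      abs_convOn_sub_le hψ1 (fun y hy w => hη1 _ (hVZ _ (hg n le_rfl) y hy) w) z
    have h2 : ∀ i ∈ Finset.range n, |(φ z - φ (g⁻¹ * z)) -
        (φ ((g ^ i)⁻¹ * z) - φ (g⁻¹ * ((g ^ i)⁻¹ * z)))| ≤ 2 * D.card * (c / m * (1 / R)) := by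
      intro i hi
      have hi' : i ≤ n := (Finset.mem_range.1 hi).le
      refine abs_second_difference_le hψD (by positivity)
        (fun y => abs_bump_wordMul_sub_le hV hg hc y) (fun y hy w => hη1 _ ?_ w) z
      rcases Finset.mem_union.1 hy with hy | hy
      · exact hVZ _ (hg i hi') y hy
      · obtain ⟨y', hy', rfl⟩ := Finset.mem_image.1 hy
        have : (g * y')⁻¹ * g ^ i * (g * y') = y'⁻¹ * g ^ i * y' := by
          have h3 : g ^ i * g = g * g ^ i := by rw [← pow_succ, ← pow_succ']
          simp only [mul_inv_rev, mul_assoc]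
          rw [← mul_assoc (g ^ i) g, h3]
          group
        rw [this]
        exact hVZ _ (hg i hi') y' hy'
    have h3 := natCast_mul_sub_eq φ g z n
    have h4 : n * |φ z - φ (g⁻¹ * z)| ≤
        D.card * (1 / R) + n * (2 * D.card * (c / m * (1 / R))) := by
      rw [← abs_of_pos hn0, ← abs_mul, abs_of_pos hn0, h3]
      refine (abs_add_le _ _).trans (add_le_add h1 ?_)
      refine (Finset.abs_sum_le_sum_abs _ _).trans ((Finset.sum_le_card_nsmul _ _ _ h2).trans ?_)
      simp
    have h5 : (m : ℝ) ≤ c * n := by exact_mod_cast hmL.trans hc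
    have h6 : (1 : ℝ) ≤ n * (c / m) := by
      rw [← mul_div_assoc, le_div_iff₀ hm0]; linarith
    have h7 : (0 : ℝ) ≤ D.card * (1 / R) := by positivity
    have h8 := mul_le_mul_of_nonneg_left h6 h7
    refine le_of_mul_le_mul_left ?_ hn0
    calc n * |φ z - φ (g⁻¹ * z)| ≤ _ := h4
      _ ≤ D.card * (1 / R) * (n * (c / m)) + n * (2 * D.card * (c / m * (1 / R))) := by linarith
      _ = _ := by field_simp; ring
  have hword : ∀ (i : ℕ) (w : G), Word V L i w → ∀ z,
      |φ z - φ (w⁻¹ * z)| ≤ i * (3 * D.card / (m * R)) := by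
    intro i w hw
    induction hw with
    | one i => intro z; simp; positivity
    | @cons g w n c i hg hc hw ih =>
      intro z
      have h1 := hone g n c hg hc z
      have h2 := ih (g⁻¹ * z)
      rw [mul_inv_rev, mul_assoc]
      push_cast
      calc _ = |(φ z - φ (g⁻¹ * z)) + (φ (g⁻¹ * z) - φ (w⁻¹ * (g⁻¹ * z)))| := by ring_nf
        _ ≤ _ := (abs_add_le _ _).trans (by linarith)
  have hx1 : |φ x - φ 1| ≤ 6 * D.card / R := by
    have := hword _ x hx x
    rw [inv_mul_cancel] at this
    refine this.trans (le_of_eq ?_)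
    push_cast
    field_simp; ring
  have hsub : Y' ⊆ D := fun y hy => hD ⟨1, Word.one m, y, hYY hy, one_mul y⟩
  have hφ1 : (Y'.card : ℝ) ≤ φ 1 := by
    refine card_le_convOn_one (fun y => bump_nonneg _ _ _) (fun y => bump_nonneg _ _ _) hsub ?_ ?_
    · exact fun y hy => bump_eq_one hm fun i _ => ⟨1, Word.one i, y, hYY hy, one_mul y⟩
    · exact fun y hy => bump_eq_one hR fun i _ =>
        ⟨1, Set.one_mem_pow hZ1, y⁻¹, hY' y hy, one_mul _⟩
  have hlt : 6 * D.card / (R : ℝ) < Y'.card := by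
    rw [div_lt_iff₀ hR0]
    have : ((6 * D.card : ℕ) : ℝ) < ((R * Y'.card : ℕ) : ℝ) := by exact_mod_cast hcard
    push_cast at this; linarith
  have hne : φ x ≠ 0 := by
    intro h0
    rw [h0, zero_sub, abs_neg] at hx1
    linarith [le_abs_self (φ 1)]
  obtain ⟨y, -, hy1, hy2⟩ := exists_of_convOn_ne_zero hne
  obtain ⟨i, hi, hyi⟩ := exists_mem_of_bump_ne_zero hy1
  obtain ⟨j, hj, hyj⟩ := exists_mem_of_bump_ne_zero hy2
  have h1 := hmono i hi hyi
  have h2 := hZY j hj hyj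
  rw [wordMul, ← mul_assoc]
  exact ⟨y, h1, y⁻¹ * x, h2, by simp⟩

/-- Powers of a commutator `(h * g * h⁻¹ * g⁻¹)` stay controlled up to an exponent comparable to the
product of the escape times of `g` and `h`. -/
lemma commutator_pow_mem {V V' : Set G} (hV : V⁻¹ = V) (hV' : V'⁻¹ = V') {p q : ℕ} (hp : 1 ≤ p)
    (hq : 1 ≤ q) {g h : G} (hg : g ∈ Qset V p) (hh : h ∈ Qset V q) {Y' D : Finset G}
    (hY' : ∀ y ∈ Y', y⁻¹ ∈ Y') (hD : wordMul V (p * q) Y' (p * q) ⊆ D)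
    (hVV : ∀ v ∈ V, ∀ y ∈ D, y⁻¹ * v * y ∈ V')
    (hVVg : ∀ v ∈ V, ∀ a ∈ V, ∀ y ∈ D, (a * y)⁻¹ * v * (a * y) ∈ V') {l : ℕ}
    (hcard : 4 * l * D.card < p * q * Y'.card) :
    (h * g * h⁻¹ * g⁻¹) ^ l ∈ wordMul V (p * q) Y' (p * q) * wordMul V' (p * q) Y' (p * q) := by
  classical
  set L := p * q with hL
  have hL1 : 1 ≤ L := Nat.mul_pos hp hq
  have hp0 : (0 : ℝ) < p := by exact_mod_cast hp
  have hq0 : (0 : ℝ) < q := by exact_mod_cast hq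
  set ψ := bump (wordMul V L Y') L with hψ
  set η := bump (wordMul V' L Y') L with hη
  set φ := convOn D ψ η with hφ
  have hmono : ∀ (W : Set G), ∀ i < L, wordMul W L Y' i ⊆ wordMul W L Y' L := fun W i hi =>
    Set.mul_subset_mul_right fun z hz => Word.mono hz hi.le
  have hψD : ∀ y, y ∉ D → ψ y = 0 := by
    intro y hy
    by_contra h
    obtain ⟨i, hi, hyi⟩ := exists_mem_of_bump_ne_zero h
    exact hy (hD (hmono V i hi hyi))
  have key : ∀ (p q : ℕ) (g h : G), L = p * q → 1 ≤ p → 1 ≤ q → g ∈ Qset V p → h ∈ Qset V q →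
      ∀ x, |(φ x - φ (g⁻¹ * x)) - (φ (h⁻¹ * x) - φ (g⁻¹ * (h⁻¹ * x)))| ≤
        2 * D.card * (1 / L) := by
    intro p q g h hpq hp hq hg hh x
    have hp0 : (0 : ℝ) < p := by exact_mod_cast hp
    have hq0 : (0 : ℝ) < q := by exact_mod_cast hq
    have hconj : ∀ y ∈ D ∪ D.image (g * ·), y⁻¹ * h * y ∈ Qset V' q := by
      intro y hy k hk
      have : (y⁻¹ * h * y) ^ k = y⁻¹ * h ^ k * y := by
        simpa using (conj_pow (i := k) (a := y⁻¹) (b := h))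
      rw [this]
      rcases Finset.mem_union.1 hy with hy | hy
      · exact hVV _ (hh k hk) y hy
      · obtain ⟨y', hy', rfl⟩ := Finset.mem_image.1 hy
        exact hVVg _ (hh k hk) g (by simpa using hg 1 hp) y' hy'
    have := abs_second_difference_le (ψ := ψ) (η := η) hψD (g := g) (h := h) (a := (q : ℝ) / L)
      (b := (p : ℝ) / L) (by positivity)
      (fun y => abs_bump_wordMul_sub_le hV hg (by rw [hpq, mul_comm]) y)
      (fun y hy z => abs_bump_wordMul_sub_le hV' (hconj y hy) hpq.le z) x
    refine this.trans (le_of_eq ?_)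
    rw [hpq]; push_cast; field_simp
  have hcomm : ∀ w, |φ w - φ ((h * g * h⁻¹ * g⁻¹) * w)| ≤ 4 * D.card / L := by
    intro w
    have h1 := key p q g⁻¹ h⁻¹ hL hp hq (inv_mem_Qset hV hg) (inv_mem_Qset hV hh) (h⁻¹ * g⁻¹ * w)
    have h2 := key q p h⁻¹ g⁻¹ (hL.trans (mul_comm _ _)) hq hp (inv_mem_Qset hV hh)
      (inv_mem_Qset hV hg) (h⁻¹ * g⁻¹ * w)
    have e1 : g⁻¹⁻¹ * (h⁻¹⁻¹ * (h⁻¹ * g⁻¹ * w)) = w := by group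
    have e2 : h⁻¹⁻¹ * (g⁻¹⁻¹ * (h⁻¹ * g⁻¹ * w)) = (h * g * h⁻¹ * g⁻¹) * w := by
      group
    rw [e1] at h1
    rw [e2] at h2
    rw [abs_le] at h1 h2 ⊢
    have e3 : 4 * (D.card : ℝ) / L = 2 * D.card * (1 / L) + 2 * D.card * (1 / L) := by ring
    rw [e3]
    constructor <;> linarith
  have hpow : ∀ k : ℕ, |φ 1 - φ ((h * g * h⁻¹ * g⁻¹) ^ k)| ≤ k * (4 * D.card / L) := by
    intro k
    induction k with
    | zero => simp
    | succ k ih =>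
      have h1 := hcomm ((h * g * h⁻¹ * g⁻¹) ^ k)
      rw [← pow_succ'] at h1
      push_cast
      calc _ = |(φ 1 - φ ((h * g * h⁻¹ * g⁻¹) ^ k)) +
            (φ ((h * g * h⁻¹ * g⁻¹) ^ k) - φ ((h * g * h⁻¹ * g⁻¹) ^ (k + 1)))| := by ring_nf
        _ ≤ _ := (abs_add_le _ _).trans (by linarith)
  have hsub : Y' ⊆ D := fun y hy => hD ⟨1, Word.one _, y, hy, one_mul y⟩
  have hφ1 : (Y'.card : ℝ) ≤ φ 1 := by
    refine card_le_convOn_one (fun y => bump_nonneg _ _ _) (fun y => bump_nonneg _ _ _) hsub ?_ ?_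
    · exact fun y hy => bump_eq_one hL1 fun i _ => ⟨1, Word.one i, y, hy, one_mul y⟩
    · exact fun y hy => bump_eq_one hL1 fun i _ => ⟨1, Word.one i, y⁻¹, hY' y hy, one_mul _⟩
  have hlt : l * (4 * D.card / (L : ℝ)) < Y'.card := by
    rw [← mul_div_assoc, div_lt_iff₀ (by exact_mod_cast hL1)]
    have : ((4 * l * D.card : ℕ) : ℝ) < ((p * q * Y'.card : ℕ) : ℝ) := by exact_mod_cast hcard
    rw [hL]
    push_cast at this ⊢; linarith
  have hne : φ ((h * g * h⁻¹ * g⁻¹) ^ l) ≠ 0 := by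
    intro h0
    have := hpow l
    rw [h0, sub_zero] at this
    linarith [le_abs_self (φ 1)]
  obtain ⟨y, -, hy1, hy2⟩ := exists_of_convOn_ne_zero hne
  obtain ⟨i, hi, hyi⟩ := exists_mem_of_bump_ne_zero hy1
  obtain ⟨j, hj, hyj⟩ := exists_mem_of_bump_ne_zero hy2
  exact ⟨y, hmono V i hi hyi, y⁻¹ * _, hmono V' j hj hyj, by simp⟩

end Gleason

section Trapping

open Filter

variable {G : ℕ → Type*} [∀ n, Group (G n)]

lemma exists_forall_of_eventually_exists {α : ℕ → Type*} [∀ n, Nonempty (α n)]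
    {P : ∀ n, α n → Prop} (h : ∀ᶠ n in ultra, ∃ x, P n x) :
    ∃ x : ∀ n, α n, ∀ᶠ n in ultra, P n (x n) := by
  obtain ⟨x, hx⟩ := exists_of_finitely_satisfiable (fun _ => P) fun _ =>
    h.mono fun n ⟨x, hx⟩ => ⟨x, fun _ _ => hx⟩
  exact ⟨x, hx 0⟩

lemma exists_last_subset {α : Type*} {E : ℕ → Set α} {S : Set α} {L : ℕ} (h1 : E 1 ⊆ S)
    (hE : ∀ i j, i ≤ j → E i ⊆ E j) (hL : ¬ E L ⊆ S) :
    ∃ m, 1 ≤ m ∧ m < L ∧ E m ⊆ S ∧ ¬ E (m + 1) ⊆ S := by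
  classical
  have hex : ∃ l, ¬ E l ⊆ S := ⟨L, hL⟩
  have h2 : 1 < Nat.find hex := by
    by_contra h
    exact Nat.find_spec hex ((hE _ _ (not_lt.1 h)).trans h1)
  refine ⟨Nat.find hex - 1, by omega, ?_, ?_, ?_⟩
  · have := Nat.find_min' hex hL
    omega
  · by_contra h
    have := Nat.find_min' hex h
    omega
  · rw [Nat.sub_add_cancel h2.le]
    exact Nat.find_spec hex

lemma word_mono {G : Type*} [Group G] (V : Set G) (L : ℕ) (i j : ℕ) (h : i ≤ j) :
    {x | Word V L i x} ⊆ {x | Word V L j x} := fun _ hx => Word.mono hx h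

namespace GoodChain

variable {S : ℕ → ∀ n, Set (G n)} (hS : GoodChain S)
include hS

lemma eventually_ncard_le (k : ℕ) :
    ∃ M : ℕ, ∀ᶠ n in ultra, (S 0 n).ncard ≤ M * (S k n).ncard := by
  obtain ⟨M, hM⟩ := hS.cover k
  refine ⟨M, ?_⟩
  filter_upwards [hM, hS.fin, hS.eventually_anti (Nat.zero_le k)] with n h1 h2 h3
  obtain ⟨X, hX, hsub⟩ := h1
  calc (S 0 n).ncard ≤ ((X : Set (G n)) * S k n).ncard :=
        Set.ncard_le_ncard hsub (X.finite_toSet.mul (h2.subset h3))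
    _ ≤ (X : Set (G n)).ncard * (S k n).ncard := Set.natCard_mul_le
    _ ≤ _ := by rw [Set.ncard_coe_finset]; gcongr

lemma eventually_ncard_pos (k : ℕ) : ∀ᶠ n in ultra, 0 < (S k n).ncard := by
  filter_upwards [hS.fin, hS.eventually_anti (Nat.zero_le k), hS.one k] with n h1 h2 h3
  exact (Set.ncard_pos (h1.subset h2)).2 ⟨1, h3⟩

lemma eventually_word_two_mul_subset {V : ∀ n, Set (G n)} {L m : ℕ → ℕ}
    (hV : ∀ i, ∀ᶠ n in ultra, V n ⊆ S i n) (hVinv : ∀ᶠ n in ultra, (V n)⁻¹ = V n)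
    (hm : ∀ᶠ n in ultra, 1 ≤ m n) (hmL : ∀ᶠ n in ultra, m n ≤ L n)
    (hE : ∀ᶠ n in ultra, {x | Word (V n) (L n) (m n) x} ⊆ S 1 n) (i : ℕ) :
    ∀ᶠ n in ultra, {x | Word (V n) (L n) (2 * m n) x} ⊆ wordMul (V n) (L n) (S i n) (m n) := by
  obtain ⟨M, hM⟩ := hS.eventually_ncard_le (i + 2)
  obtain ⟨r, hr⟩ : ∃ r : ℕ, 6 * M < 2 ^ r := ⟨6 * M, Nat.lt_two_pow_self⟩
  filter_upwards [hV (i + 2 + r + 1), hVinv, hm, hmL, hE, hM, hS.eventually_pow (i + 2) r,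
    hS.inv (i + 2 + r), hS.one (i + 2 + r), hS.inv (i + 2), hS.mul (i + 1), hS.mul i,
    hS.conj (i + 2 + r), hS.inv 0, hS.mul 0,
    hS.eventually_anti (Nat.le_add_left 1 i), hS.eventually_anti (Nat.zero_le (i + 2)),
    hS.fin, hS.eventually_ncard_pos (i + 2), hS.one (i + 2)]
    with n h1 h2 h3 h4 h5 h6 h7 h8 h9 h10 h11
    h12 h13 h14 h15 h16 h17 h18 h19 h20 x hx
  have hDsub : wordMul (V n) (L n) (S (i + 1) n) (m n) ⊆ S 0 n :=
    (Set.mul_subset_mul h5 h16).trans h15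
  have hDfin : (wordMul (V n) (L n) (S (i + 1) n) (m n)).Finite := h18.subset hDsub
  have hYfin : (S (i + 2) n).Finite := h18.subset h17
  have := word_two_mul_subset h2 h3 h4 (R := 2 ^ r) (Nat.one_le_two_pow) h8 h9
    (Y := S (i + 1) n) (Y' := hYfin.toFinset) (D := hDfin.toFinset)
    (fun y hy => ?_) ?_ ?_ ?_ ?_ ?_ hx
  · exact Set.mul_subset_mul_left h12 this
  · rw [Set.Finite.mem_toFinset] at hy ⊢
    rw [← h10]
    simpa using hy
  · rw [Set.Finite.coe_toFinset]
    exact fun y hy => h11 ⟨1, h20, y, hy, one_mul y⟩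
  · intro j hj
    rw [Set.Finite.coe_toFinset]
    exact (Set.mul_subset_mul_right ((Set.pow_subset_pow_right h9 hj.le).trans h7)).trans h11
  · rw [Set.Finite.coe_toFinset]
  · intro v hv y hy
    rw [Set.Finite.mem_toFinset] at hy
    have hy' : y⁻¹ ∈ S 0 n := by rw [← h14]; simpa using hDsub hy
    simpa using h13 _ hy' _ (h1 hv)
  · rw [← Set.ncard_eq_toFinset_card _ hDfin, ← Set.ncard_eq_toFinset_card _ hYfin]
    calc _ ≤ 6 * (M * (S (i + 2) n).ncard) :=
          Nat.mul_le_mul_left 6 ((Set.ncard_le_ncard hDsub h18).trans h6)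
      _ = 6 * M * (S (i + 2) n).ncard := (mul_assoc _ _ _).symm
      _ < _ := Nat.mul_lt_mul_of_pos_right hr h19

lemma exists_word_subgroup {V : ∀ n, Set (G n)} {L m : ℕ → ℕ}
    (hV : ∀ i, ∀ᶠ n in ultra, V n ⊆ S i n) (hVinv : ∀ᶠ n in ultra, (V n)⁻¹ = V n)
    (hm : ∀ᶠ n in ultra, 1 ≤ m n) (hmL : ∀ᶠ n in ultra, m n ≤ L n)
    (hE : ∀ᶠ n in ultra, {x | Word (V n) (L n) (m n) x} ⊆ S 1 n) :
    ∃ H : Subgroup (∀ n, G n),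
      (∀ x, x ∈ H ↔ ∀ i, x ∈ internalSet fun n => wordMul (V n) (L n) (S i n) (m n)) ∧
      internalSet (fun n => {x | Word (V n) (L n) (2 * m n) x}) ⊆ H := by
  have hdbl := hS.eventually_word_two_mul_subset hV hVinv hm hmL hE
  refine ⟨{ carrier := {x | ∀ i, x ∈ internalSet fun n => wordMul (V n) (L n) (S i n) (m n)}
            one_mem' := fun i => ?_
            mul_mem' := fun {x y} hx hy i => ?_
            inv_mem' := fun {x} hx i => ?_ }, fun x => Iff.rfl, fun x hx i => ?_⟩
  · filter_upwards [hx (i + 3), hy (i + 3), hdbl (i + 1), hS.mul i, hS.mul (i + 1),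
      hS.conj (i + 2), hS.inv 0, hE, hS.eventually_anti (Nat.zero_le 1),
      hS.eventually_anti (Nat.le_succ (i + 2))] with n h1 h2 h3 h4 h5 h6 h7 h8 h9 h10
    obtain ⟨e, he, s, hs, hes⟩ := h1
    obtain ⟨f, hf, t, ht, hft⟩ := h2
    have hf' : f⁻¹ ∈ S 0 n := by rw [← h7]; simpa using h9 (h8 hf)
    have hc : f⁻¹ * s * f ∈ S (i + 2) n := by simpa using h6 _ hf' _ hs
    have hst : f⁻¹ * s * f * t ∈ S (i + 1) n := h5 ⟨_, hc, _, h10 ht, rfl⟩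
    obtain ⟨a, ha, u, hu, hau⟩ := h3 (show Word (V n) (L n) (2 * m n) (e * f) by
      rw [two_mul]; exact Word.mul he hf)
    refine ⟨a, ha, u * (f⁻¹ * s * f * t), h4 ⟨_, hu, _, hst, rfl⟩, ?_⟩
    simp only [Pi.mul_apply, ← hes, ← hft] at hau ⊢
    rw [← mul_assoc, hau]
    group
  · filter_upwards [hS.one i] with n h1
    exact ⟨1, Word.one _, 1, h1, mul_one 1⟩
  · filter_upwards [hx (i + 1), hS.inv (i + 1), hS.conj i, hE,
      hS.eventually_anti (Nat.zero_le 1), hVinv] with n h1 h2 h3 h4 h5 h6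
    obtain ⟨e, he, s, hs, hes⟩ := h1
    refine ⟨e⁻¹, Word.inv h6 he, e * s⁻¹ * e⁻¹, h3 _ (h5 (h4 he)) _ ?_, ?_⟩
    · rw [← h2]; simpa using hs
    · simp only [Pi.inv_apply, ← hes]
      group
  · filter_upwards [hx, hdbl i] with n h1 h2 using h2 h1

/-- Words whose cost is at most one, in elements whose escape time is measured by a deep
member of the chain, cannot leave a given member of the chain. -/
theorem exists_forall_word_mem (k : ℕ) :
    ∃ j, ∀ᶠ n in ultra, ∀ L, 1 ≤ L → ∀ x, Word (S j n) L L x → x ∈ S k n := by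
  wlog hk : 2 ≤ k generalizing k
  · obtain ⟨j, hj⟩ := this 2 le_rfl
    refine ⟨j, ?_⟩
    filter_upwards [hj, hS.eventually_anti (show k ≤ 2 by omega)] with n h1 h2
    exact fun L hL x hx => h2 (h1 L hL x hx)
  by_contra! hcon
  obtain ⟨VL, hVL⟩ := exists_of_finitely_satisfiable (α := fun n => Set (G n) × ℕ)
    (fun i n p => p.1 ⊆ S i n ∧ p.1⁻¹ = p.1 ∧ 1 ∈ p.1 ∧ 1 ≤ p.2 ∧
      ¬ {x | Word p.1 p.2 p.2 x} ⊆ S k n) fun j => by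
    filter_upwards [hcon j, eventually_all_finset (Finset.range (j + 1)) |>.2 fun i hi =>
      hS.eventually_anti (Finset.mem_range_succ_iff.1 hi), hS.inv j, hS.one j] with n h1 h2 h3 h4
    obtain ⟨L, hL, x, hx, hxk⟩ := h1
    exact ⟨(S j n, L), fun i hi =>
      ⟨h2 i (Finset.mem_range_succ_iff.2 hi), h3, h4, hL, fun h => hxk (h hx)⟩⟩
  set V : ∀ n, Set (G n) := fun n => (VL n).1 with hVdef
  set L : ℕ → ℕ := fun n => (VL n).2 with hLdef
  have hV : ∀ i, ∀ᶠ n in ultra, V n ⊆ S i n := fun i => (hVL i).mono fun n h => h.1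
  have hVinv : ∀ᶠ n in ultra, (V n)⁻¹ = V n := (hVL 0).mono fun n h => h.2.1
  have hV1 : ∀ᶠ n in ultra, 1 ∈ V n := (hVL 0).mono fun n h => h.2.2.1
  have hL1 : ∀ᶠ n in ultra, 1 ≤ L n := (hVL 0).mono fun n h => h.2.2.2.1
  have hone : ∀ᶠ n in ultra, {x | Word (V n) (L n) 1 x} ⊆ V n := by
    filter_upwards [hV1, hL1] with n h1 h2 x hx using (Word.mem_of_le_one h1 h2 hx).2 rfl
  have hex : ∀ᶠ n in ultra, ∃ m, 1 ≤ m ∧ m < L n ∧ {x | Word (V n) (L n) m x} ⊆ S k n ∧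
      ¬ {x | Word (V n) (L n) (m + 1) x} ⊆ S k n := by
    filter_upwards [hone, hV k, hVL 0] with n h1 h2 h3
    exact exists_last_subset (h1.trans h2) (word_mono _ _) h3.2.2.2.2
  obtain ⟨m, hm⟩ := hex.choice
  have hm1 : ∀ᶠ n in ultra, 1 ≤ m n := hm.mono fun n h => h.1
  have hmL : ∀ᶠ n in ultra, m n ≤ L n := hm.mono fun n h => h.2.1.le
  have hmk : ∀ᶠ n in ultra, {x | Word (V n) (L n) (m n) x} ⊆ S k n := hm.mono fun n h => h.2.2.1
  have hmS1 : ∀ᶠ n in ultra, {x | Word (V n) (L n) (m n) x} ⊆ S 1 n := by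
    filter_upwards [hmk, hS.eventually_anti (show 1 ≤ k by omega)] with n h1 h2 using h1.trans h2
  obtain ⟨H, hHmem, hHsub⟩ := hS.exists_word_subgroup hV hVinv hm1 hmL hmS1
  have hH1 : (H : Set (∀ n, G n)) ⊆ internalSet (S 1) := by
    intro x hx
    filter_upwards [(hHmem x).1 hx 2, hmk, hS.mul 1, hS.eventually_anti hk] with n h1 h2 h3 h4
    exact h3 (Set.mul_subset_mul_right (h2.trans h4) h1)
  obtain ⟨N, hNk, w, hw⟩ := hS.exists_trapping_subgroup H hH1 k
  obtain ⟨D, hND, hDN⟩ := hS.exists_hull (hNk.trans (hS.anti (Nat.zero_le k))) (w + 2)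
  have hD1 : ∀ᶠ n in ultra, 1 ∈ D n := hND N.one_mem
  have hex' : ∀ᶠ n in ultra, ∃ m', 1 ≤ m' ∧ m' < m n + 1 ∧
      {x | Word (V n) (L n) m' x} ⊆ D n * S (w + 3) n ∩ S k n ∧
      ¬ {x | Word (V n) (L n) (m' + 1) x} ⊆ D n * S (w + 3) n ∩ S k n := by
    filter_upwards [hone, hV k, hV (w + 3), hD1, hm] with n h1 h2 h3 h4 h5
    refine exists_last_subset (h1.trans (Set.subset_inter (fun x hx => ?_) h2)) (word_mono _ _)
      fun h => h5.2.2.2 (h.trans Set.inter_subset_right)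
    exact ⟨1, h4, x, h3 hx, one_mul x⟩
  obtain ⟨m', hm'⟩ := hex'.choice
  have hm'm : ∀ᶠ n in ultra, {x | Word (V n) (L n) (m' n) x} ⊆ {x | Word (V n) (L n) (m n) x} :=
    hm'.mono fun n h => word_mono _ _ _ _ (Nat.lt_succ_iff.1 h.2.1)
  obtain ⟨F, hFmem, hFsub⟩ := hS.exists_word_subgroup hV hVinv (hm'.mono fun n h => h.1)
    (by filter_upwards [hm', hmL] with n h1 h2 using (Nat.lt_succ_iff.1 h1.2.1).trans h2)
    (by filter_upwards [hm'm, hmS1] with n h1 h2 using h1.trans h2)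
  have hFH : F ≤ H := fun x hx => (hHmem x).2 fun i => by
    filter_upwards [(hFmem x).1 hx i, hm'm] with n h1 h2 using Set.mul_subset_mul_right h2 h1
  have hFN : F ≤ N := by
    refine hw F hFH fun x hx => ?_
    have h1 : x ∈ internalSet (fun n => D n * S (w + 1) n) := by
      filter_upwards [(hFmem x).1 hx (w + 2), hm', hS.mul (w + 1), hS.eventually_anti
        (Nat.le_succ (w + 2))] with n h1 h2 h3 h4
      have h5 := Set.mul_subset_mul_right (h2.2.2.1.trans Set.inter_subset_left) h1
      rw [mul_assoc] at h5
      exact Set.mul_subset_mul_left ((Set.mul_subset_mul_right h4).trans h3) h5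
    rw [internalSet_mul] at h1
    obtain ⟨d, hd, s, hs, rfl⟩ := h1
    obtain ⟨a, ha, t, ht, rfl⟩ := hDN hd
    exact ⟨a, ha, t * s, hS.mul_mem (hS.anti (Nat.le_succ _) ht) hs, (mul_assoc _ _ _).symm⟩
  have hexit : ∀ᶠ n in ultra, ∃ x, Word (V n) (L n) (m' n + 1) x ∧
      x ∉ D n * S (w + 3) n ∩ S k n := by
    filter_upwards [hm'] with n h
    obtain ⟨x, h1, h2⟩ := Set.not_subset.1 h.2.2.2
    exact ⟨x, h1, h2⟩
  obtain ⟨x, hx⟩ := exists_forall_of_eventually_exists hexit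
  have hxF : x ∈ F := hFsub (by
    filter_upwards [hx, hm'] with n h1 h2
    exact Word.mono h1.1 (by omega))
  have hfalse : ∀ᶠ _ : ℕ in ultra, False := by
    filter_upwards [hx, hND (hFN hxF), hNk (hFN hxF), hS.one (w + 3)] with n h1 h2 h3 h4
    exact h1.2 ⟨⟨_, h2, 1, h4, mul_one _⟩, h3⟩
  exact hfalse.exists.elim fun _ h => h

end GoodChain

end Trapping

section NoSmallSubgroups

open Filter

variable {G : ℕ → Type*} [∀ n, Group (G n)]

/-- A chain has no small subgroups if elements with many powers in the first member of the chain
lie deep in the chain. -/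
def NoSmallSubgroups (S : ℕ → ∀ n, Set (G n)) : Prop :=
  ∀ k, ∃ ν, ∀ᶠ n in ultra, Qset (S 0 n) ν ⊆ S k n

/-- Growth of dimension less than `e` of arbitrarily small neighbourhoods in a chain. -/
def PolyGrowth (S : ℕ → ∀ n, Set (G n)) (e : ℕ) : Prop :=
  ∃ C : ℕ, ∀ M ≥ 1, ∀ k, ∃ U : Set (∀ n, G n), ∃ l, internalSet (S l) ⊆ U ∧
    U ⊆ internalSet (S k) ∧ ∃ X : Finset (∀ n, G n), M * X.card ≤ C * M ^ e ∧
      U ^ M ⊆ (X : Set (∀ n, G n)) * U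

namespace GoodChain

variable {S : ℕ → ∀ n, Set (G n)} (hS : GoodChain S)
include hS

lemma exists_maximal_subgroup : ∃ (N : Subgroup (∀ n, G n)) (w : ℕ),
    (N : Set (∀ n, G n)) ⊆ internalSet (S 1) ∧
    ∀ F : Subgroup (∀ n, G n), (F : Set (∀ n, G n)) ⊆ N * internalSet (S w) → F ≤ N := by
  obtain ⟨j, hj⟩ := hS.exists_forall_word_mem 1
  let H : Subgroup (∀ n, G n) := Subgroup.closure {g | ∀ k : ℕ, g ^ k ∈ internalSet (S j)}
  have hword : ∀ x ∈ H, ∃ r : ℕ, ∀ L, ∀ᶠ n in ultra, Word (S j n) L r (x n) := by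
    intro x hx
    induction hx using Subgroup.closure_induction with
    | mem x hx =>
      refine ⟨1, fun L => ?_⟩
      filter_upwards [eventually_all_finset (Finset.range (L + 1)) |>.2 fun i _ => hx i] with n h1
      exact Word.of_mem (n := L) (fun k hk => h1 k (Finset.mem_range_succ_iff.2 hk))
        (one_mul L).ge
    | one => exact ⟨0, fun L => Eventually.of_forall fun n => Word.one 0⟩
    | mul x y _ _ hx hy =>
      obtain ⟨r, hr⟩ := hx
      obtain ⟨s, hs⟩ := hy
      refine ⟨r + s, fun L => ?_⟩
      filter_upwards [hr L, hs L] with n h1 h2 using h1.mul h2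
    | inv x _ hx =>
      obtain ⟨r, hr⟩ := hx
      refine ⟨r, fun L => ?_⟩
      filter_upwards [hr L, hS.inv j] with n h1 h2 using h1.inv h2
  have hH : (H : Set (∀ n, G n)) ⊆ internalSet (S 1) := by
    intro x hx
    obtain ⟨r, hr⟩ := hword x hx
    filter_upwards [hr (r + 1), hj] with n h1 h2
    exact h2 (r + 1) (by omega) _ (h1.mono (Nat.le_succ r))
  obtain ⟨N, hN, w, hw⟩ := hS.exists_trapping_subgroup H hH (j + 1)
  refine ⟨N, max w (j + 1), hN.trans (hS.anti (by omega)), fun F hF => hw F (fun x hx => ?_) ?_⟩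
  · refine Subgroup.subset_closure fun k => ?_
    obtain ⟨a, ha, s, hs, has⟩ := hF (pow_mem hx k)
    rw [← has]
    exact hS.mul_mem (hN ha) (hS.anti (le_max_right _ _) hs)
  · exact hF.trans (Set.mul_subset_mul_left (hS.anti (le_max_left _ _)))

/-- Dividing out a maximal small subgroup produces a chain without small subgroups. -/
theorem exists_noSmallSubgroups : ∃ S' : ℕ → ∀ n, Set (G n), GoodChain S' ∧ NoSmallSubgroups S' ∧
    (∃ a, ∀ᶠ n in ultra, S a n ⊆ S' 0 n) ∧ ∀ e, PolyGrowth S e → PolyGrowth S' e := by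
  obtain ⟨N, w, hN1, hw⟩ := hS.exists_maximal_subgroup
  have hN0 : (N : Set (∀ n, G n)) ⊆ internalSet (S 0) := hN1.trans (hS.anti zero_le_one)
  have hnorm : ∀ g ∈ internalSet (S (w + 2)), ∀ a ∈ N, g * a * g⁻¹ ∈ N := by
    intro g hg
    have hle : N.map (MulAut.conj g).toMonoidHom ≤ N := by
      refine hw _ ?_
      rintro _ ⟨a, ha, rfl⟩
      have h1 := hS.conj_mem (hN0 (N.inv_mem ha)) hg
      have h2 := hS.anti (Nat.le_succ _) (hS.inv_mem hg)
      refine ⟨a, ha, _, hS.mul_mem h1 h2, ?_⟩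
      simp only [MulEquiv.toMonoidHom_eq_coe, MonoidHom.coe_coe, MulAut.conj_apply]
      group
    intro a ha
    exact hle ⟨a, ha, rfl⟩
  have hnorm' : ∀ g ∈ internalSet (S (w + 2)), ∀ a ∈ N, g⁻¹ * a * g ∈ N := fun g hg a ha => by
    simpa using hnorm _ (hS.inv_mem hg) a ha
  have hcomm : ∀ A ⊆ internalSet (S (w + 2)), A * (N : Set (∀ n, G n)) = N * A := by
    intro A hA
    apply Set.Subset.antisymm
    · rintro _ ⟨g, hg, a, ha, rfl⟩
      exact ⟨_, hnorm g (hA hg) a ha, g, hg, by group⟩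
    · rintro _ ⟨a, ha, g, hg, rfl⟩
      exact ⟨g, hg, _, hnorm' g (hA hg) a ha, by group⟩
  have hNS : ∀ c, (N : Set (∀ n, G n)) * internalSet (S (c + 1)) ⊆ internalSet (S 0) := by
    rintro c _ ⟨a, ha, s, hs, rfl⟩
    exact hS.mul_mem (hN1 ha) (hS.anti (by omega) hs)
  let c : ℕ → ℕ := fun i => w + 4 + 3 * i
  have hT : ∀ i, ∃ T : ∀ n, Set (G n), (∀ᶠ n in ultra, (T n)⁻¹ = T n) ∧
      N * internalSet (S (c i)) ⊆ internalSet T ∧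
      internalSet T ⊆ N * internalSet (S (w + 3 + 3 * i)) := by
    intro i
    obtain ⟨D, hD1, hD2⟩ := hS.exists_hull (hNS (w + 3 + 3 * i)) (w + 4 + 3 * i)
    refine ⟨fun n => D n ∩ (D n)⁻¹, Eventually.of_forall fun n => ?_, ?_, ?_⟩
    · rw [Set.inter_inv, inv_inv, Set.inter_comm]
    · rw [internalSet_inter, internalSet_inv]
      refine Set.subset_inter (le_trans (le_of_eq ?_) hD1) ?_
      · congr 3; simp only [c]; ring
      · rw [← Set.inv_subset]
        refine le_trans ?_ hD1
        rintro x hx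
        obtain ⟨a, ha, s, hs, h⟩ := hx
        have h' : x = s⁻¹ * a⁻¹ := by rw [← mul_inv_rev]; exact (inv_eq_iff_eq_inv.1 h.symm)
        rw [← hcomm _ (hS.anti (by omega)), h']
        exact ⟨_, hS.anti (by simp only [c]; omega) (hS.inv_mem hs), _, N.inv_mem ha, rfl⟩
    · rw [internalSet_inter]
      refine Set.inter_subset_left.trans (hD2.trans ?_)
      rw [mul_assoc]
      refine Set.mul_subset_mul_left ?_
      rintro _ ⟨s, hs, t, ht, rfl⟩
      exact hS.mul_mem (hS.anti (by omega) hs) (hS.anti (by omega) ht)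
  choose T hTinv hTl hTu using hT
  have hST : ∀ i, ∀ᶠ n in ultra, S (c i) n ⊆ T i n := fun i =>
    eventually_subset_of_internalSet fun x hx => hTl i ⟨1, N.one_mem, x, hx, one_mul x⟩
  have hT0 : ∀ i, internalSet (T i) ⊆ internalSet (S 0) := fun i => (hTu i).trans
    (le_trans (le_of_eq (by congr 3; ring)) (hNS (w + 2 + 3 * i)))
  have hNT : ∀ i, (N : Set (∀ n, G n)) ⊆ internalSet (T i) := fun i x hx =>
    hTl i ⟨x, hx, 1, hS.one_mem _, mul_one x⟩
  have hchain : GoodChain T := by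
    refine ⟨fun i => hNT i N.one_mem, hTinv, fun i => ?_, fun i => ?_, ?_, fun i => ?_⟩
    · refine eventually_subset_of_internalSet ?_
      rw [internalSet_mul]
      refine le_trans ?_ (hTl i)
      rintro _ ⟨x, hx, y, hy, rfl⟩
      obtain ⟨a, ha, s, hs, rfl⟩ := hTu _ hx
      obtain ⟨b, hb, t, ht, rfl⟩ := hTu _ hy
      refine ⟨a * (s * b * s⁻¹), N.mul_mem ha (hnorm s (hS.anti (by omega) hs) b hb), s * t,
        hS.mul_mem_of_lt (by simp only [c]; omega) hs ht, ?_⟩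
      simp only
      group
    · have : ∀ᶠ n in ultra, ∀ p : G n × G n, p.1 ∈ T 0 n → p.2 ∈ T (i + 1) n →
          p.1 * p.2 * p.1⁻¹ ∈ T i n := by
        refine eventually_of_forall_internal (G := fun n => G n × G n)
          (P := fun n p => p.1 ∈ T 0 n → p.2 ∈ T (i + 1) n → p.1 * p.2 * p.1⁻¹ ∈ T i n)
          fun p => ?_
        rw [Ultrafilter.eventually_imp, Ultrafilter.eventually_imp]
        intro hx hy
        obtain ⟨a, ha, s, hs, hxs⟩ := hTu 0 (show (fun n => (p n).1) ∈ _ from hx)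
        obtain ⟨b, hb, t, ht, hyt⟩ := hTu _ (show (fun n => (p n).2) ∈ internalSet (T (i + 1))
          from hy)
        refine hTl i
          (show (fun n => (p n).1) * (fun n => (p n).2) * (fun n => (p n).1)⁻¹ ∈ _ from ?_)
        have hx0 : (fun n => (p n).1) ∈ internalSet (S 0) := hT0 0 hx
        have h1 : (fun n => (p n).1) * b * (fun n => (p n).1)⁻¹ ∈ N := by
          rw [← hxs, show a * s * b * (a * s)⁻¹ = a * (s * b * s⁻¹) * a⁻¹ by group]
          exact N.mul_mem (N.mul_mem ha (hnorm s (hS.anti (by omega) hs) b hb)) (N.inv_mem ha)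
        refine ⟨_, h1, _, hS.anti ?_ (hS.conj_mem (k := w + 2 + 3 * (i + 1)) (x := t) hx0
          (hS.anti (by omega) ht)), ?_⟩
        · simp only [c]; omega
        · rw [← hyt]
          simp only
          group
      filter_upwards [this] with n h a ha s hs using h (a, s) ha hs
    · filter_upwards [hS.fin, eventually_subset_of_internalSet (hT0 0)] with n h1 h2
        using h1.subset h2
    · obtain ⟨m, hm⟩ := hS.cover (c i)
      refine ⟨m, ?_⟩
      filter_upwards [hm, hST i, eventually_subset_of_internalSet (hT0 0)] with n h1 h2 h3
      obtain ⟨X, hX, hsub⟩ := h1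
      exact ⟨X, hX, h3.trans (hsub.trans (Set.mul_subset_mul_left h2))⟩
  refine ⟨T, hchain, fun k => ?_, ⟨c 0, hST 0⟩, fun e hgrowth => ?_⟩
  · by_contra! hcon
    obtain ⟨g, hg⟩ := exists_of_finitely_satisfiable
      (fun ν n (g : G n) => g ∈ Qset (T 0 n) ν ∧ g ∉ T k n) fun ν => by
        filter_upwards [hcon ν] with n h
        obtain ⟨g, h1, h2⟩ := Set.not_subset.1 h
        exact ⟨g, fun i hi => ⟨fun l hl => h1 l (hl.trans hi), h2⟩⟩
    have hpow : ∀ l : ℕ, g ^ l ∈ internalSet (T 0) := fun l =>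
      (hg l).mono fun n h => h.1 l le_rfl
    have hz : Subgroup.zpowers g ≤ N := by
      refine hw _ ?_
      rintro x hx
      have hx0 : x ∈ internalSet (T 0) := by
        obtain ⟨l, rfl⟩ := Subgroup.mem_zpowers_iff.1 hx
        obtain ⟨l, rfl | rfl⟩ := l.eq_nat_or_neg
        · simpa using hpow l
        · simpa using hchain.inv_mem (hpow l)
      exact Set.mul_subset_mul_left (hS.anti (by omega)) (hTu 0 hx0)
    have h1 := hNT k (hz (Subgroup.mem_zpowers g))
    have hfalse : ∀ᶠ _ : ℕ in ultra, False := by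
      filter_upwards [hg 0, h1] with n h2 h3 using h2.2 h3
    exact hfalse.exists.elim fun _ h => h
  · obtain ⟨C, hC⟩ := hgrowth
    refine ⟨C, fun M hM k => ?_⟩
    obtain ⟨U, l, hlU, hUk, X, hX, hUX⟩ := hC M hM (c k)
    have hU : U ⊆ internalSet (S (w + 2)) := hUk.trans (hS.anti (by simp only [c]; omega))
    refine ⟨N * U, l, (hTu l).trans (Set.mul_subset_mul_left ((hS.anti (by omega)).trans hlU)),
      (Set.mul_subset_mul_left hUk).trans (hTl k), X, hX, ?_⟩
    have hpow : ∀ r : ℕ, ((N : Set (∀ n, G n)) * U) ^ (r + 1) ⊆ U ^ (r + 1) * N := by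
      intro r
      induction r with
      | zero => simp [hcomm U hU]
      | succ r ih =>
        rw [pow_succ, pow_succ U]
        refine (Set.mul_subset_mul_right ih).trans ?_
        rw [mul_assoc, ← mul_assoc (N : Set (∀ n, G n)), coe_mul_coe, ← hcomm U hU,
          mul_assoc]
    obtain ⟨r, rfl⟩ := Nat.exists_eq_add_of_le' hM
    refine (hpow r).trans ((Set.mul_subset_mul_right hUX).trans ?_)
    rw [mul_assoc, hcomm U hU]

end GoodChain

end NoSmallSubgroups

section Qset

variable {G : Type*} [Group G] {U : Set G}

lemma Qset_anti {m n : ℕ} (h : m ≤ n) : Qset U n ⊆ Qset U m := fun _ hg k hk => hg k (hk.trans h)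

lemma Qset_mono {U' : Set G} (h : U ⊆ U') (n : ℕ) : Qset U n ⊆ Qset U' n :=
  fun _ hg k hk => h (hg k hk)

lemma pow_mem_Qset {g : G} {j m n : ℕ} (hg : g ∈ Qset U (m * n)) (hj : j ≤ m) :
    g ^ j ∈ Qset U n := fun k hk => by
  rw [← pow_mul]
  exact hg _ (Nat.mul_le_mul hj hk)

lemma one_mem_Qset (h : 1 ∈ U) (n : ℕ) : 1 ∈ Qset U n := fun k _ => by simpa

lemma Qset_subset {n : ℕ} (hn : 1 ≤ n) : Qset U n ⊆ U := fun g hg => by simpa using hg 1 hn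

lemma mem_Qset_zero (h : 1 ∈ U) (g : G) : g ∈ Qset U 0 := fun k hk => by
  rw [Nat.le_zero.1 hk, pow_zero]; exact h

lemma Qset_subset_Qset {U' : Set G} {N : ℕ} (h : Qset U N ⊆ U') (n : ℕ) :
    Qset U (N * n) ⊆ Qset U' n := fun g hg k hk =>
  h (pow_mem_Qset (m := n) (by rwa [mul_comm]) hk)

/-- The calculus of escape times from a set `U` normalised up to a constant by a set `A`:
in terms of the reciprocals of the escape times, products are subadditive, conjugation is bounded,
commutators are submultiplicative and powers are homogeneous, up to the constant `κ`. -/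
structure EscapeCalculus (U A : Set G) (κ : ℕ) : Prop where
  pos : 1 ≤ κ
  one : 1 ∈ U
  inv : U⁻¹ = U
  fin : U.Finite
  sub : U ⊆ A
  prod : ∀ m n (l : List G), l.length ≤ m → (∀ x ∈ l, x ∈ Qset U (κ * (m * n))) →
    l.prod ∈ Qset U n
  conj : ∀ a ∈ A, ∀ n, ∀ g ∈ Qset U (κ * n), a * g * a⁻¹ ∈ Qset U n
  comm : ∀ m n, ∀ g ∈ Qset U (κ * m), ∀ h ∈ Qset U (κ * n), h * g * h⁻¹ * g⁻¹ ∈ Qset U (m * n)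
  pow : ∀ m n r g, g ∈ Qset U m → g ^ m ∈ Qset U n → κ * r ≤ m * n → g ∈ Qset U r

end Qset

section Calculus

open Filter

variable {G : ℕ → Type*} [∀ n, Group (G n)]

namespace GoodChain

variable {S : ℕ → ∀ n, Set (G n)} (hS : GoodChain S)
include hS

lemma eventually_prod_mem (hN : NoSmallSubgroups S) (k : ℕ) :
    ∃ κ, ∀ᶠ i in ultra, ∀ m n (l : List (G i)), l.length ≤ m →
      (∀ x ∈ l, x ∈ Qset (S 0 i) (κ * (m * n))) → l.prod ∈ Qset (S k i) n := by
  obtain ⟨j, hj⟩ := hS.exists_forall_word_mem k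
  obtain ⟨ν, hν⟩ := hN j
  refine ⟨ν, ?_⟩
  filter_upwards [hj, hν, hS.one k] with i h1 h2 h3 m n l hl hx
  rcases Nat.eq_zero_or_pos (m * n) with h0 | h0
  · rcases Nat.mul_eq_zero.1 h0 with rfl | rfl
    · rw [List.eq_nil_of_length_eq_zero (Nat.le_zero.1 hl)]
      exact one_mem_Qset h3 n
    · exact mem_Qset_zero h3 _
  have hw : ∀ l : List (G i), (∀ x ∈ l, x ∈ Qset (S 0 i) (ν * (m * n))) →
      Word (S j i) (m * n) l.length l.prod := by
    intro l hl
    induction l with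
    | nil => exact Word.one 0
    | cons a l ih =>
      rw [List.prod_cons, List.length_cons]
      exact Word.cons (Qset_subset_Qset h2 _ (hl a List.mem_cons_self)) (one_mul _).ge
        (ih fun x hx => hl x (List.mem_cons_of_mem _ hx))
  have hpow : ∀ t : ℕ, Word (S j i) (m * n) (l.length * t) (l.prod ^ t) := by
    intro t
    induction t with
    | zero => simpa using Word.one 0
    | succ t ih => rw [pow_succ, mul_add_one]; exact ih.mul (hw l hx)
  exact fun t ht => h1 (m * n) h0 _ ((hpow t).mono (Nat.mul_le_mul hl ht))

lemma eventually_commutator_mem (hN : NoSmallSubgroups S) :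
    ∃ κ, ∀ᶠ i in ultra, ∀ m n, ∀ g ∈ Qset (S 0 i) (κ * m), ∀ h ∈ Qset (S 0 i) (κ * n),
      h * g * h⁻¹ * g⁻¹ ∈ Qset (S 0 i) (m * n) := by
  obtain ⟨j₀, hj₀⟩ := hS.exists_forall_word_mem 2
  obtain ⟨j, hj2, hj⟩ : ∃ j, 2 ≤ j ∧ ∀ᶠ n in ultra, ∀ L, 1 ≤ L → ∀ x, Word (S j n) L L x →
      x ∈ S 2 n := by
    refine ⟨max j₀ 2, le_max_right _ _, ?_⟩
    filter_upwards [hj₀, hS.eventually_anti (le_max_left j₀ 2)] with n h1 h2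
    exact fun L hL x hx => h1 L hL x (hx.subset h2)
  obtain ⟨ν, hν⟩ := hN (j + 1)
  obtain ⟨M, hM⟩ := hS.eventually_ncard_le 2
  refine ⟨ν * (4 * M + 1), ?_⟩
  filter_upwards [hj, hν, hM, hS.one 0, hS.inv 0, hS.inv 2, hS.inv j, hS.inv (j + 1), hS.mul 0,
    hS.mul 1, hS.conj j, hS.fin, hS.eventually_ncard_pos 2, hS.eventually_anti (zero_le_two),
    hS.eventually_anti (Nat.le_succ j), hS.eventually_anti (show 1 ≤ j + 1 by omega),
    hS.eventually_anti (zero_le_one)]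
    with i h1 h2 h3 h4 h5 h6 h7 h8 h9 h10 h11 h12 h13 h14 h15 h16 h17 m n g hg h hh
  rcases Nat.eq_zero_or_pos (m * n) with h0 | h0
  · rw [h0]; exact mem_Qset_zero h4 _
  have hm : 1 ≤ m := Nat.pos_of_ne_zero (by rintro rfl; simp at h0)
  have hn : 1 ≤ n := Nat.pos_of_ne_zero (by rintro rfl; simp at h0)
  set p := (4 * M + 1) * m with hp
  set q := (4 * M + 1) * n with hq
  rw [mul_assoc] at hg hh
  have hp1 : 1 ≤ p := Nat.mul_pos (by omega) hm
  have hq1 : 1 ≤ q := Nat.mul_pos (by omega) hn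
  have hL : 1 ≤ p * q := Nat.mul_pos hp1 hq1
  have hYfin : (S 2 i).Finite := h12.subset h14
  have hEV : wordMul (S j i) (p * q) (S 2 i) (p * q) ⊆ S 1 i :=
    (Set.mul_subset_mul_right fun x hx => h1 _ hL x hx).trans h10
  have hEV' : wordMul (S (j + 1) i) (p * q) (S 2 i) (p * q) ⊆ S 1 i :=
    (Set.mul_subset_mul_right fun x (hx : Word _ _ _ x) => h1 _ hL x (hx.subset h15)).trans h10
  have hDfin := h12.subset (hEV'.trans h17)
  intro l hl
  have hconj : ∀ v ∈ S (j + 1) i, ∀ y ∈ S 0 i, y⁻¹ * v * y ∈ S j i := fun v hv y hy => by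
    have : y⁻¹ ∈ S 0 i := by rw [← h5]; simpa using hy
    simpa using h11 _ this _ hv
  have := commutator_pow_mem h8 h7 hp1 hq1 (Qset_subset_Qset h2 _ hg) (Qset_subset_Qset h2 _ hh)
    (Y' := hYfin.toFinset) (D := hDfin.toFinset) (l := l) (fun y hy => ?_) ?_ ?_ ?_ ?_
  · rw [Set.Finite.coe_toFinset] at this
    exact h9 (Set.mul_subset_mul hEV' hEV this)
  · rw [Set.Finite.mem_toFinset] at hy ⊢
    rw [← h6]; simpa using hy
  · rw [Set.Finite.coe_toFinset, Set.Finite.coe_toFinset]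
  · intro v hv y hy
    rw [Set.Finite.mem_toFinset] at hy
    exact hconj v hv y (h17 (hEV' hy))
  · intro v hv a ha y hy
    rw [Set.Finite.mem_toFinset] at hy
    exact hconj v hv _ (h9 ⟨a, h16 ha, y, hEV' hy, rfl⟩)
  · rw [← Set.ncard_eq_toFinset_card _ hDfin, ← Set.ncard_eq_toFinset_card _ hYfin]
    calc _ ≤ 4 * l * (M * (S 2 i).ncard) :=
          Nat.mul_le_mul_left _ ((Set.ncard_le_ncard (hEV'.trans h17) h12).trans h3)
      _ = 4 * l * M * (S 2 i).ncard := (mul_assoc _ _ _).symm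
      _ < _ := by
        refine Nat.mul_lt_mul_of_pos_right ?_ h13
        calc 4 * l * M ≤ 4 * M * (m * n) := by nlinarith
          _ < (4 * M + 1) * (4 * M + 1) * (m * n) := by
            refine Nat.mul_lt_mul_of_pos_right ?_ h0
            nlinarith
          _ = p * q := by rw [hp, hq]; ring

theorem eventually_escapeCalculus (hN : NoSmallSubgroups S) :
    ∃ κ, ∀ᶠ i in ultra, EscapeCalculus (S 1 i) (S 0 i) κ := by
  obtain ⟨κ₁, hκ₁⟩ := hS.eventually_prod_mem hN 1
  obtain ⟨κ₂, hκ₂⟩ := hS.eventually_commutator_mem hN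
  obtain ⟨ν₁, hν₁⟩ := hN 1
  obtain ⟨ν₂, hν₂⟩ := hN 2
  refine ⟨κ₁ + κ₂ * (ν₁ + 1) + ν₁ + ν₂ + 1, ?_⟩
  filter_upwards [hκ₁, hκ₂, hν₁, hν₂, hS.one 1, hS.inv 1, hS.fin, hS.eventually_anti zero_le_one,
    hS.mul 0, hS.conj 1] with i h1 h2 h3 h4 h5 h6 h7 h8 h9 h10
  set κ := κ₁ + κ₂ * (ν₁ + 1) + ν₁ + ν₂ + 1 with hκ
  have hdown : ∀ c ≤ κ, ∀ n, Qset (S 1 i) (κ * n) ⊆ Qset (S 0 i) (c * n) := fun c hc n =>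
    (Qset_mono h8 _).trans (Qset_anti (Nat.mul_le_mul_right n hc))
  have hk2 : 0 ≤ κ₂ * (ν₁ + 1) := Nat.zero_le _
  refine ⟨by omega, h5, h6, h7.subset h8, h8, fun m n l hl hx => ?_, fun a ha n g hg t ht => ?_,
    fun m n g hg h hh => ?_, fun m n r g hg hgm hr => ?_⟩
  · exact h1 m n l hl fun x hxl => hdown κ₁ (by omega) _ (hx x hxl)
  · rw [conj_pow]
    exact h10 a ha _ (Qset_subset_Qset h4 n (hdown ν₂ (by omega) n hg) t ht)
  · refine Qset_subset_Qset h3 _ (Qset_anti ?_ (h2 ((ν₁ + 1) * m) n g ?_ h (hdown _ ?_ _ hh)))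
    · rw [mul_assoc]; exact Nat.mul_le_mul_right _ (Nat.le_succ _)
    · rw [← mul_assoc]; exact hdown _ (by omega) _ hg
    · nlinarith
  · refine Qset_subset_Qset h3 _ fun t ht => ?_
    rcases Nat.eq_zero_or_pos m with rfl | hm
    · have : r = 0 := by
        rw [zero_mul, Nat.le_zero, Nat.mul_eq_zero] at hr
        omega
      subst this
      rw [Nat.le_zero.1 ht, pow_zero]
      exact h8 h5
    rw [← Nat.div_add_mod t m, pow_add, pow_mul]
    refine h9 ⟨_, hgm _ ?_, _, hg _ (Nat.mod_lt _ hm).le, rfl⟩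
    refine Nat.div_le_of_le_mul (ht.trans (le_trans ?_ hr))
    exact Nat.mul_le_mul_right _ (by omega)

end GoodChain

end Calculus

lemma Set.Finite.pow_pointwise {G : Type*} [Monoid G] {W : Set G} (hW : W.Finite) (n : ℕ) :
    (W ^ n).Finite := by
  induction n with
  | zero => rw [pow_zero]; exact Set.finite_one
  | succ n ih => rw [pow_succ]; exact ih.mul hW

/-- A maximal separated subset. -/
lemma exists_maximal_separated {G : Type*} (R : G → G → Prop) (hR : ∀ x, R x x)
    (hsymm : ∀ x y, R x y → R y x) {W : Set G} (hW : W.Finite) :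
    ∃ T : Finset G, (T : Set G) ⊆ W ∧ (∀ x ∈ T, ∀ y ∈ T, R x y → x = y) ∧
      ∀ w ∈ W, ∃ t ∈ T, R t w := by
  classical
  let F := hW.toFinset.powerset.filter fun T => ∀ x ∈ T, ∀ y ∈ T, R x y → x = y
  obtain ⟨T, hT, hmax⟩ := F.exists_max_image Finset.card ⟨∅, by simp [F]⟩
  simp only [F, Finset.mem_filter, Finset.mem_powerset] at hT hmax
  refine ⟨T, fun x hx => hW.mem_toFinset.1 (hT.1 hx), hT.2, fun w hw => ?_⟩
  by_contra! hc
  have hwT : w ∉ T := fun hwT => hc w hwT (hR w)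
  have := hmax (insert w T) ⟨?_, ?_⟩
  · rw [Finset.card_insert_of_notMem hwT] at this
    omega
  · exact Finset.insert_subset (hW.mem_toFinset.2 hw) hT.1
  · intro x hx y hy hxy
    rcases Finset.mem_insert.1 hx with hx' | hx' <;> rcases Finset.mem_insert.1 hy with hy' | hy'
    · rw [hx', hy']
    · exact absurd (hsymm _ _ (hx' ▸ hxy)) (hc y hy')
    · exact absurd (hy' ▸ hxy) (hc x hx')
    · exact hT.2 x hx' y hy' hxy

namespace EscapeCalculus

variable {G : Type*} [Group G] {U A : Set G} {κ : ℕ} (h : EscapeCalculus U A κ)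
include h

lemma inv_mem {n : ℕ} {g : G} (hg : g ∈ Qset U n) : g⁻¹ ∈ Qset U n := inv_mem_Qset h.inv hg

lemma mul_mem {n : ℕ} {x y : G} (hx : x ∈ Qset U (κ * (2 * n))) (hy : y ∈ Qset U (κ * (2 * n))) :
    x * y ∈ Qset U n := by
  have := h.prod 2 n [x, y] (by simp) (by simp [hx, hy])
  simpa using this

lemma finite_Qset {n : ℕ} (hn : 1 ≤ n) : (Qset U n).Finite := h.fin.subset (Qset_subset hn)

/-- Taking `M`-th powers separates elements near the identity. -/
lemma mem_of_pow_mul_inv_mem {M n : ℕ} (hM : 1 ≤ M) {x y : G}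
    (hx : x ∈ Qset U (8 * κ ^ 6 * M ^ 2)) (hy : y ∈ Qset U (8 * κ ^ 6 * M ^ 2))
    (hxy : y ^ M * (x ^ M)⁻¹ ∈ Qset U (2 * κ ^ 2 * n)) : x⁻¹ * y ∈ Qset U (M * n) := by
  classical
  have hκ := h.pos
  by_contra hz
  set z := x⁻¹ * y with hzdef
  have hz0 : z ∈ Qset U (4 * κ ^ 5 * M ^ 2) := by
    have e : 8 * κ ^ 6 * M ^ 2 = κ * (2 * (4 * κ ^ 5 * M ^ 2)) := by ring
    rw [e] at hx hy
    exact h.mul_mem (h.inv_mem hx) hy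
  have hex : ∃ q, z ∉ Qset U q := ⟨_, hz⟩
  obtain ⟨p, hp⟩ : ∃ p, Nat.find hex = p + 1 := by
    refine Nat.exists_eq_succ_of_ne_zero fun h0 => Nat.find_spec hex ?_
    rw [h0]; exact mem_Qset_zero h.one z
  have hzp1 : z ∉ Qset U (p + 1) := hp ▸ Nat.find_spec hex
  have hzp : z ∈ Qset U p := by
    by_contra hc
    have := Nat.find_min' hex hc
    omega
  have hpn : p + 1 ≤ M * n := hp ▸ Nat.find_min' hex hz
  have hplarge : 4 * κ ^ 5 * M ^ 2 ≤ p := by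
    by_contra hc
    exact hzp1 (Qset_anti (by omega) hz0)
  have hκ5 : κ ≤ κ ^ 5 := Nat.le_self_pow (by norm_num) κ
  have hM2 : M ≤ M ^ 2 := Nat.le_self_pow (by norm_num) M
  have hpM : M ≤ p := by nlinarith [Nat.mul_le_mul hκ5 hM2]
  have hpκ : 4 * κ ≤ p := by nlinarith [Nat.mul_le_mul hκ5 hM2]
  set s := p / κ with hs
  have hsp : κ * s ≤ p := Nat.mul_div_le p κ
  have hps : p ≤ 2 * κ * s := by
    have := Nat.lt_mul_div_succ p (show 0 < κ by omega)
    rw [← hs] at this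
    nlinarith
  have hzpow : ∀ k ≤ M, z ^ k ∈ A := fun k hk => h.sub (hzp k (hk.trans hpM))
  have herr : ∀ k ≤ M, (z ^ k) * (x ^ (k + 1) * z * (x ^ (k + 1))⁻¹ * z⁻¹) * (z ^ k)⁻¹ ∈
      Qset U (κ * (M * (8 * κ ^ 3 * s))) ∨ M ≤ k := by
    intro k hk
    rcases hk.lt_or_eq with hk' | rfl
    · left
      refine h.conj _ (hzpow k hk) _ _ ?_
      have hxk : x ^ (k + 1) ∈ Qset U (κ * (8 * κ ^ 5 * M)) := by
        refine pow_mem_Qset (m := M) ?_ hk'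
        convert hx using 2; ring
      convert h.comm s (8 * κ ^ 5 * M) z (Qset_anti hsp hzp) _ hxk using 2
      ring
    · exact Or.inr le_rfl
  have hlist : ∀ k ≤ M, ∃ l : List G, l.length ≤ k ∧
      (∀ e ∈ l, e ∈ Qset U (κ * (M * (8 * κ ^ 3 * s)))) ∧
      y ^ k * (x ^ k)⁻¹ = l.prod * z ^ k := by
    intro k
    induction k with
    | zero => exact fun _ => ⟨[], by simp⟩
    | succ k ih =>
      intro hk
      obtain ⟨l, hl1, hl2, hl3⟩ := ih (by omega)
      refine ⟨l ++ [(z ^ k) * (x ^ (k + 1) * z * (x ^ (k + 1))⁻¹ * z⁻¹) * (z ^ k)⁻¹],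
        by simp [hl1], ?_, ?_⟩
      · intro e he
        rcases List.mem_append.1 he with he | he
        · exact hl2 e he
        · rw [List.mem_singleton.1 he]
          exact (herr k (by omega)).resolve_right (by omega)
      · have hy' : y = x * z := by rw [hzdef]; group
        calc y ^ (k + 1) * (x ^ (k + 1))⁻¹
            = (y ^ k * (x ^ k)⁻¹) * (x ^ k * (x * z) * (x ^ (k + 1))⁻¹) := by
              rw [pow_succ y, ← hy']; group
          _ = _ := by
            rw [hl3, List.prod_append, List.prod_singleton, pow_succ z, pow_succ x]
            group
  obtain ⟨l, hl1, hl2, hl3⟩ := hlist M le_rfl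
  have he := h.prod M _ l hl1 hl2
  set r := (κ * (p + 1) + (M - 1)) / M with hr
  have hr1 : κ * (p + 1) ≤ M * r := by
    have := Nat.lt_mul_div_succ (κ * (p + 1) + (M - 1)) (show 0 < M by omega)
    rw [← hr, mul_add_one M] at this
    omega
  have hr2 : r ≤ κ * n := by
    rw [hr, Nat.div_le_iff_le_mul_add_pred (by omega)]
    have := Nat.mul_le_mul_left κ hpn
    have e : κ * (M * n) = M * (κ * n) := by ring
    omega
  have hr3 : r ≤ 2 * κ * p := by
    have h1 : M * r ≤ κ * (p + 1) + (M - 1) := Nat.mul_div_le _ _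
    have h2 : M * r ≤ M * (κ * (p + 1) + 1) := by
      refine h1.trans ?_
      have : κ * (p + 1) ≤ M * (κ * (p + 1)) := Nat.le_mul_of_pos_left _ hM
      rw [mul_add_one M]; omega
    have h3 := Nat.le_of_mul_le_mul_left h2 hM
    nlinarith
  have hzM : z ^ M ∈ Qset U r := by
    have e : z ^ M = l.prod⁻¹ * (y ^ M * (x ^ M)⁻¹) := by rw [hl3]; group
    rw [e]
    refine h.mul_mem (h.inv_mem (Qset_anti ?_ he)) (Qset_anti ?_ hxy)
    · calc κ * (2 * r) ≤ κ * (2 * (2 * κ * (2 * κ * s))) := by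
            have := Nat.mul_le_mul_left (2 * κ) hps
            gcongr; exact hr3.trans this
        _ = _ := by ring
    · calc κ * (2 * r) ≤ κ * (2 * (κ * n)) := by gcongr
        _ = _ := by ring
  exact hzp1 (h.pow M r (p + 1) z (Qset_anti hpM hzp) hzM hr1)

lemma ncard_Qset_le {M n a : ℕ} (hM : 1 ≤ M) (hn : 1 ≤ n) {W : Set G} (hW1 : W.Nonempty)
    (hWfin : W.Finite) (hW : W ⊆ Qset U (8 * κ ^ 6 * M ^ 2))
    (ha : (Qset U (4 * κ ^ 3 * n) * W ^ M).ncard ≤ a * W.ncard) :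
    (Qset U (4 * κ ^ 3 * n)).ncard ≤ a * (Qset U (M * n)).ncard := by
  classical
  have hκ := h.pos
  obtain ⟨T, hTW, hTsep, hTcov⟩ := exists_maximal_separated (fun x y => x⁻¹ * y ∈ Qset U (M * n))
    (fun x => by simpa using one_mem_Qset h.one _)
    (fun x y hxy => by simpa using h.inv_mem hxy) hWfin
  have hQ := h.finite_Qset (n := 4 * κ ^ 3 * n) (Nat.mul_pos (by positivity) hn)
  have h1 : W.ncard ≤ T.card * (Qset U (M * n)).ncard := by
    rw [← Set.ncard_coe_finset]
    refine (Set.ncard_le_ncard ?_ (T.finite_toSet.mul (h.finite_Qset (Nat.mul_pos hM hn)))).trans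
      Set.natCard_mul_le
    intro w hw
    obtain ⟨t, ht, htw⟩ := hTcov w hw
    exact ⟨t, ht, _, htw, by simp⟩
  have h2 : T.card * (Qset U (4 * κ ^ 3 * n)).ncard ≤ (Qset U (4 * κ ^ 3 * n) * W ^ M).ncard := by
    have hinj : Set.InjOn (fun q : G × G => q.1 * q.2 ^ M)
        (Qset U (4 * κ ^ 3 * n) ×ˢ (T : Set G)) := by
      rintro ⟨a, x⟩ ⟨ha, hx⟩ ⟨b, y⟩ ⟨hb, hy⟩ hab
      simp only at ha hx hb hy hab
      have hxy : x = y := by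
        refine hTsep x hx y hy (h.mem_of_pow_mul_inv_mem hM (hW (hTW hx)) (hW (hTW hy)) ?_)
        have e : y ^ M * (x ^ M)⁻¹ = b⁻¹ * a := by
          rw [eq_inv_mul_iff_mul_eq, ← mul_assoc, ← hab]; group
        rw [e]
        have e' : 4 * κ ^ 3 * n = κ * (2 * (2 * κ ^ 2 * n)) := by ring
        rw [e'] at ha hb
        exact h.mul_mem (h.inv_mem hb) ha
      subst hxy
      rw [mul_right_cancel hab]
    have hsub : (fun q : G × G => q.1 * q.2 ^ M) '' (Qset U (4 * κ ^ 3 * n) ×ˢ (T : Set G)) ⊆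
        Qset U (4 * κ ^ 3 * n) * W ^ M := by
      rintro _ ⟨⟨a, x⟩, ⟨ha, hx⟩, rfl⟩
      exact ⟨a, ha, _, Set.pow_mem_pow (hTW hx), rfl⟩
    have := Set.ncard_le_ncard hsub (hQ.mul (hWfin.pow_pointwise M))
    rw [hinj.ncard_image, Set.ncard_prod, Set.ncard_coe_finset] at this
    rwa [mul_comm]
  have hT0 : 0 < T.card := by
    obtain ⟨w, hw⟩ := hW1
    obtain ⟨t, ht, -⟩ := hTcov w hw
    exact Finset.card_pos.2 ⟨t, ht⟩
  refine Nat.le_of_mul_le_mul_left ?_ hT0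
  calc _ ≤ _ := h2
    _ ≤ _ := ha
    _ ≤ a * (T.card * (Qset U (M * n)).ncard) := Nat.mul_le_mul_left a h1
    _ = _ := by ring

lemma ncard_Qset_le_of_div {M n a : ℕ} (hn : 8 * κ ^ 3 ≤ n) {W : Set G} (hM : 1 ≤ M)
    (hW1 : W.Nonempty) (hWfin : W.Finite)
    (hW : W ⊆ Qset U (8 * κ ^ 6 * (8 * κ ^ 3 * M) ^ 2))
    (ha : (Qset U (4 * κ ^ 3 * (n / (4 * κ ^ 3))) * W ^ (8 * κ ^ 3 * M)).ncard ≤ a * W.ncard) :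
    (Qset U n).ncard ≤ a * (Qset U (M * n)).ncard := by
  have hκ := h.pos
  have hc : 0 < 4 * κ ^ 3 := by positivity
  set c := 4 * κ ^ 3 with hcdef
  have e8 : 8 * κ ^ 3 = 2 * c := by rw [hcdef]; ring
  rw [e8] at hn hW ha
  have hn1 : 1 ≤ n / c := Nat.div_pos (by omega) hc
  have hle := h.ncard_Qset_le (M := 2 * c * M) (n := n / c) (Nat.mul_pos (by omega) hM) hn1 hW1
    hWfin hW ha
  have hfin1 := h.finite_Qset (n := c * (n / c)) (Nat.mul_pos hc hn1)
  have hnlt := Nat.lt_mul_div_succ n hc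
  rw [mul_add_one] at hnlt
  calc _ ≤ (Qset U (c * (n / c))).ncard :=
        Set.ncard_le_ncard (Qset_anti (Nat.mul_div_le _ _)) hfin1
    _ ≤ _ := hle
    _ ≤ _ := by
      refine Nat.mul_le_mul_left a (Set.ncard_le_ncard (Qset_anti ?_)
        (h.finite_Qset (Nat.mul_pos hM (by omega))))
      calc M * n ≤ M * (2 * (c * (n / c))) := by gcongr; nlinarith
        _ = _ := by ring

end EscapeCalculus

section EscapeGrowth

open Filter

variable {G : ℕ → Type*} [∀ n, Group (G n)]

/-- Polynomial growth of the escape time balls `Qset (S 1 i) n` for standard `n`. -/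
def EscapeGrowth (S : ℕ → ∀ n, Set (G n)) (e : ℕ) : Prop :=
  ∃ C : ℕ, ∀ M ≥ 1, ∃ N, ∀ n ≥ N, ∀ᶠ i in ultra,
    M * (Qset (S 1 i) n).ncard ≤ C * M ^ e * (Qset (S 1 i) (M * n)).ncard

lemma internalSet_pow (A : ∀ n, Set (G n)) {m : ℕ} (hm : 1 ≤ m) :
    internalSet (fun n => A n ^ m) = internalSet A ^ m := by
  induction m, hm using Nat.le_induction with
  | base => simp only [pow_one]
  | succ m _ ih => simp only [pow_succ, internalSet_mul, ih]

namespace GoodChain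

variable {S : ℕ → ∀ n, Set (G n)} (hS : GoodChain S)
include hS

lemma eventually_subset_Qset (N : ℕ) : ∃ k, ∀ᶠ i in ultra, S k i ⊆ Qset (S 1 i) N := by
  refine ⟨1 + N, ?_⟩
  filter_upwards [hS.eventually_pow 1 N, hS.one (1 + N)] with i h1 h2 g hg t ht
  exact h1 (Set.pow_subset_pow_right h2 (ht.trans Nat.lt_two_pow_self.le) (Set.pow_mem_pow hg))

lemma eventually_Qset_subset (hN : NoSmallSubgroups S) (k : ℕ) :
    ∃ N, ∀ᶠ i in ultra, Qset (S 1 i) N ⊆ S k i := by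
  obtain ⟨N, hN⟩ := hN k
  refine ⟨N, ?_⟩
  filter_upwards [hN, hS.eventually_anti zero_le_one] with i h1 h2
  exact (Qset_mono h2 N).trans h1

theorem escapeGrowth (hN : NoSmallSubgroups S) {e : ℕ} (he : PolyGrowth S e) :
    EscapeGrowth S e := by
  classical
  obtain ⟨κ, hκ⟩ := hS.eventually_escapeCalculus hN
  obtain ⟨C, hC⟩ := he
  refine ⟨C * (18 * κ ^ 3) ^ e, fun M hM => ?_⟩
  have hκ1 : 1 ≤ κ := hκ.exists.elim fun _ h => h.pos
  have hκ3 : 0 < κ ^ 3 := by positivity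
  obtain ⟨k, hk⟩ := hS.eventually_subset_Qset (8 * κ ^ 6 * (8 * κ ^ 3 * M) ^ 2)
  obtain ⟨U, l, hlU, hUk, X, hX, hUX⟩ := hC (2 * (8 * κ ^ 3 * M) + 2) (by omega) (k + 1)
  obtain ⟨W, hUW, hWU⟩ := hS.exists_hull (hUk.trans (hS.anti (Nat.zero_le _))) (max l (k + 1))
  obtain ⟨N₁, hN₁⟩ := hS.eventually_Qset_subset hN l
  have h1U : (1 : ∀ n, G n) ∈ U := hlU (hS.one_mem l)
  have hWk : internalSet W ⊆ internalSet (S k) := hWU.trans fun x ⟨a, ha, b, hb, hab⟩ =>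
    hab ▸ hS.mul_mem (hUk ha) (hS.anti (le_max_right _ _) hb)
  have hWUU : internalSet W ⊆ U ^ 2 := hWU.trans <| by
    rw [pow_two]
    exact Set.mul_subset_mul_left ((hS.anti (le_max_left _ _)).trans hlU)
  refine ⟨N₁ + 8 * κ ^ 3, fun n hn => ?_⟩
  have hQn : N₁ ≤ 4 * κ ^ 3 * (n / (4 * κ ^ 3)) := by
    have := Nat.lt_mul_div_succ n (show 0 < 4 * κ ^ 3 by omega)
    rw [mul_add_one (4 * κ ^ 3)] at this
    omega
  have hsub : internalSet (fun i => Qset (S 1 i) (4 * κ ^ 3 * (n / (4 * κ ^ 3))) *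
      W i ^ (8 * κ ^ 3 * M)) ⊆
      internalSet (fun i => ((X.image fun x => x i : Finset (G i)) : Set (G i)) * W i) := by
    rw [internalSet_mul, internalSet_pow _ (Nat.mul_pos (by positivity) hM)]
    refine (Set.mul_subset_mul (t₁ := U) ?_ (Set.pow_subset_pow_left hWUU)).trans ?_
    · exact (internalSet_mono (hN₁.mono fun i hi => (Qset_anti hQn).trans hi)).trans hlU
    rw [← pow_mul, ← pow_succ']
    refine ((Set.pow_subset_pow_right h1U (by omega)).trans hUX).trans ?_
    rintro _ ⟨x, hx, u, hu, rfl⟩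
    filter_upwards [hUW hu] with i hi
    exact ⟨_, Finset.mem_coe.2 (Finset.mem_image_of_mem _ hx), _, hi, rfl⟩
  have hWne : ∀ᶠ i in ultra, 1 ∈ W i := hUW h1U
  filter_upwards [hκ, hk, eventually_subset_of_internalSet hWk,
    eventually_subset_of_internalSet hsub, hWne] with i h1 h2 h3 h4 h5
  have hWQ := h3.trans h2
  have hWfin : (W i).Finite := (h1.finite_Qset (Nat.mul_pos (by positivity)
    (pow_pos (Nat.mul_pos (by positivity) hM) _))).subset hWQ
  have key := h1.ncard_Qset_le_of_div (n := n) (a := X.card) (by omega) hM ⟨1, h5⟩ hWfin hWQ <| by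
    refine (Set.ncard_le_ncard h4 ((Finset.finite_toSet _).mul hWfin)).trans ?_
    refine Set.natCard_mul_le.trans (Nat.mul_le_mul_right _ ?_)
    exact (Set.ncard_coe_finset _).trans_le Finset.card_image_le
  have hM' : 2 * (8 * κ ^ 3 * M) + 2 ≤ 18 * κ ^ 3 * M := by nlinarith
  have hMX : M * X.card ≤ C * (18 * κ ^ 3) ^ e * M ^ e :=
    calc M * X.card ≤ (2 * (8 * κ ^ 3 * M) + 2) * X.card := by gcongr; nlinarith
      _ ≤ C * (2 * (8 * κ ^ 3 * M) + 2) ^ e := hX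
      _ ≤ C * (18 * κ ^ 3 * M) ^ e := by gcongr
      _ = _ := by rw [mul_pow _ M, mul_assoc]
  calc _ ≤ M * (X.card * _) := Nat.mul_le_mul_left M key
    _ = M * X.card * _ := (mul_assoc _ _ _).symm
    _ ≤ _ := Nat.mul_le_mul_right _ hMX

lemma exists_ncard_Qset_le_two_mul (hN : NoSmallSubgroups S) : ∃ m N : ℕ, ∀ n ≥ N, ∀ᶠ i in ultra,
    (Qset (S 1 i) n).ncard ≤ m * (Qset (S 1 i) (2 * n)).ncard := by
  obtain ⟨κ, hκ⟩ := hS.eventually_escapeCalculus hN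
  have hκ1 : 1 ≤ κ := hκ.exists.elim fun _ h => h.pos
  have hκ3 : 0 < κ ^ 3 := by positivity
  obtain ⟨k, hk⟩ := hS.eventually_subset_Qset (8 * κ ^ 6 * (8 * κ ^ 3 * 2) ^ 2)
  set m₀ := 8 * κ ^ 3 * 2
  set K := max k (m₀ + 1)
  obtain ⟨m, hm⟩ := hS.eventually_ncard_le K
  obtain ⟨N₁, hN₁⟩ := hS.eventually_Qset_subset hN K
  refine ⟨m, N₁ + 8 * κ ^ 3, fun n hn => ?_⟩
  have hQn : N₁ ≤ 4 * κ ^ 3 * (n / (4 * κ ^ 3)) := by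
    have := Nat.lt_mul_div_succ n (show 0 < 4 * κ ^ 3 by omega)
    rw [mul_add_one (4 * κ ^ 3)] at this
    omega
  filter_upwards [hκ, hk, hm, hN₁, hS.eventually_anti (le_max_left k (m₀ + 1)), hS.one K, hS.fin,
    hS.eventually_pow 0 K, hS.eventually_anti (Nat.zero_le K)] with i h1 h2 h3 h4 h5 h6 h7 h8 h9
  refine h1.ncard_Qset_le_of_div (by omega) (by norm_num) ⟨1, h6⟩ (h7.subset h9) (h5.trans h2) ?_
  refine le_trans (Set.ncard_le_ncard ?_ h7) h3
  refine (Set.mul_subset_mul_right ((Qset_anti hQn).trans h4)).trans ?_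
  rw [← pow_succ']
  rw [zero_add] at h8
  exact (Set.pow_subset_pow_right h6 (((le_max_right k _).trans Nat.lt_two_pow_self.le))).trans h8

theorem exists_escapeGrowth (hN : NoSmallSubgroups S) : ∃ e, EscapeGrowth S e := by
  obtain ⟨m, N, hm⟩ := hS.exists_ncard_Qset_le_two_mul hN
  have hiter : ∀ t, ∀ n ≥ N, ∀ᶠ i in ultra,
      (Qset (S 1 i) n).ncard ≤ m ^ t * (Qset (S 1 i) (2 ^ t * n)).ncard := by
    intro t n hn
    induction t with
    | zero => simp
    | succ t ih =>
      filter_upwards [ih, hm (2 ^ t * n) (hn.trans (Nat.le_mul_of_pos_left _ (by positivity)))]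
        with i h1 h2
      calc _ ≤ _ := h1
        _ ≤ m ^ t * _ := Nat.mul_le_mul_left _ h2
        _ = _ := by rw [← mul_assoc, ← pow_succ, ← mul_assoc, ← pow_succ']
  refine ⟨m + 1, 2 ^ m, fun M hM => ⟨N + 1, fun n hn => ?_⟩⟩
  filter_upwards [hiter (Nat.clog 2 M) n (by omega), hS.fin, hS.eventually_anti zero_le_one]
    with i h1 h2 h3
  have hM1 : M ≤ 2 ^ Nat.clog 2 M := Nat.le_pow_clog (by norm_num) M
  have hM2 : 2 ^ Nat.clog 2 M ≤ 2 * M := by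
    rcases hM.eq_or_lt with rfl | hM
    · simp
    · have := Nat.pow_pred_clog_lt_self (b := 2) (by norm_num) hM
      obtain ⟨c, hc⟩ := Nat.exists_eq_succ_of_ne_zero
        (Nat.clog_pos (b := 2) (by norm_num) hM).ne'
      rw [hc] at this ⊢
      rw [Nat.pred_succ] at this
      rw [pow_succ]; omega
  have hfin : (Qset (S 1 i) (M * n)).Finite :=
    (h2.subset h3).subset (Qset_subset (Nat.mul_pos hM (by omega)))
  calc M * (Qset (S 1 i) n).ncard
      ≤ M * ((2 ^ m) ^ Nat.clog 2 M * (Qset (S 1 i) (M * n)).ncard) := by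
        gcongr
        refine h1.trans ?_
        gcongr
        · exact Nat.lt_two_pow_self.le
        · exact Qset_anti (Nat.mul_le_mul_right n hM1)
    _ ≤ M * ((2 * M) ^ m * (Qset (S 1 i) (M * n)).ncard) := by
        rw [← pow_mul, mul_comm m, pow_mul]
        gcongr
    _ = _ := by rw [mul_pow]; ring

end GoodChain

end EscapeGrowth

section ImageOn

variable {G H : Type*} [Group G] [Group H] {Γ : Subgroup G} (π : Γ →* H)

/-- The image of a subset of `G` under a homomorphism defined on a subgroup. -/
def imageOn (A : Set G) : Set H := π '' {x | (x : G) ∈ A}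

/-- The kernel of a homomorphism defined on a subgroup of `G`, as a subgroup of `G`. -/
def kerOn : Subgroup G := π.ker.map Γ.subtype

variable {π}

lemma mem_imageOn {A : Set G} (x : Γ) (hx : (x : G) ∈ A) : π x ∈ imageOn π A := ⟨x, hx, rfl⟩

lemma mem_kerOn (x : Γ) : (x : G) ∈ kerOn π ↔ π x = 1 := by
  simp [kerOn, MonoidHom.mem_ker]

lemma imageOn_mono {A B : Set G} (h : A ⊆ B) : imageOn π A ⊆ imageOn π B := by
  rintro _ ⟨x, hx, rfl⟩
  exact ⟨x, h hx, rfl⟩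

lemma imageOn_mul_subset (A B : Set G) : imageOn π A * imageOn π B ⊆ imageOn π (A * B) := by
  rintro _ ⟨_, ⟨x, hx, rfl⟩, _, ⟨y, hy, rfl⟩, rfl⟩
  exact ⟨x * y, ⟨x, hx, y, hy, rfl⟩, map_mul π x y⟩

lemma imageOn_pow_subset (A : Set G) (m : ℕ) : imageOn π A ^ m ⊆ imageOn π (A ^ m) := by
  induction m with
  | zero =>
    rintro _ rfl
    exact ⟨1, by simp, map_one π⟩
  | succ m ih =>
    rw [pow_succ, pow_succ]
    exact (Set.mul_subset_mul_right ih).trans (imageOn_mul_subset _ _)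

lemma imageOn_inv (A : Set G) : imageOn π A⁻¹ = (imageOn π A)⁻¹ := by
  ext y
  constructor
  · rintro ⟨x, hx, rfl⟩
    exact ⟨x⁻¹, by simpa using hx, by simp⟩
  · rintro ⟨x, hx, hxy⟩
    exact ⟨x⁻¹, by simpa using hx, by simp [hxy]⟩

lemma Set.Finite.imageOn {A : Set G} (hA : A.Finite) : (imageOn π A).Finite :=
  (hA.preimage Subtype.val_injective.injOn).image π

lemma ncard_imageOn_mul_le {A B : Set G} (hA : A.Finite) (hB : B.Finite) :
    (imageOn π A).ncard * ((kerOn π : Set G) ∩ B).ncard ≤ (A * B).ncard := by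
  choose! r hr hπ using fun y (hy : y ∈ imageOn π A) => hy
  rw [← Set.ncard_prod]
  refine Set.ncard_le_ncard_of_injOn (fun q : H × G => (r q.1 : G) * q.2) ?_ ?_ (hA.mul hB)
  · rintro ⟨y, z⟩ ⟨hy, -, hz⟩
    exact ⟨_, hr y hy, _, hz, rfl⟩
  · rintro ⟨y, z⟩ ⟨hy, ⟨z, hz, rfl⟩, -⟩ ⟨y', z'⟩ ⟨hy', ⟨z', hz', rfl⟩, -⟩ hq
    have e : r y * z = r y' * z' := Subtype.ext hq
    have hyy : y = y' := by
      have := congrArg π e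
      rwa [map_mul, map_mul, hπ y hy, hπ y' hy', MonoidHom.mem_ker.1 hz, MonoidHom.mem_ker.1 hz',
        mul_one, mul_one] at this
    subst hyy
    rw [mul_left_cancel e]

lemma ncard_le_imageOn_mul {A B : Set G} (hA : A.Finite) (hB : B.Finite) (hAΓ : A ⊆ Γ)
    (hAB : ∀ x ∈ A, ∀ y ∈ A, x⁻¹ * y ∈ B) :
    A.ncard ≤ (imageOn π A).ncard * ((kerOn π : Set G) ∩ B).ncard := by
  classical
  choose! r hr hπ using fun y (hy : y ∈ imageOn π A) => hy
  rw [← Set.ncard_prod]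
  let f : G → H := fun x => if hx : x ∈ Γ then π ⟨x, hx⟩ else 1
  have hf : ∀ x (hx : x ∈ A), f x = π ⟨x, hAΓ hx⟩ := fun x hx => dif_pos (hAΓ hx)
  have hfA : ∀ x ∈ A, f x ∈ imageOn π A := fun x hx => hf x hx ▸ mem_imageOn _ hx
  refine Set.ncard_le_ncard_of_injOn (fun x => (f x, (r (f x) : G)⁻¹ * x)) ?_ ?_
    (hA.imageOn.prod (hB.inter_of_right _))
  · intro x hx
    refine ⟨hfA x hx, (mem_kerOn ((r (f x))⁻¹ * ⟨x, hAΓ hx⟩)).2 ?_, hAB _ (hr _ (hfA x hx)) _ hx⟩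
    rw [map_mul, map_inv, hπ _ (hfA x hx), ← hf x hx, inv_mul_cancel]
  · intro x hx y hy hxy
    obtain ⟨h1, h2⟩ := Prod.ext_iff.1 hxy
    simp only at h1 h2
    rw [h1] at h2
    exact mul_left_cancel h2

end ImageOn

namespace EscapeCalculus

variable {G : Type*} [Group G] {U A : Set G} {κ : ℕ} (h : EscapeCalculus U A κ)
include h

lemma pow_subset_Qset {m n : ℕ} : Qset U (κ * (m * n)) ^ m ⊆ Qset U n := by
  intro x hx
  obtain ⟨f, rfl⟩ := Set.mem_pow.1 hx
  refine h.prod m n _ (by simp) fun y hy => ?_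
  obtain ⟨i, rfl⟩ := (List.mem_ofFn' _ _).1 hy
  exact (f i).2

/-- The balls in a subgroup containing an element `u` of large escape time grow at least
linearly. -/
lemma mul_ncard_inter_Qset_le {Z : Subgroup G} {u : G} (hu : u ∈ Z) {p : ℕ} (hup : u ∈ Qset U p)
    (hup' : u ∉ Qset U (p + 1)) {M n : ℕ} (hM : 1 ≤ M) (hn : 1 ≤ n) (hp : (M + 1) * n ≤ p) :
    M * ((Z : Set G) ∩ Qset U (κ * ((M + 1) * (2 * κ * n)))).ncard ≤
      8 * κ ^ 2 * ((Z : Set G) ∩ Qset U (2 * κ * n)).ncard := by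
  classical
  have hκ := h.pos
  set J := (M + 1) / (8 * κ ^ 2) + 1 with hJ
  have hκ2 : 0 < 8 * κ ^ 2 := by positivity
  have hMJ : M ≤ 8 * κ ^ 2 * J := by
    have := Nat.lt_mul_div_succ (M + 1) hκ2
    rw [← hJ] at this
    omega
  set t := p / ((M + 1) * n) + 1 with ht
  have hMn : 0 < (M + 1) * n := Nat.mul_pos (by omega) hn
  have ht1 : p + 1 ≤ (M + 1) * n * t := Nat.lt_mul_div_succ p hMn
  have ht2 : (M + 1) * n * t ≤ 2 * p := by
    have := Nat.mul_div_le p ((M + 1) * n)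
    rw [ht, mul_add_one]; omega
  have htJ : ∀ j < J, t * j * (4 * κ ^ 2 * n) ≤ p := by
    intro j hj
    have hj' : 8 * κ ^ 2 * j ≤ M + 1 :=
      (Nat.mul_le_mul_left _ (Nat.lt_succ_iff.1 hj)).trans (Nat.mul_div_le _ _)
    have := Nat.mul_le_mul_right (n * t) hj'
    nlinarith
  have key : J * ((Z : Set G) ∩ Qset U (κ * ((M + 1) * (2 * κ * n)))).ncard ≤
      ((Z : Set G) ∩ Qset U (2 * κ * n)).ncard := by
    rw [← Finset.card_range J, ← Set.ncard_coe_finset, ← Set.ncard_prod]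
    refine Set.ncard_le_ncard_of_injOn (fun q : ℕ × G => u ^ (t * q.1) * q.2) ?_ ?_
      ((h.finite_Qset (Nat.mul_pos (by omega) hn)).inter_of_right _)
    · rintro ⟨j, z⟩ ⟨hj, hz, hzQ⟩
      refine ⟨Z.mul_mem (Z.pow_mem hu _) hz, h.mul_mem ?_ (Qset_anti ?_ hzQ)⟩
      · refine pow_mem_Qset (m := t * j) (Qset_anti ?_ hup) le_rfl
        refine le_trans (le_of_eq ?_) (htJ j (Finset.mem_range.1 hj))
        ring
      · have : 2 * (2 * κ * n) ≤ (M + 1) * (2 * κ * n) := Nat.mul_le_mul_right _ (by omega)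
        exact Nat.mul_le_mul_left _ this
    · have hlt : ∀ j j' z z', j < j' → j' < J → z ∈ Qset U (κ * ((M + 1) * (2 * κ * n))) →
          z' ∈ Qset U (κ * ((M + 1) * (2 * κ * n))) → u ^ (t * j) * z = u ^ (t * j') * z' →
          False := by
        intro j j' z z' hjj hj' hz hz' e
        have e1 : u ^ (t * (j' - j)) = z * z'⁻¹ := by
          rw [eq_mul_inv_iff_mul_eq]
          apply mul_left_cancel (a := u ^ (t * j))
          rw [e, ← mul_assoc, ← pow_add, ← mul_add, Nat.add_sub_cancel' hjj.le]
        have e2 : κ * ((M + 1) * (2 * κ * n)) = κ * (2 * (κ * ((M + 1) * n))) := by ring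
        rw [e2] at hz hz'
        have h1 := h.mul_mem hz (h.inv_mem hz')
        rw [← e1] at h1
        have hle : t * (j' - j) ≤ p := by
          refine le_trans ?_ (htJ (j' - j) (by omega))
          exact Nat.le_mul_of_pos_right _ (Nat.mul_pos (by positivity) hn)
        refine hup' (h.pow (t * (j' - j)) _ (p + 1) u (Qset_anti hle hup) h1 ?_)
        have h2 : t ≤ t * (j' - j) := Nat.le_mul_of_pos_right _ (by omega)
        calc κ * (p + 1) ≤ κ * ((M + 1) * n * t) := Nat.mul_le_mul_left _ ht1
          _ = t * (κ * ((M + 1) * n)) := by ring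
          _ ≤ _ := Nat.mul_le_mul_right _ h2
      rintro ⟨j, z⟩ ⟨hj, -, hz⟩ ⟨j', z'⟩ ⟨hj', -, hz'⟩ e
      simp only [Finset.coe_range, Set.mem_Iio] at hj hj' e hz hz'
      rcases lt_trichotomy j j' with hjj | rfl | hjj
      · exact (hlt j j' z z' hjj hj' hz hz' e).elim
      · rw [mul_left_cancel e]
      · exact (hlt j' j z' z hjj hj hz' hz e.symm).elim
  calc _ ≤ 8 * κ ^ 2 * J * _ := Nat.mul_le_mul_right _ hMJ
    _ ≤ _ := by rw [mul_assoc]; exact Nat.mul_le_mul_left _ key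

/-- Growth of the images of escape time balls in a quotient which kills an element of
large escape time. -/
lemma exists_cover_imageOn {H : Type*} [Group H] {Γ : Subgroup G} {π : Γ →* H} {u : G}
    (hu : u ∈ kerOn π) {p : ℕ} (hup : u ∈ Qset U p) (hup' : u ∉ Qset U (p + 1)) {M n a : ℕ}
    (hM : 1 ≤ M) (hn : 1 ≤ n) (hp : (M + 1) * n ≤ p)
    (hΓ : Qset U (4 * κ ^ 3 * (M + 1) * n) ⊆ Γ)
    (ha : (Qset U n).ncard ≤ a * (Qset U (4 * κ ^ 3 * (M + 1) * n)).ncard) :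
    ∃ X : Finset H, M * X.card ≤ 8 * κ ^ 2 * a ∧
      imageOn π (Qset U (κ * ((M + 1) * (2 * κ * n)))) ^ M ⊆
        (X : Set H) * imageOn π (Qset U (κ * ((M + 1) * (2 * κ * n)))) := by
  classical
  have hκ := h.pos
  have hM1 : 0 < M + 1 := by omega
  set n₁ := 2 * κ * n with hn₁
  set n₃ := κ * ((M + 1) * n₁) with hn₃
  have e₄ : 4 * κ ^ 3 * (M + 1) * n = κ * (2 * n₃) := by rw [hn₃, hn₁]; ring
  rw [e₄] at hΓ ha
  set P := imageOn π (Qset U n₃)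
  set V := imageOn π (Qset U (κ * (2 * n₃)))
  have hn₁0 : 1 ≤ n₁ := Nat.mul_pos (by omega) hn
  have hn₃0 : 1 ≤ n₃ := Nat.mul_pos hκ (Nat.mul_pos hM1 hn₁0)
  have hn₄0 : 1 ≤ κ * (2 * n₃) := Nat.mul_pos hκ (by omega)
  have hn₃4 : n₃ ≤ κ * (2 * n₃) := by nlinarith
  have hPfin : P.Finite := (h.finite_Qset hn₃0).imageOn
  have hVfin : V.Finite := (h.finite_Qset hn₄0).imageOn
  have hVinv : V⁻¹ = V := by
    rw [← imageOn_inv]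
    congr 1
    ext g
    exact ⟨fun hg => by simpa using h.inv_mem hg, fun hg => h.inv_mem hg⟩
  have hVV : V * V ⊆ P := (imageOn_mul_subset _ _).trans <| imageOn_mono <| by
    rintro _ ⟨x, hx, y, hy, rfl⟩
    exact h.mul_mem hx hy
  have hVP : V ⊆ P := imageOn_mono (Qset_anti hn₃4)
  have hV1 : 1 ∈ V := ⟨1, by simpa using one_mem_Qset h.one _, map_one π⟩
  obtain ⟨T, hTP, hTsep, hTcov⟩ := exists_maximal_separated (fun x y => x⁻¹ * y ∈ V * V)
    (fun x => by simpa using Set.mul_mem_mul hV1 hV1)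
    (fun x y hxy => by
      have : (x⁻¹ * y)⁻¹ ∈ V * V := by
        rw [← Set.mem_inv, mul_inv_rev, hVinv]; exact hxy
      simpa using this) (hPfin.pow_pointwise M)
  refine ⟨T, ?_, fun w hw => ?_⟩
  swap
  · obtain ⟨t, ht, htw⟩ := hTcov w hw
    exact ⟨t, ht, _, hVV htw, by simp⟩
  have h1 : T.card * V.ncard ≤ (imageOn π (Qset U n₁)).ncard := by
    rw [← Set.ncard_coe_finset, ← Set.ncard_prod]
    refine Set.ncard_le_ncard_of_injOn (fun q : H × H => q.1 * q.2) ?_ ?_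
      (h.finite_Qset hn₁0).imageOn
    · rintro ⟨t, v⟩ ⟨ht, hv⟩
      have : t * v ∈ P ^ (M + 1) := by
        rw [pow_succ]; exact ⟨t, hTP ht, v, hVP hv, rfl⟩
      exact imageOn_mono h.pow_subset_Qset (imageOn_pow_subset _ _ this)
    · rintro ⟨t, v⟩ ⟨ht, hv⟩ ⟨t', v'⟩ ⟨ht', hv'⟩ e
      simp only at ht hv ht' hv' e
      have : t = t' := by
        refine hTsep t ht t' ht' ⟨v, hv, v'⁻¹, ?_, ?_⟩
        · rw [← hVinv]; simpa using hv'
        · change v * v'⁻¹ = _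
          rw [mul_inv_eq_iff_eq_mul, mul_assoc, ← e]; group
      subst this
      rw [mul_left_cancel e]
  set z₁ := ((kerOn π : Set G) ∩ Qset U n₁).ncard
  set z₃ := ((kerOn π : Set G) ∩ Qset U n₃).ncard
  have h2 : (imageOn π (Qset U n₁)).ncard * z₁ ≤ (Qset U n).ncard := by
    refine (ncard_imageOn_mul_le (h.finite_Qset hn₁0) (h.finite_Qset hn₁0)).trans ?_
    refine Set.ncard_le_ncard ?_ (h.finite_Qset hn)
    rintro _ ⟨x, hx, y, hy, rfl⟩
    have e : n₁ = κ * (2 * n) := by rw [hn₁]; ring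
    rw [e] at hx hy
    exact h.mul_mem hx hy
  have h3 : (Qset U (κ * (2 * n₃))).ncard ≤ V.ncard * z₃ :=
    ncard_le_imageOn_mul (h.finite_Qset hn₄0) (h.finite_Qset hn₃0) hΓ
      fun x hx y hy => h.mul_mem (h.inv_mem hx) hy
  have h4 : M * z₃ ≤ 8 * κ ^ 2 * z₁ := h.mul_ncard_inter_Qset_le hu hup hup' hM hn hp
  have hV0 : 0 < V.ncard := (Set.ncard_pos hVfin).2 ⟨1, hV1⟩
  have hz0 : 0 < z₁ := (Set.ncard_pos ((h.finite_Qset hn₁0).inter_of_right _)).2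
    ⟨1, one_mem _, one_mem_Qset h.one _⟩
  refine Nat.le_of_mul_le_mul_right ?_ (Nat.mul_pos hV0 hz0)
  calc M * T.card * (V.ncard * z₁) = M * (T.card * V.ncard * z₁) := by ring
    _ ≤ M * ((imageOn π (Qset U n₁)).ncard * z₁) := by gcongr
    _ ≤ M * (Qset U n).ncard := by gcongr
    _ ≤ M * (a * (V.ncard * z₃)) := by gcongr; exact ha.trans (Nat.mul_le_mul_left _ h3)
    _ = a * V.ncard * (M * z₃) := by ring
    _ ≤ a * V.ncard * (8 * κ ^ 2 * z₁) := by gcongr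
    _ = _ := by ring

end EscapeCalculus

section VirtuallyNilpotent

lemma lowerCentralSeries_le_of_le {G : Type*} [Group G] {S T : Subgroup G} (h : S ≤ T) (n : ℕ) :
    S.lowerCentralSeries n ≤ T.lowerCentralSeries n := by
  induction n with
  | zero => exact h
  | succ n ih => exact Subgroup.commutator_mono ih h

lemma IsVirtuallyNilpotent.of_finite (G : Type*) [Group G] [Finite G] : IsVirtuallyNilpotent G :=
  ⟨⊥, inferInstance, inferInstance⟩

lemma finiteIndex_comap {G H : Type*} [Group G] [Group H] (f : G →* H) (N : Subgroup H)
    [N.FiniteIndex] : (N.comap f).FiniteIndex :=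
  ⟨by
    rw [Subgroup.index_comap]
    exact Subgroup.FiniteIndex.index_ne_zero⟩

/-- Virtual nilpotency is preserved by extensions with kernel central modulo a finite
normal subgroup. -/
theorem IsVirtuallyNilpotent.of_hom {Γ H : Type*} [Group Γ] [Group H] (π : Γ →* H)
    (F : Subgroup Γ) [F.Normal] [Finite F]
    (hker : ∀ z ∈ π.ker, ∀ g : Γ, z * g * z⁻¹ * g⁻¹ ∈ F) (hH : IsVirtuallyNilpotent H) :
    IsVirtuallyNilpotent Γ := by
  obtain ⟨N, hN, hnil⟩ := hH
  have : Finite (MulAut F) := Finite.of_injective _ DFunLike.coe_injective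
  have hC : ((MulAut.conjNormal : Γ →* MulAut F).ker).FiniteIndex := inferInstance
  have hP := finiteIndex_comap π N
  refine ⟨N.comap π ⊓ (MulAut.conjNormal : Γ →* MulAut F).ker, inferInstance, ?_⟩
  set S := N.comap π ⊓ (MulAut.conjNormal : Γ →* MulAut F).ker with hS
  rw [Subgroup.isNilpotent_iff_lowerCentralSeries] at hnil ⊢
  obtain ⟨c, hc⟩ := hnil
  have h0 : S.lowerCentralSeries c ≤ π.ker := by
    intro x hx
    have h1 : π x ∈ (S.lowerCentralSeries c).map π := Subgroup.mem_map_of_mem π hx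
    rw [Subgroup.map_lowerCentralSeries] at h1
    have h2 := lowerCentralSeries_le_of_le (Subgroup.map_le_iff_le_comap.2
      (inf_le_left : S ≤ N.comap π)) c h1
    rw [hc] at h2
    exact h2
  have h1 : S.lowerCentralSeries (c + 1) ≤ F :=
    Subgroup.commutator_le.2 fun z hz g _ => hker z (h0 hz) g
  refine ⟨c + 2, (Subgroup.eq_bot_iff_forall _).2 fun x hx => ?_⟩
  refine (Subgroup.commutator_le (H₃ := ⊥)).2 (fun z hz g hg => ?_) hx
  have h2 := DFunLike.congr_fun (MonoidHom.mem_ker.1 hg.2) ⟨z, h1 hz⟩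
  have h3 : g * z * g⁻¹ = z := congrArg Subtype.val h2
  rw [Subgroup.mem_bot, commutatorElement_eq_one_iff_mul_comm]
  rw [mul_inv_eq_iff_eq_mul] at h3
  exact h3.symm

lemma IsVirtuallyNilpotent.of_injective {G H : Type*} [Group G] [Group H] (f : G →* H)
    (hf : Function.Injective f) (hH : IsVirtuallyNilpotent H) : IsVirtuallyNilpotent G := by
  refine IsVirtuallyNilpotent.of_hom f ⊥ (fun z hz g => ?_) hH
  rw [(injective_iff_map_eq_one f).1 hf z hz]
  simp

end VirtuallyNilpotent

section EscapeCore

variable {G : Type*} [Group G]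

/-- The elements which never escape from a set. -/
def escapeCore (U : Set G) : Set G := {g | ∀ n, g ∈ Qset U n}

namespace EscapeCalculus

variable {U A : Set G} {κ : ℕ} (h : EscapeCalculus U A κ)

/-- The elements which never escape form a subgroup. -/
def core : Subgroup G where
  carrier := escapeCore U
  one_mem' := fun _ => one_mem_Qset h.one _
  mul_mem' := fun hx hy _ => h.mul_mem (hx _) (hy _)
  inv_mem' := fun hx n => h.inv_mem (hx n)

include h

lemma finite_escapeCore : (escapeCore U).Finite :=
  h.fin.subset fun _ hg => Qset_subset le_rfl (hg 1)

lemma conj_mem_core {a g : G} (ha : a ∈ A) (hg : g ∈ h.core) : a * g * a⁻¹ ∈ h.core :=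
  fun n => h.conj a ha n g (hg _)

lemma exists_maximal_escaping (hne : ¬ Qset U 1 ⊆ escapeCore U) :
    ∃ p, ∃ u, u ∈ Qset U p ∧ u ∉ escapeCore U ∧ Qset U (p + 1) ⊆ escapeCore U := by
  classical
  have hex : ∃ n, Qset U n ⊆ escapeCore U := by
    have : ∀ g, ∃ n, g ∉ escapeCore U → g ∉ Qset U n := by
      intro g
      by_cases hg : g ∈ escapeCore U
      · exact ⟨0, fun hc => absurd hg hc⟩
      · obtain ⟨n, hn⟩ := not_forall.1 hg
        exact ⟨n, fun _ => hn⟩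
    choose n hn using this
    refine ⟨h.fin.toFinset.sup n + 1, fun g hg => ?_⟩
    by_contra hc
    have hgU : g ∈ h.fin.toFinset := h.fin.mem_toFinset.2 (Qset_subset (by omega) hg)
    exact hn g hc (Qset_anti (Nat.le_succ_of_le (Finset.le_sup (f := n) hgU)) hg)
  obtain ⟨p, hp⟩ : ∃ p, Nat.find hex = p + 1 := by
    refine Nat.exists_eq_succ_of_ne_zero fun h0 => hne ?_
    have := Nat.find_spec hex
    rw [h0] at this
    exact (Qset_anti (Nat.zero_le 1)).trans this
  have h1 : ¬ Qset U p ⊆ escapeCore U := Nat.find_min hex (by omega)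
  obtain ⟨u, hu, hu'⟩ := Set.not_subset.1 h1
  exact ⟨p, u, hu, hu', hp ▸ Nat.find_spec hex⟩

lemma closure_le_normalizer_core {B : Set G} (hBA : B ⊆ A) :
    Subgroup.closure B ≤ Subgroup.normalizer (h.core : Set G) := by
  have : Finite (h.core : Set G) := h.finite_escapeCore
  exact (Subgroup.closure_le _).2 fun b hb =>
    Subgroup.mem_normalizer_fintype fun _ hg => h.conj_mem_core (hBA hb) hg

/-- An element of maximal escape time is central modulo the elements which never escape. -/
lemma commutator_mem_core {B : Set G} (hBA : B ⊆ A) (hB : B ⊆ Qset U (κ * (3 * κ))) {u : G} {p : ℕ}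
    (hu : u ∈ Qset U p) (hp : Qset U (p + 1) ⊆ escapeCore U) (hpκ : 2 * κ ≤ p) {x : G}
    (hx : x ∈ Subgroup.closure B) : x * u * x⁻¹ * u⁻¹ ∈ h.core := by
  have hκ := h.pos
  have hN := h.closure_le_normalizer_core hBA
  induction hx using Subgroup.closure_induction with
  | mem x hx =>
    refine hp (Qset_anti ?_
      (h.comm (p / κ) (3 * κ) u (Qset_anti (Nat.mul_div_le _ _) hu) x (hB hx)))
    have := Nat.lt_mul_div_succ p hκ
    rw [mul_add_one κ] at this
    have e : p / κ * (3 * κ) = 3 * (κ * (p / κ)) := by ring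
    omega
  | one => simp
  | mul x y hx hy ihx ihy =>
    have e : x * y * u * (x * y)⁻¹ * u⁻¹ =
      (x * (y * u * y⁻¹ * u⁻¹) * x⁻¹) * (x * u * x⁻¹ * u⁻¹) := by group
    rw [e]
    exact Subgroup.mul_mem _ ((Subgroup.mem_normalizer_iff.1 (hN hx) _).1 ihy) ihx
  | inv x hx ih =>
    have e : x⁻¹ * u * x⁻¹⁻¹ * u⁻¹ = x⁻¹ * (x * u * x⁻¹ * u⁻¹)⁻¹ * x⁻¹⁻¹ := by group
    rw [e]
    exact (Subgroup.mem_normalizer_iff.1 (Subgroup.inv_mem _ (hN hx)) _).1 (Subgroup.inv_mem _ ih)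

end EscapeCalculus

end EscapeCore

section Covering

lemma imageOn_subset_mul {G H : Type*} [Group G] [Group H] {Γ : Subgroup G} {π : Γ →* H}
    {A B : Set G} {X : Finset G} (hAX : A ⊆ X * B) :
    ∃ Y : Finset H, Y.card ≤ X.card ∧ imageOn π A ⊆ Y * imageOn π (B⁻¹ * B) := by
  classical
  have : ∀ x : G, ∃ z : Γ, (∃ y : Γ, (y : G) ∈ A ∧ x⁻¹ * y ∈ B) → (z : G) ∈ A ∧ x⁻¹ * z ∈ B := by
    intro x
    by_cases hx : ∃ y : Γ, (y : G) ∈ A ∧ x⁻¹ * y ∈ B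
    · obtain ⟨y, hy⟩ := hx
      exact ⟨y, fun _ => hy⟩
    · exact ⟨1, fun h => absurd h hx⟩
  choose f hf using this
  refine ⟨X.image fun x => π (f x), Finset.card_image_le, ?_⟩
  rintro _ ⟨y, hy, rfl⟩
  obtain ⟨x, hx, b, hb, hxb⟩ := hAX hy
  have hxy : x⁻¹ * (y : G) ∈ B := by rw [← hxb]; simpa using hb
  obtain ⟨h1, h2⟩ := hf x ⟨y, hy, hxy⟩
  refine ⟨π (f x), Finset.mem_coe.2 (Finset.mem_image_of_mem _ hx), π ((f x)⁻¹ * y),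
    mem_imageOn _ ⟨(x⁻¹ * f x)⁻¹, by simpa using h2, _, hxy, ?_⟩, by simp⟩
  push_cast
  group

end Covering

section InductionStep

open Filter

universe u

/-- The initial term of a chain is covered by boundedly many cosets of a virtually nilpotent
group. -/
def VirtuallyNilpotentCover {G : ℕ → Type*} [∀ n, Group (G n)] (S : ℕ → ∀ n, Set (G n)) : Prop :=
  ∃ m : ℕ, ∀ᶠ i in ultra, ∃ Γ₀ : Subgroup (G i), IsVirtuallyNilpotent Γ₀ ∧
    ∃ X : Finset (G i), X.card ≤ m ∧ S 0 i ⊆ (X : Set (G i)) * (Γ₀ : Set (G i))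

lemma VirtuallyNilpotentCover.of_subset {G : ℕ → Type*} [∀ n, Group (G n)]
    {S S' : ℕ → ∀ n, Set (G n)} (hS : GoodChain S) {a : ℕ}
    (ha : ∀ᶠ n in ultra, S a n ⊆ S' 0 n) (h : VirtuallyNilpotentCover S') :
    VirtuallyNilpotentCover S := by
  classical
  obtain ⟨m, hm⟩ := h
  obtain ⟨m', hm'⟩ := hS.cover a
  refine ⟨m' * m, ?_⟩
  filter_upwards [hm, hm', ha] with i ⟨Γ₀, hΓ, X, hX, hcov⟩ ⟨Y, hY, hcov'⟩ h3
  refine ⟨Γ₀, hΓ, Y * X, Finset.card_mul_le.trans (Nat.mul_le_mul hY hX), hcov'.trans ?_⟩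
  rw [Finset.coe_mul, mul_assoc]
  exact Set.mul_subset_mul_left (h3.trans hcov)

namespace EscapeCalculus

/-- Pulling back a covering by cosets of a virtually nilpotent group from the quotient by an
element of maximal escape time and the elements which never escape. -/
lemma exists_virtuallyNilpotent_cover {G : Type*} [Group G] {U A : Set G} {κ : ℕ}
    (h : EscapeCalculus U A κ) {B : Set G} (hBA : B ⊆ A) (hB : B ⊆ Qset U (κ * (3 * κ))) {u : G}
    {p : ℕ} (hu : u ∈ Qset U p) (hp : Qset U (p + 1) ⊆ escapeCore U) (hpκ : 2 * κ ≤ p)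
    (hcB : escapeCore U ⊆ B)
    {Γ : Subgroup G} (hΓ : Γ = Subgroup.closure B) {N : Subgroup Γ} [N.Normal]
    (hN : N = Subgroup.normalClosure {x : Γ | (x : G) ∈ escapeCore U ∨ (x : G) = u})
    {Γ₁ : Subgroup (Γ ⧸ N)} (hΓ₁ : IsVirtuallyNilpotent Γ₁) {X : Finset (Γ ⧸ N)}
    (hX : imageOn (QuotientGroup.mk' N) B ⊆ (X : Set (Γ ⧸ N)) * (Γ₁ : Set (Γ ⧸ N))) :
    ∃ Γ₀ : Subgroup G, IsVirtuallyNilpotent Γ₀ ∧ ∃ Y : Finset G, Y.card ≤ X.card ∧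
      B ⊆ (Y : Set G) * (Γ₀ : Set G) := by
  classical
  have hBΓ : B ⊆ Γ := hΓ ▸ Subgroup.subset_closure
  have hcΓ : h.core ≤ Γ := fun x hx => hBΓ (hcB hx)
  have hEn : (h.core.subgroupOf Γ).Normal :=
    (Subgroup.normal_subgroupOf_iff_le_normalizer hcΓ).2 (hΓ ▸ h.closure_le_normalizer_core hBA)
  have hcfin : Finite h.core := h.finite_escapeCore
  have hEfin : Finite (h.core.subgroupOf Γ) :=
    Finite.of_injective (fun x : h.core.subgroupOf Γ => (⟨x.1.1, x.2⟩ : h.core))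
      fun x y hxy => Subtype.ext (Subtype.ext (congrArg (fun z : h.core => (z : G)) hxy))
  have hcomm : N ≤ (Subgroup.center (Γ ⧸ h.core.subgroupOf Γ)).comap
      (QuotientGroup.mk' (h.core.subgroupOf Γ)) := by
    rw [hN]
    refine Subgroup.normalClosure_le_normal ?_
    rintro x (hx | hx)
    · have : QuotientGroup.mk' (h.core.subgroupOf Γ) x = 1 := by
        rw [QuotientGroup.mk'_apply, QuotientGroup.eq_one_iff]
        exact hx
      simp only [SetLike.mem_coe, Subgroup.mem_comap, this]
      exact one_mem _
    · simp only [SetLike.mem_coe, Subgroup.mem_comap, Subgroup.mem_center_iff]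
      intro g
      obtain ⟨g, rfl⟩ := QuotientGroup.mk'_surjective _ g
      rw [← mul_inv_eq_one, mul_inv_rev, ← map_inv, ← map_inv, ← map_mul, ← map_mul, ← map_mul,
        QuotientGroup.mk'_apply, QuotientGroup.eq_one_iff, Subgroup.mem_subgroupOf]
      push_cast
      rw [hx, ← mul_assoc]
      exact h.commutator_mem_core hBA hB hu hp hpκ (hΓ ▸ g.2)
  have hcomm' : ∀ z ∈ N, ∀ g : Γ, z * g * z⁻¹ * g⁻¹ ∈ h.core.subgroupOf Γ := by
    intro z hz g
    have h1 := Subgroup.mem_center_iff.1 (hcomm hz) (QuotientGroup.mk' _ g)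
    rw [← QuotientGroup.eq_one_iff, ← QuotientGroup.mk'_apply, map_mul, map_mul, map_mul, ← h1,
      map_inv, map_inv]
    group
  have hEfin' : Finite ((h.core.subgroupOf Γ).subgroupOf (Γ₁.comap (QuotientGroup.mk' N))) :=
    Finite.of_injective (fun x => (⟨x.1.1, x.2⟩ : h.core.subgroupOf Γ))
      fun x y hxy => Subtype.ext (Subtype.ext (congrArg
        (fun z : h.core.subgroupOf Γ => (z : Γ)) hxy))
  refine ⟨(Γ₁.comap (QuotientGroup.mk' N)).map Γ.subtype, ?_,
    X.image fun y => ((Quotient.out y : Γ) : G), Finset.card_image_le, fun w hw => ?_⟩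
  · have h1 : IsVirtuallyNilpotent (Γ₁.comap (QuotientGroup.mk' N)) := by
      refine IsVirtuallyNilpotent.of_hom ((QuotientGroup.mk' N).subgroupComap Γ₁)
        ((h.core.subgroupOf Γ).subgroupOf (Γ₁.comap (QuotientGroup.mk' N))) (fun z hz g => ?_) hΓ₁
      refine hcomm' z ?_ g
      have h2 : QuotientGroup.mk' N z = 1 := congrArg Subtype.val (MonoidHom.mem_ker.1 hz)
      rwa [QuotientGroup.mk'_apply, QuotientGroup.eq_one_iff] at h2
    exact IsVirtuallyNilpotent.of_injective ((Γ₁.comap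
      (QuotientGroup.mk' N)).equivMapOfInjective Γ.subtype Subtype.val_injective).symm.toMonoidHom
      (MulEquiv.injective _) h1
  · obtain ⟨y, hy, γ, hγ, hyγ⟩ := hX (mem_imageOn (π := QuotientGroup.mk' N) ⟨w, hBΓ hw⟩ hw)
    refine ⟨_, Finset.mem_coe.2 (Finset.mem_image_of_mem _ hy), _,
      ⟨(Quotient.out y)⁻¹ * ⟨w, hBΓ hw⟩, ?_, rfl⟩, by simp⟩
    have hout : QuotientGroup.mk' N (Quotient.out y) = y := QuotientGroup.out_eq' y
    simp only [SetLike.mem_coe, Subgroup.mem_comap, map_mul, map_inv, hout, ← hyγ]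
    simpa using hγ

end EscapeCalculus

end InductionStep

section InductionStep

open Filter

universe u

variable {G H : ℕ → Type u} [∀ n, Group (G n)] [∀ n, Group (H n)] {S : ℕ → ∀ n, Set (G n)}

namespace GoodChain

lemma imageOn (hS : GoodChain S) {Γ : ∀ n, Subgroup (G n)} (π : ∀ n, Γ n →* H n) (b : ℕ) :
    GoodChain fun k n => _root_.imageOn (π n) (S (b + k) n) where
  one k := by
    filter_upwards [hS.one (b + k)] with n h1
    exact ⟨1, h1, map_one _⟩
  inv k := by
    filter_upwards [hS.inv (b + k)] with n h1
    rw [← imageOn_inv, h1]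
  mul k := by
    filter_upwards [hS.mul (b + k)] with n h1
    exact (imageOn_mul_subset _ _).trans (imageOn_mono h1)
  conj k := by
    filter_upwards [hS.conj (b + k), hS.eventually_anti (Nat.zero_le b)] with n h1 h2
    rintro _ ⟨x, hx, rfl⟩ _ ⟨y, hy, rfl⟩
    exact ⟨x * y * x⁻¹, h1 _ (h2 hx) _ hy, by simp⟩
  fin := by
    filter_upwards [hS.fin, hS.eventually_anti (Nat.zero_le b)] with n h1 h2
    exact (h1.subset h2).imageOn
  cover k := by
    obtain ⟨m, hm⟩ := hS.cover (b + k + 1)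
    refine ⟨m, ?_⟩
    filter_upwards [hm, hS.mul (b + k), hS.inv (b + k + 1),
      hS.eventually_anti (Nat.zero_le b)] with n ⟨X, hX, hcov⟩ h1 h2 h3
    obtain ⟨Y, hY, hYcov⟩ := imageOn_subset_mul (π := π n) ((h3 : S (b + 0) n ⊆ S 0 n).trans hcov)
    rw [h2] at hYcov
    exact ⟨Y, hY.trans hX, hYcov.trans (Set.mul_subset_mul_left (imageOn_mono h1))⟩

/-- Killing an element of large escape time reduces the dimension by one. -/
lemma polyGrowth_imageOn (hS : GoodChain S) (hN : NoSmallSubgroups S) {e : ℕ}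
    (he : EscapeGrowth S (e + 1)) {Γ : ∀ n, Subgroup (G n)} {π : ∀ n, Γ n →* H n} {b : ℕ}
    (hb : ∀ᶠ i in ultra, S b i ⊆ Γ i) {p : ℕ → ℕ} {x : ∀ n, G n}
    (hp : ∀ N, ∀ᶠ i in ultra, N ≤ p i) (hx : ∀ᶠ i in ultra, x i ∈ Qset (S 1 i) (p i))
    (hx' : ∀ᶠ i in ultra, x i ∉ Qset (S 1 i) (p i + 1))
    (hxk : ∀ᶠ i in ultra, x i ∈ kerOn (π i)) :
    PolyGrowth (fun k n => _root_.imageOn (π n) (S (b + k) n)) e := by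
  classical
  obtain ⟨κ, hκ⟩ := hS.eventually_escapeCalculus hN
  have hκ1 : 1 ≤ κ := hκ.exists.elim fun _ h => h.pos
  obtain ⟨C, hC⟩ := he
  refine ⟨8 * κ ^ 2 * (C * (8 * κ ^ 3) ^ e), fun M hM k => ?_⟩
  have hκ3 : 1 ≤ 4 * κ ^ 3 := Nat.succ_le_of_lt (by positivity)
  have hL : 1 ≤ 4 * κ ^ 3 * (M + 1) := Nat.one_le_iff_ne_zero.2 (by positivity)
  obtain ⟨N, hN2⟩ := hC (4 * κ ^ 3 * (M + 1)) hL
  obtain ⟨N₁, hN₁⟩ := hS.eventually_Qset_subset hN (b + k)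
  set n := N + N₁ + 1 with hn
  set n' := κ * ((M + 1) * (2 * κ * n)) with hn'
  have hnn' : N₁ ≤ n' := by
    have h1 : N₁ ≤ n := by omega
    have h2 : 1 * n ≤ (κ * ((M + 1) * (2 * κ))) * n :=
      Nat.mul_le_mul_right _ (Nat.one_le_iff_ne_zero.2 (by positivity))
    have h3 : (κ * ((M + 1) * (2 * κ))) * n = n' := by rw [hn']; ring
    omega
  have hnL : N₁ ≤ 4 * κ ^ 3 * (M + 1) * n := by
    have h1 := Nat.mul_le_mul_right n hL
    omega
  obtain ⟨l, hl⟩ := hS.eventually_subset_Qset n'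
  have hcov : ∀ᶠ i in ultra, ∃ X : Finset (H i),
      X.card ≤ 8 * κ ^ 2 * (C * (4 * κ ^ 3 * (M + 1)) ^ e) / M ∧
      _root_.imageOn (π i) (Qset (S 1 i) n') ^ M ⊆
        (X : Set (H i)) * _root_.imageOn (π i) (Qset (S 1 i) n') := by
    filter_upwards [hκ, hb, hp ((M + 1) * n), hx, hx', hxk, hN2 n (by omega), hN₁,
      hS.eventually_anti (Nat.le_add_right b k)] with i h h1 h2 h3 h4 h5 h6 h7 h8
    obtain ⟨X, hX, hXcov⟩ := h.exists_cover_imageOn h5 h3 h4 hM (by omega) h2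
      ((Qset_anti hnL).trans (h7.trans (h8.trans h1))) (a := C * (4 * κ ^ 3 * (M + 1)) ^ e) (by
        refine Nat.le_of_mul_le_mul_left (h6.trans_eq ?_) (Nat.lt_of_lt_of_le Nat.zero_lt_one hL)
        ring)
    exact ⟨X, (Nat.le_div_iff_mul_le hM).2 (by rwa [mul_comm]), hXcov⟩
  obtain ⟨X, hX, hXcov⟩ := exists_internal_cover hcov
  refine ⟨internalSet fun i => _root_.imageOn (π i) (Qset (S 1 i) n'), l, internalSet_mono ?_,
    internalSet_mono ?_, X, ?_, ?_⟩
  · filter_upwards [hl, hS.eventually_anti (Nat.le_add_left l b)] with i h1 h2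
    exact imageOn_mono (h2.trans h1)
  · filter_upwards [hN₁] with i h1
    exact imageOn_mono ((Qset_anti hnn').trans h1)
  · calc M * X.card ≤ M * (8 * κ ^ 2 * (C * (4 * κ ^ 3 * (M + 1)) ^ e) / M) :=
          Nat.mul_le_mul_left _ hX
      _ ≤ 8 * κ ^ 2 * (C * (4 * κ ^ 3 * (M + 1)) ^ e) := Nat.mul_div_le _ _
      _ ≤ 8 * κ ^ 2 * (C * (8 * κ ^ 3 * M) ^ e) := by
          have : 4 * κ ^ 3 * (M + 1) ≤ 8 * κ ^ 3 * M :=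
            (Nat.mul_le_mul_left _ (show M + 1 ≤ 2 * M by omega)).trans_eq (by ring)
          gcongr
      _ = 8 * κ ^ 2 * (C * (8 * κ ^ 3) ^ e) * M ^ e := by ring
  · rwa [← internalSet_pow _ hM]

lemma virtuallyNilpotentCover_of_escapeGrowth (hS : GoodChain S) (hN : NoSmallSubgroups S) {e : ℕ}
    (he : EscapeGrowth S (e + 1))
    (ih : ∀ {H : ℕ → Type u} [∀ n, Group (H n)] {S' : ℕ → ∀ n, Set (H n)}, GoodChain S' →
      PolyGrowth S' e → VirtuallyNilpotentCover S') : VirtuallyNilpotentCover S := by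
  classical
  obtain ⟨κ, hκ⟩ := hS.eventually_escapeCalculus hN
  by_cases hcase : ∃ n, ∀ᶠ i in ultra, Qset (S 1 i) n ⊆ escapeCore (S 1 i)
  · obtain ⟨n, hn⟩ := hcase
    obtain ⟨k, hk⟩ := hS.eventually_subset_Qset n
    obtain ⟨m, hm⟩ := hS.cover k
    refine ⟨m, ?_⟩
    filter_upwards [hκ, hn, hk, hm] with i h h1 h2 ⟨X, hX, hcov⟩
    have : Finite h.core := h.finite_escapeCore
    exact ⟨h.core, .of_finite _, X, hX, hcov.trans (Set.mul_subset_mul_left (h2.trans h1))⟩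
  · have hne : ∀ n, ∀ᶠ i in ultra, ¬ Qset (S 1 i) n ⊆ escapeCore (S 1 i) := fun n =>
      Ultrafilter.eventually_not.2 fun hc => hcase ⟨n, hc⟩
    obtain ⟨b, hb⟩ := hS.eventually_subset_Qset (κ * (3 * κ))
    obtain ⟨Nb, hNb⟩ := hS.eventually_Qset_subset hN b
    obtain ⟨px, hpx⟩ := exists_forall_of_eventually_exists (α := fun i => ℕ × G i)
      (P := fun i q => q.2 ∈ Qset (S 1 i) q.1 ∧ q.2 ∉ escapeCore (S 1 i) ∧
        Qset (S 1 i) (q.1 + 1) ⊆ escapeCore (S 1 i)) (by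
        filter_upwards [hκ, hne 1] with i h h1
        obtain ⟨p, u, hpu⟩ := h.exists_maximal_escaping h1
        exact ⟨(p, u), hpu⟩)
    have hp : ∀ N, ∀ᶠ i in ultra, N ≤ (px i).1 := by
      intro N
      filter_upwards [hpx, hne N] with i h1 h2
      by_contra hc
      exact h2 ((Qset_anti (by omega)).trans h1.2.2)
    let Γ : ∀ i, Subgroup (G i) := fun i => Subgroup.closure (S b i)
    let N : ∀ i, Subgroup (Γ i) := fun i =>
      Subgroup.normalClosure {x : Γ i | (x : G i) ∈ escapeCore (S 1 i) ∨ (x : G i) = (px i).2}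
    have hbΓ : ∀ᶠ i in ultra, S b i ⊆ Γ i := Eventually.of_forall fun i => Subgroup.subset_closure
    have hpoly := hS.polyGrowth_imageOn hN he (π := fun i => QuotientGroup.mk' (N i)) hbΓ hp
      (hpx.mono fun i h => h.1)
      (hpx.mono fun i h hc => h.2.1 (h.2.2 hc)) (by
        filter_upwards [hpx, hbΓ, hNb, hp Nb] with i h1 h2 h3 h4
        have hxΓ : (px i).2 ∈ Γ i := h2 (h3 (Qset_anti h4 h1.1))
        have := (mem_kerOn (π := QuotientGroup.mk' (N i)) ⟨(px i).2, hxΓ⟩).2 (by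
          rw [QuotientGroup.mk'_apply, QuotientGroup.eq_one_iff]
          exact Subgroup.subset_normalClosure (Or.inr rfl))
        exact this)
    obtain ⟨m, hm⟩ := ih (hS.imageOn (fun i => QuotientGroup.mk' (N i)) b) hpoly
    obtain ⟨m', hm'⟩ := hS.cover b
    refine ⟨m' * m, ?_⟩
    filter_upwards [hκ, hm, hm', hpx, hp (2 * κ), hNb, hb, hS.eventually_anti (Nat.zero_le b)]
      with i h ⟨Γ₁, hΓ₁, X, hX, hcov⟩ ⟨Y, hY, hcov'⟩ h1 h2 h3 h4 h5
    obtain ⟨Γ₀, hΓ₀, Z, hZ, hcov''⟩ := h.exists_virtuallyNilpotent_cover h5 h4 h1.1 h1.2.2 h2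
      (fun g hg => h3 (hg _)) rfl rfl hΓ₁ hcov
    refine ⟨Γ₀, hΓ₀, Y * Z, Finset.card_mul_le.trans (Nat.mul_le_mul hY (hZ.trans hX)),
      hcov'.trans ?_⟩
    rw [Finset.coe_mul, mul_assoc]
    exact Set.mul_subset_mul_left hcov''

lemma virtuallyNilpotentCover_of_polyGrowth (e : ℕ) : ∀ {G : ℕ → Type u} [∀ n, Group (G n)]
    {S : ℕ → ∀ n, Set (G n)}, GoodChain S → PolyGrowth S e → VirtuallyNilpotentCover S := by
  induction e with
  | zero =>
    intro G _ S hS ⟨C, hC⟩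
    obtain ⟨U, l, hl, -, X, hX, hcov⟩ := hC (C + 1) (by omega) 0
    have h1 : (1 : ∀ n, G n) ∈ (X : Set (∀ n, G n)) * U :=
      hcov (Set.one_mem_pow (hl (hS.one_mem l)))
    obtain ⟨x, hx, -⟩ := h1
    have hX1 : 1 ≤ X.card := Finset.card_pos.2 ⟨x, hx⟩
    have := Nat.mul_le_mul_left (C + 1) hX1
    rw [pow_zero] at hX
    omega
  | succ e ih =>
    intro G _ S hS he
    obtain ⟨S', hS', hN, ⟨a, ha⟩, hpoly⟩ := hS.exists_noSmallSubgroups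
    exact .of_subset hS ha (hS'.virtuallyNilpotentCover_of_escapeGrowth hN
      (hS'.escapeGrowth hN (hpoly _ he)) ih)

/-- The initial term of a good chain is covered by boundedly many cosets of a virtually nilpotent
group. -/
theorem virtuallyNilpotentCover (hS : GoodChain S) : VirtuallyNilpotentCover S := by
  obtain ⟨S', hS', hN, ⟨a, ha⟩, -⟩ := hS.exists_noSmallSubgroups
  obtain ⟨e, C, hC⟩ := hS'.exists_escapeGrowth hN
  refine .of_subset hS ha (hS'.virtuallyNilpotentCover_of_escapeGrowth hN (e := e)
    ⟨C, fun M hM => ?_⟩ (virtuallyNilpotentCover_of_polyGrowth e))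
  obtain ⟨N, hN⟩ := hC M hM
  refine ⟨N, fun n hn => (hN n hn).mono fun i hi => hi.trans ?_⟩
  gcongr
  · omega

end GoodChain

end InductionStep

section SmallPowers

open Finset

universe u

lemma sum_card_inter_smul {G : Type*} [Group G] [DecidableEq G] {A B P : Finset G}
    (h : A * B⁻¹ ⊆ P) : ∑ g ∈ P, #(A ∩ g • B) = #A * #B := by
  simp only [card_inter_smul]
  rw [← card_inv B, ← card_product]
  exact (card_eq_sum_card_fiberwise fun q hq =>
    h (mul_mem_mul (mem_product.1 hq).1 (mem_product.1 hq).2)).symm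

lemma card_sdiff_smul_le {G : Type*} [Group G] [DecidableEq G] {X E : Finset G} {δ : ℕ}
    (hX : ∀ g ∈ X, #(E \ g • E) ≤ δ) (m : ℕ) : ∀ g ∈ X ^ m, #(E \ g • E) ≤ m * δ := by
  induction m with
  | zero =>
    intro g hg
    rw [pow_zero, mem_one] at hg
    simp [hg]
  | succ m ih =>
    intro g hg
    rw [pow_succ', mem_mul] at hg
    obtain ⟨x, hx, y, hy, rfl⟩ := hg
    have h1 : E \ (x * y) • E ⊆ (E \ x • E) ∪ x • (E \ y • E) := by
      rw [smul_finset_sdiff, smul_smul]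
      intro z hz
      simp only [mem_union, mem_sdiff] at hz ⊢
      tauto
    calc #(E \ (x * y) • E) ≤ #(E \ x • E) + #(x • (E \ y • E)) :=
          (card_le_card h1).trans (card_union_le _ _)
      _ ≤ δ + m * δ := by
          rw [card_smul_finset]
          exact add_le_add (hX x hx) (ih y hy)
      _ = (m + 1) * δ := by ring

/-- A set of small doubling contains, up to a bounded power, a large set all of whose products of
`m` elements are controlled. -/
theorem exists_pow_subset_pow_four (m k : ℕ) (hm : 1 ≤ m) :
    ∃ c : ℕ, ∀ {G : Type u} [Group G] [DecidableEq G] (T : Finset G), T⁻¹ = T → 1 ∈ T →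
      #(T ^ 2) ≤ k * #T → ∃ X : Finset G, X⁻¹ = X ∧ 1 ∈ X ∧ X ^ m ⊆ T ^ 4 ∧ #T ≤ c * #X := by
  let s : ℕ → ℕ := fun j => Nat.rec 1 (fun _ t => 2 * k * t ^ 2) j
  have hs0 : s 0 = 1 := rfl
  have hs : ∀ j, s (j + 1) = 2 * k * s j ^ 2 := fun j => rfl
  refine ⟨2 * ∑ j ∈ range (m * k), s j, fun {G} _ _ T hT h1 hk => ?_⟩
  have hTpos : 0 < #T := card_pos.2 ⟨1, h1⟩
  have hkpos : 0 < k := by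
    refine Nat.pos_of_ne_zero fun h0 => ?_
    rw [h0, zero_mul, Nat.le_zero, card_eq_zero] at hk
    exact (Finset.nonempty_iff_ne_empty.1 ⟨_, pow_mem_pow h1⟩) hk
  have hspos : ∀ j, 0 < s j := by
    intro j
    induction j with
    | zero => simp [hs0]
    | succ j ih => rw [hs]; positivity
  let P : ℕ → Set ℕ := fun j => {n | ∃ B ⊆ T, #T ≤ s j * #B ∧ #(B * T) = n}
  have hPne : ∀ j, (P j).Nonempty := fun j =>
    ⟨_, T, subset_rfl, Nat.le_mul_of_pos_left _ (hspos j), rfl⟩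
  have hmem : ∀ j, sInf (P j) ∈ P j := fun j => Nat.sInf_mem (hPne j)
  have hge : ∀ j, #T ≤ sInf (P j) := by
    intro j
    obtain ⟨B, -, hB, hBn⟩ := hmem j
    rw [← hBn]
    exact card_le_card_mul_left (card_pos.1 (Nat.pos_of_mul_pos_left (hTpos.trans_le hB)))
  obtain ⟨j, hj, hjF⟩ : ∃ j < m * k, m * sInf (P j) < sInf (P j) + m * sInf (P (j + 1)) := by
    by_contra! hcon
    have hind : ∀ j ≤ m * k, j * #T + m * sInf (P j) ≤ m * sInf (P 0) := by
      intro j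
      induction j with
      | zero => simp
      | succ j ih =>
        intro hj
        have h2 := ih (by omega)
        have h3 := hcon j hj
        have h4 := hge j
        rw [add_one_mul]
        omega
    have h2 := hind _ le_rfl
    have h3 : sInf (P 0) ≤ k * #T :=
      (Nat.sInf_le (show #(T * T) ∈ P 0 from ⟨T, subset_rfl, by simp [hs0], rfl⟩)).trans
        (by rwa [← sq])
    have h4 := Nat.mul_le_mul_left m h3
    have h5 : 0 < m * sInf (P (m * k)) := Nat.mul_pos hm (hTpos.trans_le (hge _))
    rw [mul_assoc] at h2
    omega
  obtain ⟨B, hBT, hB, hBF⟩ := hmem j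
  have hBpos : 0 < #B := Nat.pos_of_mul_pos_left (hTpos.trans_le hB)
  let X := {g ∈ T ^ 2 | #T ≤ s (j + 1) * #(B ∩ g • B)}
  have hXinv : ∀ g ∈ X, g⁻¹ ∈ X := by
    intro g hg
    obtain ⟨h2, h3⟩ := mem_filter.1 hg
    refine mem_filter.2 ⟨?_, ?_⟩
    · rw [← hT, inv_pow]
      exact inv_mem_inv h2
    · have e : #(B ∩ g⁻¹ • B) = #(B ∩ g • B) := by
        rw [← card_smul_finset g (B ∩ g⁻¹ • B), smul_finset_inter, smul_inv_smul, inter_comm]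
      rwa [e]
  have hdiff : ∀ g ∈ X, #((B * T) \ (g • (B * T))) ≤ sInf (P j) - sInf (P (j + 1)) := by
    intro g hg
    obtain ⟨h2, h3⟩ := mem_filter.1 hg
    have h4 : sInf (P (j + 1)) ≤ #((B * T) ∩ (g • (B * T))) :=
      (Nat.sInf_le (show #((B ∩ g • B) * T) ∈ P (j + 1) from
        ⟨B ∩ g • B, inter_subset_left.trans hBT, h3, rfl⟩)).trans
        (card_le_card (subset_inter (mul_subset_mul_right inter_subset_left)
          (by rw [← smul_mul_assoc]; exact mul_subset_mul_right inter_subset_right)))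
    have h5 := card_sdiff_add_card_inter (B * T) (g • (B * T))
    omega
  refine ⟨X, ?_, ?_, ?_, ?_⟩
  · ext g
    rw [mem_inv']
    exact ⟨fun h => inv_inv g ▸ hXinv _ h, hXinv g⟩
  · refine mem_filter.2 ⟨one_mem_pow h1, ?_⟩
    rw [one_smul, inter_self, hs]
    refine hB.trans (Nat.mul_le_mul_right _ ?_)
    have h2 := hspos j
    have h3 : 1 * s j ≤ (2 * k * s j) * s j := Nat.mul_le_mul_right _ (by
      have : 0 < 2 * k * s j := by positivity
      omega)
    calc s j ≤ (2 * k * s j) * s j := by omega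
      _ = _ := by ring
  · intro g hg
    have h2 := card_sdiff_smul_le hdiff m g hg
    have h3 : ¬ Disjoint (B * T) (g • (B * T)) := by
      intro h
      rw [sdiff_eq_self_of_disjoint h, hBF, Nat.mul_sub] at h2
      have := (hTpos.trans_le (hge j))
      omega
    rw [not_disjoint_iff] at h3
    obtain ⟨x, hx, hx'⟩ := h3
    obtain ⟨y, hy, rfl⟩ := mem_smul_finset.1 hx'
    have hBT2 : B * T ⊆ T ^ 2 := by rw [sq]; exact mul_subset_mul_right hBT
    have h4 : y⁻¹ ∈ T ^ 2 := by
      rw [← hT, inv_pow]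
      exact inv_mem_inv (hBT2 hy)
    have h5 := mul_mem_mul (hBT2 hx) h4
    rw [← pow_add] at h5
    simpa using h5
  · have hsum := sum_card_inter_smul (A := B) (B := B) (P := T ^ 2) (by
      rw [sq]
      exact mul_subset_mul hBT (by rw [← hT]; exact inv_subset_inv hBT))
    rw [← sum_filter_add_sum_filter_not (T ^ 2) fun g => #T ≤ s (j + 1) * #(B ∩ g • B)] at hsum
    have h2 : ∑ g ∈ X, #(B ∩ g • B) ≤ #X * #B :=
      (sum_le_card_nsmul _ _ _ fun g _ => card_le_card inter_subset_left).trans_eq (by simp)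
    have h3 : s (j + 1) * ∑ g ∈ T ^ 2 with ¬ #T ≤ s (j + 1) * #(B ∩ g • B), #(B ∩ g • B) ≤
        k * #T * #T := by
      rw [mul_sum]
      refine (sum_le_card_nsmul _ _ #T fun g hg => (not_le.1 (mem_filter.1 hg).2).le).trans ?_
      rw [smul_eq_mul]
      exact Nat.mul_le_mul_right _ ((card_filter_le _ _).trans hk)
    have h4 : k * #T * #T ≤ k * (s j * #B) * (s j * #B) := by gcongr
    have h5 : #B ≤ 2 * #X := by
      have h6 : (k * s j ^ 2 * #B) * (2 * #B) ≤ (k * s j ^ 2 * #B) * (2 * #X + #B) := by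
        calc (k * s j ^ 2 * #B) * (2 * #B) = s (j + 1) * (#B * #B) := by rw [hs]; ring
          _ ≤ s (j + 1) * (#X * #B) + k * (s j * #B) * (s j * #B) := by
            rw [← hsum, mul_add]
            exact add_le_add (Nat.mul_le_mul_left _ h2) (h3.trans h4)
          _ = _ := by rw [hs]; ring
      have := Nat.le_of_mul_le_mul_left h6 (by have := hspos j; positivity)
      omega
    calc #T ≤ s j * #B := hB
      _ ≤ s j * (2 * #X) := Nat.mul_le_mul_left _ h5
      _ ≤ (∑ j ∈ range (m * k), s j) * (2 * #X) :=
        Nat.mul_le_mul_right _ (single_le_sum (fun _ _ => Nat.zero_le _) (mem_range.2 hj))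
      _ = _ := by ring

end SmallPowers

section ChainConstruction

open Finset

universe u

lemma exists_subset_translates {G : Type*} [Group G] [DecidableEq G] {C c : ℕ} {R T : Finset G}
    (hR : R⁻¹ = R) (hR1 : 1 ∈ R) (hRC : #(R ^ 12) ≤ C * #R) (hT : T⁻¹ = T)
    (hTR : T ⊆ R ^ 4) (hT1 : 1 ∈ T) (hc : #R ≤ c * #T) (F : Finset G) (hF : F ⊆ R ^ 4) :
    ∃ D ⊆ T, #R ≤ c * (c * C) ^ #F * #D ∧ ∀ x ∈ F, ∃ z, ∀ d ∈ D, ∃ t ∈ T, d = z * t * x := by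
  induction F using Finset.induction_on with
  | empty => exact ⟨T, subset_rfl, by simpa using hc, by simp⟩
  | insert x F hx ih =>
    obtain ⟨D, hDT, hD, hDF⟩ := ih ((subset_insert _ _).trans hF)
    have hsub : D * (T * {x})⁻¹ ⊆ R ^ 12 := by
      rw [mul_inv_rev, hT, show 12 = 4 + (4 + 4) from rfl, pow_add, pow_add]
      refine mul_subset_mul (hDT.trans hTR) (mul_subset_mul ?_ hTR)
      rw [← hR, inv_pow]
      exact inv_subset_inv (singleton_subset_iff.2 (hF (mem_insert_self _ _)))
    have hsum := sum_card_inter_smul hsub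
    obtain ⟨g, hg, hmax⟩ := exists_max_image (R ^ 12) (fun g => #(D ∩ g • (T * {x})))
      ⟨1, one_mem_pow hR1⟩
    have h1 : #D * #T ≤ C * (c * #T) * #(D ∩ g • (T * {x})) := by
      calc #D * #T = ∑ g ∈ R ^ 12, #(D ∩ g • (T * {x})) := by rw [hsum, card_mul_singleton]
        _ ≤ #(R ^ 12) * #(D ∩ g • (T * {x})) := by simpa using sum_le_card_nsmul _ _ _ hmax
        _ ≤ _ := Nat.mul_le_mul_right _ (hRC.trans (Nat.mul_le_mul_left _ hc))
    have h2 : #D ≤ c * C * #(D ∩ g • (T * {x})) := by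
      refine Nat.le_of_mul_le_mul_right (h1.trans_eq ?_) (card_pos.2 ⟨1, hT1⟩)
      ring
    refine ⟨D ∩ g • (T * {x}), inter_subset_left.trans hDT, ?_, fun y hy => ?_⟩
    · rw [card_insert_of_notMem hx]
      calc #R ≤ c * (c * C) ^ #F * #D := hD
        _ ≤ c * (c * C) ^ #F * (c * C * #(D ∩ g • (T * {x}))) := Nat.mul_le_mul_left _ h2
        _ = _ := by ring
    · rcases mem_insert.1 hy with rfl | hy
      · refine ⟨g, fun d hd => ?_⟩
        obtain ⟨w, hw, rfl⟩ := mem_smul_finset.1 (mem_inter.1 hd).2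
        obtain ⟨t, ht, y', hy', rfl⟩ := mem_mul.1 hw
        rw [mem_singleton] at hy'
        exact ⟨t, ht, by rw [hy', smul_eq_mul, mul_assoc]⟩
      · obtain ⟨z, hz⟩ := hDF y hy
        exact ⟨z, fun d hd => hz d (mem_inter.1 hd).1⟩

lemma exists_cover_pow_four {G : Type*} [Group G] [DecidableEq G] {C c : ℕ} {R T : Finset G}
    (hR1 : 1 ∈ R) (hRC : #(R ^ 12) ≤ C * #R) (hT : T⁻¹ = T)
    (hTR : T ⊆ R ^ 4) (hT1 : 1 ∈ T) (hc : #R ≤ c * #T) :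
    ∃ F ⊆ R ^ 4, #F ≤ C * c ∧ R ^ 4 ⊆ F * T ^ 2 := by
  have h1 : #(R ^ 4 * T) ≤ C * c * #T := by
    calc #(R ^ 4 * T) ≤ #(R ^ 12) := by
          refine card_le_card ((mul_subset_mul_left hTR).trans ?_)
          rw [← pow_add]
          exact pow_subset_pow_right hR1 (by omega)
      _ ≤ C * (c * #T) := hRC.trans (Nat.mul_le_mul_left _ hc)
      _ = _ := (mul_assoc _ _ _).symm
  obtain ⟨F, hF, hFC, hcov⟩ := ruzsa_covering_mul (A := R ^ 4) (K := ((C * c : ℕ) : ℝ))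
    ⟨1, hT1⟩ (by exact_mod_cast h1)
  refine ⟨F, hF, by exact_mod_cast hFC, ?_⟩
  rwa [div_eq_mul_inv, hT, ← sq] at hcov

theorem exists_next_in_chain (C c : ℕ) : ∃ c' : ℕ, ∀ {G : Type u} [Group G] [DecidableEq G]
    (R T : Finset G), R⁻¹ = R → 1 ∈ R → #(R ^ 12) ≤ C * #R → T⁻¹ = T → 1 ∈ T → T ^ 4 ⊆ R ^ 4 →
    #R ≤ c * #T → ∃ P : Finset G, P⁻¹ = P ∧ 1 ∈ P ∧ #R ≤ c' * #P ∧ P ^ 8 ⊆ T ^ 4 ∧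
      ∀ a ∈ R ^ 4, ∀ s ∈ P ^ 4, a * s * a⁻¹ ∈ T ^ 4 := by
  obtain ⟨c₁, hc₁⟩ := exists_pow_subset_pow_four 24 (C * c) (by norm_num)
  refine ⟨c * c₁ * (c * c₁ * C) ^ (C * (c * c₁)), fun {G} _ _ R T hR hR1 hRC hT hT1 hTR hc => ?_⟩
  have hRpos : 0 < #R := card_pos.2 ⟨1, hR1⟩
  obtain ⟨X, hX, hX1, hXT, hTX⟩ := hc₁ T hT hT1 (by
    calc #(T ^ 2) ≤ #(R ^ 12) := card_le_card (((pow_subset_pow_right hT1 (by omega)).trans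
          hTR).trans (pow_subset_pow_right hR1 (by omega)))
      _ ≤ C * (c * #T) := hRC.trans (Nat.mul_le_mul_left _ hc)
      _ = _ := (mul_assoc _ _ _).symm)
  have hXR : X ⊆ R ^ 4 := (subset_pow hX1 (by norm_num)).trans (hXT.trans hTR)
  have hRX : #R ≤ c * c₁ * #X := by
    rw [mul_assoc]
    exact hc.trans (Nat.mul_le_mul_left _ hTX)
  obtain ⟨F, hFR, hFC, hcov⟩ := exists_cover_pow_four hR1 hRC hX hXR hX1 hRX
  have hR4 : (R ^ 4)⁻¹ = R ^ 4 := by rw [← inv_pow, hR]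
  obtain ⟨D, hDX, hD, hDF⟩ := exists_subset_translates hR hR1 hRC hX hXR hX1 hRX F⁻¹
    (by rw [← hR4]; exact inv_subset_inv hFR)
  have hDpos : 0 < #D := Nat.pos_of_mul_pos_left (hRpos.trans_le hD)
  obtain ⟨d₀, hd₀⟩ := card_pos.1 hDpos
  have hpos : 0 < c * c₁ * C := by
    have h1 : 0 < c * c₁ := Nat.pos_of_mul_pos_right (hRpos.trans_le hRX)
    have h2 : 0 < C := Nat.pos_of_mul_pos_right
      ((card_pos.2 ⟨1, one_mem_pow hR1⟩).trans_le hRC)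
    positivity
  have hPX : D⁻¹ * D ⊆ X ^ 2 := by
    rw [sq]
    refine mul_subset_mul ?_ hDX
    rw [← hX]
    exact inv_subset_inv hDX
  refine ⟨D⁻¹ * D, by rw [mul_inv_rev, inv_inv], mem_mul.2
    ⟨d₀⁻¹, inv_mem_inv hd₀, d₀, hd₀, inv_mul_cancel _⟩, ?_, ?_, fun a ha s hs => ?_⟩
  · refine hD.trans (Nat.mul_le_mul (Nat.mul_le_mul_left _ (Nat.pow_le_pow_right hpos ?_))
      (card_le_card_mul_left ⟨d₀⁻¹, inv_mem_inv hd₀⟩))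
    rwa [card_inv]
  · refine (pow_subset_pow_left hPX).trans ?_
    rw [← pow_mul]
    exact (pow_subset_pow_right hX1 (by norm_num)).trans hXT
  · have hconj : (D⁻¹ * D).image (MulAut.conj a) ⊆ X ^ 6 := by
      intro y hy
      obtain ⟨q, hq, rfl⟩ := mem_image.1 hy
      obtain ⟨d, hd, d', hd', rfl⟩ := mem_mul.1 hq
      obtain ⟨f, hf, t, ht, hft⟩ := mem_mul.1 (hcov (by rw [← hR4]; exact inv_mem_inv ha))
      obtain ⟨z, hz⟩ := hDF f⁻¹ (inv_mem_inv hf)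
      obtain ⟨t₁, ht₁, h1⟩ := hz _ (mem_inv'.1 hd)
      obtain ⟨t₂, ht₂, rfl⟩ := hz _ hd'
      have ea : a = t⁻¹ * f⁻¹ := by rw [← mul_inv_rev, hft, inv_inv]
      have ed : d = (z * t₁ * f⁻¹)⁻¹ := by rw [← h1, inv_inv]
      have e : MulAut.conj a (d * (z * t₂ * f⁻¹)) = t⁻¹ * (t₁⁻¹ * t₂) * t := by
        rw [MulAut.conj_apply, ea, ed]
        group
      have hX2 : (X ^ 2)⁻¹ = X ^ 2 := by rw [← inv_pow, hX]
      rw [e, show 6 = 2 + 2 + 2 from rfl, pow_add, pow_add]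
      refine mul_mem_mul (mul_mem_mul ?_ ?_) ht
      · rw [← hX2]
        exact inv_mem_inv ht
      · rw [sq]
        refine mul_mem_mul ?_ ht₂
        rw [← hX]
        exact inv_mem_inv ht₁
    have h1 : MulAut.conj a s ∈ ((D⁻¹ * D).image (MulAut.conj a)) ^ 4 := by
      rw [← image_pow]
      exact mem_image_of_mem _ hs
    have h2 := pow_subset_pow_left hconj h1
    rw [← pow_mul] at h2
    exact hXT h2

/-- A set of small doubling is covered by boundedly many translates of the initial term of a chain
of symmetric sets resembling a neighbourhood basis. -/
theorem exists_chain (C : ℕ) : ∃ c : ℕ → ℕ, ∀ {G : Type u} [Group G] [DecidableEq G]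
    (R : Finset G), R⁻¹ = R → 1 ∈ R → #(R ^ 12) ≤ C * #R → ∃ T : ℕ → Finset G, T 0 = R ∧
      ∀ k, ((T k)⁻¹ = T k ∧ 1 ∈ T k ∧ T k ^ 4 ⊆ R ^ 4 ∧ #R ≤ c k * #(T k)) ∧
        T (k + 1) ^ 8 ⊆ T k ^ 4 ∧ ∀ a ∈ R ^ 4, ∀ s ∈ T (k + 1) ^ 4, a * s * a⁻¹ ∈ T k ^ 4 := by
  choose f hf using exists_next_in_chain.{u} C
  let c : ℕ → ℕ := fun k => Nat.rec 1 (fun _ => f) k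
  refine ⟨c, fun {G} _ _ R hR hR1 hRC => ?_⟩
  have : ∀ c (T : Finset G), ∃ P : Finset G, T⁻¹ = T ∧ 1 ∈ T ∧ T ^ 4 ⊆ R ^ 4 ∧ #R ≤ c * #T →
      (P⁻¹ = P ∧ 1 ∈ P ∧ P ^ 4 ⊆ R ^ 4 ∧ #R ≤ f c * #P) ∧
      P ^ 8 ⊆ T ^ 4 ∧ ∀ a ∈ R ^ 4, ∀ s ∈ P ^ 4, a * s * a⁻¹ ∈ T ^ 4 := by
    intro c T
    by_cases h : T⁻¹ = T ∧ 1 ∈ T ∧ T ^ 4 ⊆ R ^ 4 ∧ #R ≤ c * #T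
    · obtain ⟨P, h1, h2, h3, h4, h5⟩ := hf c R T hR hR1 hRC h.1 h.2.1 h.2.2.1 h.2.2.2
      exact ⟨P, fun _ => ⟨⟨h1, h2, ((pow_subset_pow_right h2 (by norm_num)).trans h4).trans
        h.2.2.1, h3⟩, h4, h5⟩⟩
    · exact ⟨1, fun h' => absurd h' h⟩
  choose P hP using this
  let T : ℕ → Finset G := fun k => Nat.rec R (fun k T => P (c k) T) k
  have hT : ∀ k, (T k)⁻¹ = T k ∧ 1 ∈ T k ∧ T k ^ 4 ⊆ R ^ 4 ∧ #R ≤ c k * #(T k) := by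
    intro k
    induction k with
    | zero => exact ⟨hR, hR1, subset_rfl, (one_mul _).ge⟩
    | succ k ih => exact (hP (c k) (T k) ih).1
  exact ⟨T, rfl, fun k => ⟨hT k, (hP (c k) (T k) (hT k)).2⟩⟩

/-- A set of small doubling is covered by boundedly many translates of a symmetric set with small
powers. -/
theorem exists_symmetric_cover (K : ℝ) : ∃ C : ℕ, ∀ {G : Type u} [Group G] [DecidableEq G]
    (A : Finset G), A.Nonempty → (#(A * A) : ℝ) ≤ K * #A →
    ∃ R : Finset G, R⁻¹ = R ∧ 1 ∈ R ∧ #(R ^ 12) ≤ C * #R ∧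
      ∃ F : Finset G, #F ≤ C ∧ A ⊆ F * R := by
  refine ⟨⌈K ^ 2⌉₊ + ⌈(((K ^ 2) ^ 12) ^ 10)⌉₊, fun {G} _ _ A hA hK => ?_⟩
  obtain ⟨X, hX, hmin⟩ := exists_min_image {U ∈ A.powerset | U.Nonempty}
    (fun U => (#(U * A) : ℝ) / #U) ⟨A, mem_filter.2 ⟨mem_powerset_self _, hA⟩⟩
  obtain ⟨hXA, hXne⟩ := mem_filter.1 hX
  rw [mem_powerset] at hXA
  have hApos : (0 : ℝ) < #A := by exact_mod_cast card_pos.2 hA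
  have hXpos : (0 : ℝ) < #X := by exact_mod_cast card_pos.2 hXne
  have hXK : (#(X * A) : ℝ) ≤ K * #X := by
    have h1 := hmin A (mem_filter.2 ⟨mem_powerset_self _, hA⟩)
    rw [div_le_div_iff₀ hXpos hApos] at h1
    refine le_of_mul_le_mul_right (h1.trans ?_) hApos
    nlinarith
  have hK0 : 0 ≤ K := nonneg_of_mul_nonneg_left ((Nat.cast_nonneg _).trans hXK) hXpos
  have hpet : #(X * X * A) * #X ≤ #(X * A) * #(X * X) := by
    refine pluennecke_petridis_inequality_mul X fun X' hX' => ?_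
    rcases X'.eq_empty_or_nonempty with rfl | hne
    · simp
    have hpos : (0 : ℝ) < #X' := by exact_mod_cast card_pos.2 hne
    have h1 := hmin X' (mem_filter.2 ⟨mem_powerset.2 (hX'.trans hXA), hne⟩)
    rw [div_le_div_iff₀ hXpos hpos] at h1
    exact_mod_cast h1
  have htrip : (#(X ^ 3) : ℝ) ≤ K ^ 2 * #X := by
    have h1 : (#(X ^ 3) : ℝ) ≤ #(X * X * A) := by
      rw [pow_succ, sq]
      exact_mod_cast card_le_card (mul_subset_mul_left hXA)
    have h2 : (#(X * X) : ℝ) ≤ #(X * A) := by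
      exact_mod_cast card_le_card (mul_subset_mul_left hXA)
    refine h1.trans (le_of_mul_le_mul_right ?_ hXpos)
    calc (#(X * X * A) : ℝ) * #X ≤ #(X * A) * #(X * X) := by exact_mod_cast hpet
      _ ≤ (K * #X) * (K * #X) := by
        gcongr
        exact h2.trans hXK
      _ = _ := by ring
  have hAX : (#A : ℝ) ≤ K * #X :=
    hXK.trans' (by exact_mod_cast card_le_card_mul_left hXne)
  obtain ⟨F, -, hF, hcov⟩ := ruzsa_covering_mul (A := A) (K := K ^ 2) hXne (by
    calc (#(A * X) : ℝ) ≤ #(A * A) := by exact_mod_cast card_le_card (mul_subset_mul_left hXA)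
      _ ≤ K * (K * #X) := hK.trans (by gcongr)
      _ = _ := by ring)
  obtain ⟨x, hx⟩ := hXne
  have hR : (X / X)⁻¹ = X / X := inv_div _ _
  have h6 := small_alternating_pow_of_small_tripling (m := 6) (by norm_num) htrip
    (fun i => (-1) ^ (i : ℕ)) (fun i => by simp)
  have hR3 : (#((X / X) ^ 3) : ℝ) ≤ (K ^ 2) ^ 12 * #(X / X) := by
    calc (#((X / X) ^ 3) : ℝ) ≤ (K ^ 2) ^ 12 * #X := by
          refine h6.trans_eq' ?_
          simp [List.finRange_succ, pow_succ, div_eq_mul_inv, mul_assoc]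
      _ ≤ _ := by
        refine mul_le_mul_of_nonneg_left ?_ (by positivity)
        exact_mod_cast card_le_card_div_right ⟨x, hx⟩
  have hR12 := small_pow_of_small_tripling (m := 12) (by norm_num) hR3 hR
  refine ⟨X / X, hR, mem_div.2 ⟨x, hx, x, hx, div_self' x⟩, ?_, F, ?_, hcov⟩
  · have h1 : (#((X / X) ^ 12) : ℝ) ≤ (⌈((K ^ 2) ^ 12) ^ 10⌉₊ : ℝ) * #(X / X) :=
      hR12.trans (by gcongr; exact Nat.le_ceil _)
    have h2 : #((X / X) ^ 12) ≤ ⌈((K ^ 2) ^ 12) ^ 10⌉₊ * #(X / X) := by exact_mod_cast h1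
    exact h2.trans (Nat.mul_le_mul_right _ (Nat.le_add_left _ _))
  · have h1 : #F ≤ ⌈K ^ 2⌉₊ := by exact_mod_cast hF.trans (Nat.le_ceil _)
    exact h1.trans (Nat.le_add_right _ _)

end ChainConstruction

section SmallDoubling

open Filter Finset

universe u

/-- Sets of small doubling in a sequence of groups are covered by boundedly many cosets of
virtually nilpotent groups. -/
theorem exists_virtuallyNilpotent_cover_of_small_doubling {G : ℕ → Type u} [∀ n, Group (G n)]
    [∀ n, DecidableEq (G n)] {K : ℝ} (A : ∀ n, Finset (G n)) (hA : ∀ n, (A n).Nonempty)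
    (hK : ∀ n, (#(A n * A n) : ℝ) ≤ K * #(A n)) :
    ∃ m : ℕ, ∀ᶠ i in ultra, ∃ Γ₀ : Subgroup (G i), IsVirtuallyNilpotent Γ₀ ∧
      ∃ X : Finset (G i), #X ≤ m ∧ (A i : Set (G i)) ⊆ (X : Set (G i)) * (Γ₀ : Set (G i)) := by
  obtain ⟨C, hC⟩ := exists_symmetric_cover.{u} K
  obtain ⟨c, hc⟩ := exists_chain.{u} C
  choose R hR hR1 hRC F hF hcov using fun n => hC (A n) (hA n) (hK n)
  choose T hT0 hT hT' using fun n => hc (R n) (hR n) (hR1 n) (hRC n)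
  have hS : GoodChain fun k n => ((T n k ^ 4 : Finset (G n)) : Set (G n)) :=
    { one := fun k => Eventually.of_forall fun n => one_mem_pow (hT n k).2.1
      inv := fun k => Eventually.of_forall fun n => by rw [← coe_inv, ← inv_pow, (hT n k).1]
      mul := fun k => Eventually.of_forall fun n => by
        rw [← coe_mul, ← pow_add]
        exact_mod_cast (hT' n k).1
      conj := fun k => Eventually.of_forall fun n a ha s hs =>
        (hT' n k).2 a (by rw [← hT0 n]; exact ha) s hs
      fin := Eventually.of_forall fun n => finite_toSet _
      cover := fun k => ⟨C * c k, Eventually.of_forall fun n => by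
        obtain ⟨h1, h2, h3, h4⟩ := hT n k
        obtain ⟨X, -, hX, hXcov⟩ := exists_cover_pow_four (hR1 n) (hRC n) h1
          ((subset_pow h2 (by norm_num)).trans h3) h2 h4
        refine ⟨X, hX, ?_⟩
        rw [hT0, ← coe_mul]
        exact_mod_cast hXcov.trans (mul_subset_mul_left (pow_subset_pow_right h2 (by norm_num)))⟩ }
  obtain ⟨m, hm⟩ := hS.virtuallyNilpotentCover
  refine ⟨C * m, hm.mono fun n ⟨Γ₀, hΓ₀, X, hX, hXcov⟩ => ⟨Γ₀, hΓ₀, F n * X,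
    card_mul_le.trans (Nat.mul_le_mul (hF n) hX), ?_⟩⟩
  rw [coe_mul, mul_assoc]
  refine Set.Subset.trans ?_ (Set.mul_subset_mul_left hXcov)
  beta_reduce
  rw [hT0, ← coe_mul]
  exact_mod_cast (hcov n).trans (mul_subset_mul_left (subset_pow (hR1 n) (by norm_num)))

lemma exists_coset_of_cover {G : Type*} [Group G] {A X : Finset G} (hA : A.Nonempty)
    {Γ₀ : Subgroup G} {n : ℕ} (hX : #X ≤ n)
    (hcov : (A : Set G) ⊆ (X : Set G) * (Γ₀ : Set G)) :
    ∃ g : G, ((((A : Set G) ∩ (g • (Γ₀ : Set G))).ncard : ℝ) ≥ (#A : ℝ) / n) := by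
  classical
  by_contra! hcon
  have hA0 : 0 < #A := card_pos.2 hA
  have h1 : (#A : ℝ) ≤ ∑ g ∈ X, (((A : Set G) ∩ (g • (Γ₀ : Set G))).ncard : ℝ) := by
    have h2 : (A : Set G) ⊆ ⋃ g ∈ X, (A : Set G) ∩ (g • (Γ₀ : Set G)) := by
      intro a ha
      obtain ⟨x, hx, y, hy, rfl⟩ := hcov ha
      exact Set.mem_biUnion hx ⟨ha, y, hy, rfl⟩
    have h3 := (Set.ncard_le_ncard h2 (X.finite_toSet.biUnion fun g _ =>
      A.finite_toSet.inter_of_left _)).trans (set_ncard_biUnion_le X _)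
    rw [Set.ncard_coe_finset] at h3
    exact_mod_cast h3
  have hXne : X.Nonempty := by
    obtain ⟨a, ha⟩ := hA
    obtain ⟨x, hx, -⟩ := hcov ha
    exact ⟨x, hx⟩
  have hn : (0 : ℝ) < n := by exact_mod_cast (card_pos.2 hXne).trans_le hX
  have h2 : (#A : ℝ) < ∑ _g ∈ X, (#A : ℝ) / n :=
    h1.trans_lt (sum_lt_sum_of_nonempty hXne fun g _ => hcon g)
  rw [sum_const, nsmul_eq_mul, ← mul_div_assoc, lt_div_iff₀ hn, mul_comm] at h2
  have h3 : (#X : ℝ) ≤ n := by exact_mod_cast hX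
  nlinarith

end SmallDoubling

/-- **Structure theorem for sets of small doubling (weak version).**
For every `K ≥ 1` there exists `C(K) ≥ 1` such that for every group `G` and every finite
nonempty subset `A ⊆ G` with `|A·A| ≤ K|A|`, some coset `gΓ₀` of a virtually nilpotent
subgroup `Γ₀ ≤ G` intersects `A` in a set of size at least `|A|/C(K)`. -/
theorem bgt_structure_theorem_weak :
    ∀ K : ℝ, 1 ≤ K → ∃ C : ℝ, 1 ≤ C ∧
      ∀ (G : Type*) [Group G] [DecidableEq G] (A : Finset G), A.Nonempty →
        ((A * A).card : ℝ) ≤ K * A.card →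
        ∃ (Γ₀ : Subgroup G) (g : G), IsVirtuallyNilpotent Γ₀ ∧
          ((((A : Set G) ∩ (g • (Γ₀ : Set G))).ncard : ℝ) ≥ (A.card : ℝ) / C) := by
  intro K _
  by_contra! hcon
  choose G hG hD A hA hAK hAΓ using fun n : ℕ => hcon (n + 1) (by simp)
  obtain ⟨m, hm⟩ := exists_virtuallyNilpotent_cover_of_small_doubling A hA hAK
  obtain ⟨n, hmn, Γ₀, hΓ₀, X, hX, hcov⟩ := ((ultra_eventually_ge m).and hm).exists
  obtain ⟨g, hg⟩ := exists_coset_of_cover (n := n + 1) (hA n) (by omega) hcov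
  refine absurd hg (not_le.2 ?_)
  push_cast
  exact hAΓ n Γ₀ g hΓ₀
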